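/- arXiv:1511.00648 — 3 statements merged into one kernel-verified Lean document; each statement's English description precedes it below -/
import Mathlib

section
/- For every integer d ≥ 1 and every p₀ ∈ (0, 1/2] there exists n₀ depending only on d and p₀ such that for all n ≥ n₀, all p ∈ [p₀, 1−p₀] with pn an integer, and every degree-at-most-d multilinear polynomial f in the φ-basis on n variables, E_{D_p}[f⁴] ≤ 3 · d^{3/2} · (256 · (((1−p)/p)² + (p/(1−p))²)²)^d · ‖f‖₂⁴. -/
open Finset

/-- The value of the biased character `φ_i` at a Boolean coordinate value. -/
noncomputable def phi (p : ℝ) (b : Bool) : ℝ :=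
  if b then Real.sqrt (p / (1 - p)) else -Real.sqrt ((1 - p) / p)

/-- Evaluation of a multilinear polynomial in the φ-basis given its coefficients. -/
noncomputable def evalPhi {n : ℕ} (p : ℝ) (c : Finset (Fin n) → ℝ) (σ : Fin n → Bool) : ℝ :=
  ∑ S : Finset (Fin n), c S * ∏ i ∈ S, phi p (σ i)

/-- The (integer) sum of the ±1 values of an assignment. -/
def intSum {n : ℕ} (σ : Fin n → Bool) : ℤ := ∑ i, (if σ i then (1 : ℤ) else -1)

/-- The set of assignments satisfying `∑ i x i = (1-2p) n`, where `k = p n`. -/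
def cardSet (n k : ℕ) : Finset (Fin n → Bool) :=
  Finset.univ.filter fun σ => intSum σ = (n : ℤ) - 2 * k

/-- Expectation of `g` over the uniform distribution on `A`. -/
noncomputable def expOver {n : ℕ} (A : Finset (Fin n → Bool)) (g : (Fin n → Bool) → ℝ) : ℝ :=
  (∑ σ ∈ A, g σ) / A.card

section BiasedCharacters

/-- The weight of a coordinate value under the `p`-biased distribution. -/
def biasedWeight (p : ℝ) (b : Bool) : ℝ := if b then 1 - p else p

/-- The sum of the two values of `phi p`, which is also the third moment of `phi p`. -/
noncomputable def phiSkew (p : ℝ) : ℝ := phi p true + phi p false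

/-- The product character `φ_S`. -/
noncomputable def phiProd {n : ℕ} (p : ℝ) (S : Finset (Fin n)) (σ : Fin n → Bool) : ℝ :=
  ∏ i ∈ S, phi p (σ i)

/-- Expectation under the `p`-biased product distribution. -/
def biasedExp {n : ℕ} (p : ℝ) (g : (Fin n → Bool) → ℝ) : ℝ :=
  ∑ σ : Fin n → Bool, (∏ i, biasedWeight p (σ i)) * g σ

/-- The space of functions of degree at most `d` in the `φ`-basis. -/
noncomputable def lowDegree (p : ℝ) (n d : ℕ) : Submodule ℝ ((Fin n → Bool) → ℝ) :=
  Submodule.span ℝ {g | ∃ S : Finset (Fin n), S.card ≤ d ∧ g = phiProd p S}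

variable {n : ℕ} {p : ℝ}

lemma biasedWeight_nonneg (hp : 0 < p) (hp' : p < 1) (b : Bool) : 0 ≤ biasedWeight p b := by
  cases b <;> simp [biasedWeight] <;> linarith

lemma phi_true_sq (hp : 0 < p) (hp' : p < 1) : phi p true ^ 2 = p / (1 - p) := by
  have : 0 < 1 - p := by linarith
  simp only [phi, if_true]
  rw [Real.sq_sqrt (by positivity)]

lemma phi_false_sq (hp : 0 < p) (hp' : p < 1) : phi p false ^ 2 = (1 - p) / p := by
  have : 0 < 1 - p := by linarith
  simp only [phi, Bool.false_eq_true, if_false, neg_sq]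
  rw [Real.sq_sqrt (by positivity)]

lemma phi_true_mul_phi_false (hp : 0 < p) (hp' : p < 1) : phi p true * phi p false = -1 := by
  have : 0 < 1 - p := by linarith
  simp only [phi, Bool.false_eq_true, if_false, if_true, mul_neg]
  rw [← Real.sqrt_mul (by positivity), div_mul_div_cancel₀' (by positivity),
    div_self (by positivity), Real.sqrt_one]

lemma phi_sq (hp : 0 < p) (hp' : p < 1) (b : Bool) :
    phi p b ^ 2 = 1 + phiSkew p * phi p b := by
  have := phi_true_mul_phi_false hp hp'
  cases b <;> simp only [phiSkew] <;> linarith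

lemma phi_second_moment (hp : 0 < p) (hp' : p < 1) :
    (1 - p) * phi p true ^ 2 + p * phi p false ^ 2 = 1 := by
  have : 0 < 1 - p := by linarith
  rw [phi_true_sq hp hp', phi_false_sq hp hp']
  field_simp
  ring

lemma phi_mean (hp : 0 < p) (hp' : p < 1) :
    (1 - p) * phi p true + p * phi p false = 0 := by
  have h1 := phi_true_mul_phi_false hp hp'
  have h2 : 0 < 1 - p := by linarith
  have h3 := phi_true_sq hp hp'
  have h4 : phi p true ≠ 0 := by
    intro h; rw [h] at h1; norm_num at h1
  have : phi p true * ((1 - p) * phi p true + p * phi p false) = 0 := by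
    have : (1 - p) * phi p true ^ 2 = p := by rw [h3]; field_simp
    linear_combination this + p * h1
  exact (mul_eq_zero.mp this).resolve_left h4

lemma phiSkew_sq (hp : 0 < p) (hp' : p < 1) :
    phiSkew p ^ 2 = p / (1 - p) + (1 - p) / p - 2 := by
  rw [← phi_true_sq hp hp', ← phi_false_sq hp hp', phiSkew]
  linear_combination 2 * phi_true_mul_phi_false hp hp'

lemma phiSkew_sq_le (hp : 0 < p) (hp' : p < 1) :
    phiSkew p ^ 2 + 1 ≤ ((1 - p) / p) ^ 2 + (p / (1 - p)) ^ 2 := by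
  rw [phiSkew_sq hp hp']
  nlinarith [sq_nonneg (p / (1 - p) - 1 / 2), sq_nonneg ((1 - p) / p - 1 / 2)]

/-! ### The biased product measure -/

lemma biasedExp_mono (hp : 0 < p) (hp' : p < 1) {g h : (Fin n → Bool) → ℝ}
    (hgh : ∀ σ, g σ ≤ h σ) : biasedExp p g ≤ biasedExp p h :=
  sum_le_sum fun σ _ => mul_le_mul_of_nonneg_left (hgh σ)
    (prod_nonneg fun _ _ => biasedWeight_nonneg hp hp' _)

lemma biasedExp_nonneg (hp : 0 < p) (hp' : p < 1) {g : (Fin n → Bool) → ℝ}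
    (hg : ∀ σ, 0 ≤ g σ) : 0 ≤ biasedExp p g :=
  sum_nonneg fun σ _ => mul_nonneg (prod_nonneg fun _ _ => biasedWeight_nonneg hp hp' _) (hg σ)

lemma biasedExp_add (g h : (Fin n → Bool) → ℝ) :
    biasedExp p (fun σ => g σ + h σ) = biasedExp p g + biasedExp p h := by
  simp [biasedExp, mul_add, sum_add_distrib]

lemma biasedExp_const_mul (a : ℝ) (g : (Fin n → Bool) → ℝ) :
    biasedExp p (fun σ => a * g σ) = a * biasedExp p g := by
  simp only [biasedExp, mul_sum]
  exact sum_congr rfl fun _ _ => by ring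

lemma biasedExp_sq_le_mul (hp : 0 < p) (hp' : p < 1) (g h : (Fin n → Bool) → ℝ) :
    biasedExp p (fun σ => g σ ^ 2 * h σ ^ 2) ^ 2 ≤
      biasedExp p (fun σ => g σ ^ 4) * biasedExp p (fun σ => h σ ^ 4) := by
  have hw : ∀ σ : Fin n → Bool, 0 ≤ ∏ i, biasedWeight p (σ i) :=
    fun σ => prod_nonneg fun _ _ => biasedWeight_nonneg hp hp' _
  refine sum_sq_le_sum_mul_sum_of_sq_le_mul _ (fun σ _ => ?_) (fun σ _ => ?_) (fun σ _ => ?_)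
  · have := hw σ; positivity
  · have := hw σ; positivity
  · exact le_of_eq (by ring)

lemma biasedExp_succ (g : (Fin (n + 1) → Bool) → ℝ) :
    biasedExp p g = (1 - p) * biasedExp p (fun τ : Fin n → Bool => g (Fin.cons true τ)) +
      p * biasedExp p (fun τ : Fin n → Bool => g (Fin.cons false τ)) := by
  unfold biasedExp
  rw [← (Fin.consEquiv fun _ : Fin (n + 1) => Bool).sum_comp, Fintype.sum_prod_type]
  simp [Fin.consEquiv, Fin.prod_univ_succ, biasedWeight, mul_sum, mul_assoc]

lemma biasedExp_phiProd_mul (hp : 0 < p) (hp' : p < 1) (S T : Finset (Fin n)) :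
    biasedExp p (fun σ => phiProd p S σ * phiProd p T σ) = if S = T then 1 else 0 := by
  have h1 : biasedExp p (fun σ => phiProd p S σ * phiProd p T σ) =
      ∏ i : Fin n, ∑ b : Bool, biasedWeight p b *
        ((if i ∈ S then phi p b else 1) * (if i ∈ T then phi p b else 1)) := by
    rw [Finset.prod_univ_sum, Fintype.piFinset_univ]
    refine sum_congr rfl fun σ _ => ?_
    rw [prod_mul_distrib, prod_mul_distrib, prod_ite_mem, prod_ite_mem, univ_inter, univ_inter]
    rfl
  rw [h1]
  have h2 := phi_mean hp hp'
  have h3 := phi_second_moment hp hp'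
  split_ifs with h
  · subst h
    refine prod_eq_one fun i _ => ?_
    by_cases hi : i ∈ S
    · simp only [Fintype.sum_bool, hi, biasedWeight]
      simp; linarith
    · simp [hi, biasedWeight]
  · obtain ⟨i, hi⟩ : ∃ i, ¬ (i ∈ S ↔ i ∈ T) := by
      by_contra hc; push Not at hc; exact h (Finset.ext hc)
    refine prod_eq_zero (mem_univ i) ?_
    by_cases hS : i ∈ S <;> by_cases hT : i ∈ T <;> simp_all [biasedWeight]

/-- The Parseval identity. -/
lemma biasedExp_evalPhi_sq (hp : 0 < p) (hp' : p < 1) (c : Finset (Fin n) → ℝ) :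
    biasedExp p (fun σ => evalPhi p c σ ^ 2) = ∑ S, c S ^ 2 := by
  have h1 : biasedExp p (fun σ => evalPhi p c σ ^ 2) =
      ∑ S, ∑ T, c S * c T * biasedExp p (fun σ => phiProd p S σ * phiProd p T σ) := by
    simp only [biasedExp, mul_sum]
    rw [sum_congr rfl fun S _ => sum_comm, sum_comm]
    refine sum_congr rfl fun σ _ => ?_
    rw [evalPhi, sq, sum_mul_sum, mul_sum]
    refine sum_congr rfl fun S _ => ?_
    rw [mul_sum]
    refine sum_congr rfl fun T _ => ?_
    simp only [phiProd]
    ring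
  rw [h1]
  simp [biasedExp_phiProd_mul hp hp', sq]

/-! ### Low-degree functions -/

lemma phiProd_mem_lowDegree {d : ℕ} {S : Finset (Fin n)} (hS : S.card ≤ d) :
    phiProd p S ∈ lowDegree p n d :=
  Submodule.subset_span ⟨S, hS, rfl⟩

lemma lowDegree_mono {d e : ℕ} (h : d ≤ e) : lowDegree p n d ≤ lowDegree p n e :=
  Submodule.span_mono fun _ ⟨S, hS, hg⟩ => ⟨S, hS.trans h, hg⟩

lemma evalPhi_mem_lowDegree {d : ℕ} {c : Finset (Fin n) → ℝ} (hc : ∀ S, d < S.card → c S = 0) :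
    evalPhi p c ∈ lowDegree p n d := by
  have : evalPhi p c = ∑ S, c S • phiProd p S := by
    ext σ; simp [evalPhi, phiProd]
  rw [this]
  refine Submodule.sum_mem _ fun S _ => ?_
  by_cases hS : S.card ≤ d
  · exact Submodule.smul_mem _ _ (phiProd_mem_lowDegree hS)
  · rw [hc S (not_le.mp hS), zero_smul]
    exact Submodule.zero_mem _

lemma exists_evalPhi_of_mem_lowDegree {d : ℕ} {g : (Fin n → Bool) → ℝ}
    (hg : g ∈ lowDegree p n d) :
    ∃ c : Finset (Fin n) → ℝ, (∀ S, d < S.card → c S = 0) ∧ g = evalPhi p c := by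
  induction hg using Submodule.span_induction with
  | mem g hg =>
    obtain ⟨S, hS, rfl⟩ := hg
    refine ⟨Pi.single S 1, fun T hT => Pi.single_eq_of_ne (by rintro rfl; omega) _, ?_⟩
    ext σ
    simp [evalPhi, phiProd, Pi.single_apply]
  | zero => exact ⟨0, fun _ _ => rfl, by ext σ; simp [evalPhi]⟩
  | add g h _ _ ihg ihh =>
    obtain ⟨a, ha, rfl⟩ := ihg
    obtain ⟨b, hb, rfl⟩ := ihh
    refine ⟨a + b, fun S hS => by simp [ha S hS, hb S hS], ?_⟩
    ext σ
    simp [evalPhi, add_mul, sum_add_distrib]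
  | smul r g _ ih =>
    obtain ⟨a, ha, rfl⟩ := ih
    refine ⟨r • a, fun S hS => by simp [ha S hS], ?_⟩
    ext σ
    simp [evalPhi, mul_sum, mul_assoc]

lemma phiProd_mul_phi (hp : 0 < p) (hp' : p < 1) {S : Finset (Fin n)} {i : Fin n} (hi : i ∈ S)
    (σ : Fin n → Bool) :
    phiProd p S σ * phi p (σ i) = phiProd p (S.erase i) σ + phiSkew p * phiProd p S σ := by
  simp only [phiProd]
  rw [← Finset.mul_prod_erase S _ hi]
  linear_combination (∏ x ∈ S.erase i, phi p (σ x)) * phi_sq hp hp' (σ i)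

lemma mul_phi_mem_lowDegree (hp : 0 < p) (hp' : p < 1) {d : ℕ} {g : (Fin n → Bool) → ℝ}
    (hg : g ∈ lowDegree p n d) (i : Fin n) :
    (g * fun σ => phi p (σ i)) ∈ lowDegree p n (d + 1) := by
  induction hg using Submodule.span_induction with
  | mem g hg =>
    obtain ⟨S, hS, rfl⟩ := hg
    by_cases hi : i ∈ S
    · have : (phiProd p S * fun σ => phi p (σ i)) =
          phiProd p (S.erase i) + phiSkew p • phiProd p S := by
        ext σ; simpa using phiProd_mul_phi hp hp' hi σ
      rw [this]
      exact Submodule.add_mem _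
        (phiProd_mem_lowDegree ((card_erase_le).trans (hS.trans d.le_succ)))
        (Submodule.smul_mem _ _ (phiProd_mem_lowDegree (hS.trans d.le_succ)))
    · have : (phiProd p S * fun σ => phi p (σ i)) = phiProd p (insert i S) := by
        ext σ; simp [phiProd, prod_insert hi, mul_comm]
      rw [this]
      exact phiProd_mem_lowDegree (by rw [card_insert_of_notMem hi]; omega)
  | zero => simp
  | add g h _ _ ihg ihh => rw [add_mul]; exact Submodule.add_mem _ ihg ihh
  | smul r g _ ih => rw [smul_mul_assoc]; exact Submodule.smul_mem _ _ ih

lemma mul_phiProd_mem_lowDegree (hp : 0 < p) (hp' : p < 1) {d : ℕ} {g : (Fin n → Bool) → ℝ}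
    (hg : g ∈ lowDegree p n d) (S : Finset (Fin n)) :
    g * phiProd p S ∈ lowDegree p n (d + S.card) := by
  induction S using Finset.induction_on with
  | empty =>
    have : phiProd p (∅ : Finset (Fin n)) = 1 := by ext σ; simp [phiProd]
    simpa [this] using hg
  | insert i S hi ih =>
    have : g * phiProd p (insert i S) = (g * phiProd p S) * fun σ => phi p (σ i) := by
      ext σ; simp only [phiProd, prod_insert hi, Pi.mul_apply]; ring
    rw [this, card_insert_of_notMem hi, ← add_assoc]
    exact mul_phi_mem_lowDegree hp hp' ih i

lemma mul_mem_lowDegree (hp : 0 < p) (hp' : p < 1) {d e : ℕ} {g h : (Fin n → Bool) → ℝ}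
    (hg : g ∈ lowDegree p n d) (hh : h ∈ lowDegree p n e) :
    g * h ∈ lowDegree p n (d + e) := by
  induction hh using Submodule.span_induction with
  | mem h hh =>
    obtain ⟨S, hS, rfl⟩ := hh
    exact lowDegree_mono (by omega) (mul_phiProd_mem_lowDegree hp hp' hg S)
  | zero => simp
  | add a b _ _ iha ihb => rw [mul_add]; exact Submodule.add_mem _ iha ihb
  | smul r a _ ih => rw [mul_smul_comm]; exact Submodule.smul_mem _ _ ih

lemma sq_mem_lowDegree (hp : 0 < p) (hp' : p < 1) {d : ℕ} {g : (Fin n → Bool) → ℝ}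
    (hg : g ∈ lowDegree p n d) : (fun σ => g σ ^ 2) ∈ lowDegree p n (2 * d) := by
  have : (fun σ => g σ ^ 2) = g * g := by ext σ; simp [sq]
  rw [this, two_mul]
  exact mul_mem_lowDegree hp hp' hg hg

/-- Splitting off the first coordinate of a low-degree function. -/
lemma exists_split_of_mem_lowDegree {d : ℕ} {g : (Fin (n + 1) → Bool) → ℝ}
    (hg : g ∈ lowDegree p (n + 1) d) :
    ∃ g₀ ∈ lowDegree p n d, ∃ g₁ ∈ lowDegree p n (d - 1), (d = 0 → g₁ = 0) ∧
      ∀ b τ, g (Fin.cons b τ) = g₀ τ + phi p b * g₁ τ := by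
  induction hg using Submodule.span_induction with
  | mem g hg =>
    obtain ⟨S, hS, rfl⟩ := hg
    set T : Finset (Fin n) := univ.filter fun i => i.succ ∈ S with hT
    have hcard : S.card = (if 0 ∈ S then 1 else 0) + T.card := by
      have := Fin.card_filter_univ_succ fun i : Fin (n + 1) => i ∈ S
      rw [filter_univ_mem] at this
      rw [this, hT]
      split_ifs <;> simp [add_comm]
    have hprod : ∀ b (τ : Fin n → Bool), phiProd p S (Fin.cons b τ) =
        (if 0 ∈ S then phi p b else 1) * phiProd p T τ := by
      intro b τ
      have h1 : phiProd p S (Fin.cons b τ : Fin (n + 1) → Bool) =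
          ∏ i : Fin (n + 1), if i ∈ S then phi p ((Fin.cons b τ : Fin (n + 1) → Bool) i) else 1 := by
        simp [phiProd, prod_ite_mem]
      rw [h1, Fin.prod_univ_succ]
      simp [phiProd, hT, prod_filter]
    by_cases h0 : (0 : Fin (n + 1)) ∈ S
    · simp only [h0, if_true] at hcard hprod
      refine ⟨0, Submodule.zero_mem _, phiProd p T, phiProd_mem_lowDegree (by omega),
        by omega, fun b τ => by simp [hprod]⟩
    · simp only [h0, if_false] at hcard hprod
      exact ⟨phiProd p T, phiProd_mem_lowDegree (by omega), 0, Submodule.zero_mem _,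
        fun _ => rfl, fun b τ => by simp [hprod]⟩
  | zero => exact ⟨0, Submodule.zero_mem _, 0, Submodule.zero_mem _, fun _ => rfl, by simp⟩
  | add g h _ _ ihg ihh =>
    obtain ⟨g₀, hg₀, g₁, hg₁, hg₂, hg₃⟩ := ihg
    obtain ⟨h₀, hh₀, h₁, hh₁, hh₂, hh₃⟩ := ihh
    refine ⟨g₀ + h₀, Submodule.add_mem _ hg₀ hh₀, g₁ + h₁, Submodule.add_mem _ hg₁ hh₁,
      fun h => by simp [hg₂ h, hh₂ h], fun b τ => ?_⟩
    simp only [Pi.add_apply, hg₃, hh₃]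
    ring
  | smul r g _ ih =>
    obtain ⟨g₀, hg₀, g₁, hg₁, hg₂, hg₃⟩ := ih
    refine ⟨r • g₀, Submodule.smul_mem _ _ hg₀, r • g₁, Submodule.smul_mem _ _ hg₁,
      fun h => by simp [hg₂ h], fun b τ => ?_⟩
    simp only [Pi.smul_apply, smul_eq_mul, hg₃]
    ring

/-! ### Hypercontractivity for the biased product measure -/

lemma biasedExp_succ_sq (hp : 0 < p) (hp' : p < 1) {g : (Fin (n + 1) → Bool) → ℝ}
    {g₀ g₁ : (Fin n → Bool) → ℝ} (h : ∀ b τ, g (Fin.cons b τ) = g₀ τ + phi p b * g₁ τ) :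
    biasedExp p (fun σ => g σ ^ 2) =
      biasedExp p (fun τ => g₀ τ ^ 2) + biasedExp p (fun τ => g₁ τ ^ 2) := by
  rw [biasedExp_succ, ← biasedExp_const_mul, ← biasedExp_const_mul, ← biasedExp_add,
    ← biasedExp_add]
  congr 1
  ext τ
  simp only [h]
  linear_combination 2 * g₀ τ * g₁ τ * phi_mean hp hp' + g₁ τ ^ 2 * phi_second_moment hp hp'

lemma biasedExp_succ_pow_four_le (hp : 0 < p) (hp' : p < 1) {A : ℝ}
    (hA : phiSkew p ^ 2 + 1 ≤ A) {g : (Fin (n + 1) → Bool) → ℝ}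
    {g₀ g₁ : (Fin n → Bool) → ℝ} (h : ∀ b τ, g (Fin.cons b τ) = g₀ τ + phi p b * g₁ τ) :
    biasedExp p (fun σ => g σ ^ 4) ≤
      biasedExp p (fun τ => g₀ τ ^ 4) + 8 * biasedExp p (fun τ => g₀ τ ^ 2 * g₁ τ ^ 2) +
        3 * A * biasedExp p (fun τ => g₁ τ ^ 4) := by
  rw [biasedExp_succ, ← biasedExp_const_mul, ← biasedExp_const_mul, ← biasedExp_add,
    ← biasedExp_const_mul, ← biasedExp_const_mul, ← biasedExp_add, ← biasedExp_add]
  refine biasedExp_mono hp hp' fun τ => ?_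
  simp only [h]
  have m1 := phi_mean hp hp'
  have m2 := phi_second_moment hp hp'
  have ht := phi_sq hp hp' true
  have hf := phi_sq hp hp' false
  have m3 : (1 - p) * phi p true ^ 3 + p * phi p false ^ 3 = phiSkew p := by
    linear_combination (1 - p) * phi p true * ht + p * phi p false * hf + m1 + phiSkew p * m2
  have m4 : (1 - p) * phi p true ^ 4 + p * phi p false ^ 4 = 1 + phiSkew p ^ 2 := by
    linear_combination (1 - p) * phi p true ^ 2 * ht + p * phi p false ^ 2 * hf + m2 +
      phiSkew p * m3
  have key : (1 - p) * (g₀ τ + phi p true * g₁ τ) ^ 4 + p * (g₀ τ + phi p false * g₁ τ) ^ 4 =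
      g₀ τ ^ 4 + 6 * (g₀ τ ^ 2 * g₁ τ ^ 2) + 4 * phiSkew p * (g₀ τ * g₁ τ ^ 3) +
        (1 + phiSkew p ^ 2) * g₁ τ ^ 4 := by
    linear_combination 4 * g₀ τ ^ 3 * g₁ τ * m1 + 6 * g₀ τ ^ 2 * g₁ τ ^ 2 * m2 +
      4 * g₀ τ * g₁ τ ^ 3 * m3 + g₁ τ ^ 4 * m4
  rw [key]
  have h4 : 0 ≤ g₁ τ ^ 4 := by positivity
  nlinarith [sq_nonneg (g₀ τ * g₁ τ - phiSkew p * g₁ τ ^ 2), mul_le_mul_of_nonneg_right hA h4]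

/-- The `(2, 4)`-hypercontractive inequality for low-degree functions on the biased cube. -/
lemma biasedExp_pow_four_le (hp : 0 < p) (hp' : p < 1) {A : ℝ} (hA : phiSkew p ^ 2 + 1 ≤ A)
    {d : ℕ} {g : (Fin n → Bool) → ℝ} (hg : g ∈ lowDegree p n d) :
    biasedExp p (fun σ => g σ ^ 4) ≤ (16 * A) ^ d * biasedExp p (fun σ => g σ ^ 2) ^ 2 := by
  have hA1 : 1 ≤ A := by nlinarith [sq_nonneg (phiSkew p)]
  induction n generalizing d with
  | zero =>
    have h1 : 1 ≤ (16 * A) ^ d := one_le_pow₀ (by linarith)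
    simp only [biasedExp, univ_unique, univ_eq_empty, prod_empty, sum_singleton, one_mul]
    have : 0 ≤ g default ^ 4 := by positivity
    nlinarith
  | succ n ih =>
    obtain ⟨g₀, hg₀, g₁, hg₁, hz, hsplit⟩ := exists_split_of_mem_lowDegree hg
    rw [biasedExp_succ_sq hp hp' hsplit]
    refine (biasedExp_succ_pow_four_le hp hp' hA hsplit).trans ?_
    have hX := ih hg₀
    have hY := ih hg₁
    have hCS := biasedExp_sq_le_mul hp hp' g₀ g₁
    have hb : 0 ≤ biasedExp p fun τ => g₀ τ ^ 2 := biasedExp_nonneg hp hp' fun _ => by positivity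
    have ha : 0 ≤ biasedExp p fun τ => g₁ τ ^ 2 := biasedExp_nonneg hp hp' fun _ => by positivity
    have hX0 : 0 ≤ biasedExp p fun τ => g₀ τ ^ 4 := biasedExp_nonneg hp hp' fun _ => by positivity
    have hY0 : 0 ≤ biasedExp p fun τ => g₁ τ ^ 4 := biasedExp_nonneg hp hp' fun _ => by positivity
    cases d with
    | zero =>
      have := hz rfl
      subst this
      simp only [Pi.zero_apply]
      have : biasedExp p (fun _ : Fin n → Bool => (0 : ℝ)) = 0 := by simp [biasedExp]
      simpa [this] using hX
    | succ d =>
      rw [Nat.add_sub_cancel] at hY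
      generalize biasedExp p (fun τ => g₀ τ ^ 2) = b at *
      generalize biasedExp p (fun τ => g₁ τ ^ 2) = a at *
      generalize biasedExp p (fun τ => g₀ τ ^ 4) = X at *
      generalize biasedExp p (fun τ => g₁ τ ^ 4) = Y at *
      generalize biasedExp p (fun τ => g₀ τ ^ 2 * g₁ τ ^ 2) = Z at *
      rw [pow_succ] at hX ⊢
      have hQ : 0 < (16 * A) ^ d := by positivity
      generalize (16 * A) ^ d = Q at *
      have hZ : 8 * Z ≤ 2 * (Q * (16 * A)) * (a * b) := by
        have h2 : X * Y ≤ (Q * (16 * A) * b ^ 2) * (Q * a ^ 2) :=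
          mul_le_mul hX hY hY0 (hX0.trans hX)
        have h3 : Z ^ 2 ≤ (4 * (Q * A) * (a * b)) ^ 2 := by
          have h4 : 0 ≤ Q ^ 2 * A * (a * b) ^ 2 * (A - 1) := by
            have : 0 ≤ A - 1 := by linarith
            positivity
          nlinarith
        have h5 : 0 ≤ 4 * (Q * A) * (a * b) := by positivity
        have := abs_le_of_sq_le_sq' h3 h5
        linarith [this.2]
      have hY2 : 3 * A * Y ≤ Q * (16 * A) * a ^ 2 := by
        have := mul_le_mul_of_nonneg_left hY (show 0 ≤ 3 * A by linarith)
        have h6 : 0 ≤ Q * A * a ^ 2 := by positivity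
        nlinarith
      nlinarith

lemma biasedExp_pow_eight_le (hp : 0 < p) (hp' : p < 1) {A : ℝ} (hA : phiSkew p ^ 2 + 1 ≤ A)
    {d : ℕ} {g : (Fin n → Bool) → ℝ} (hg : g ∈ lowDegree p n d) :
    biasedExp p (fun σ => g σ ^ 8) ≤
      ((256 * A ^ 2) ^ d * biasedExp p (fun σ => g σ ^ 2) ^ 2) ^ 2 := by
  have hA1 : 1 ≤ A := by nlinarith [sq_nonneg (phiSkew p)]
  have h1 := biasedExp_pow_four_le hp hp' hA hg
  have h2 := biasedExp_pow_four_le hp hp' hA (sq_mem_lowDegree hp hp' hg)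
  simp only [← pow_mul] at h2
  have h0 : 0 ≤ biasedExp p fun σ => g σ ^ 4 := biasedExp_nonneg hp hp' fun _ => by positivity
  calc biasedExp p (fun σ => g σ ^ 8)
      ≤ (16 * A) ^ (2 * d) * biasedExp p (fun σ => g σ ^ 4) ^ 2 := h2
    _ ≤ (16 * A) ^ (2 * d) * ((16 * A) ^ d * biasedExp p (fun σ => g σ ^ 2) ^ 2) ^ 2 := by
        gcongr
    _ = _ := by
        have : (256 * A ^ 2) = (16 * A) ^ 2 := by ring
        rw [this, ← pow_mul]
        ring

/-! ### Characters on the slice -/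

lemma sum_phi_eq_zero_of_mem_cardSet (hp : 0 < p) (hp' : p < 1) {k : ℕ} (hk : (k : ℝ) = p * n)
    {σ : Fin n → Bool} (hσ : σ ∈ cardSet n k) : ∑ i, phi p (σ i) = 0 := by
  have h1 : ∑ i, (if σ i then (1 : ℝ) else -1) = n - 2 * k := by
    have : intSum σ = (n : ℤ) - 2 * k := (mem_filter.mp hσ).2
    have := congrArg (Int.cast : ℤ → ℝ) this
    simpa [intSum] using this
  have h2 : ∀ b, phi p b = (phi p true + phi p false) / 2 +
      (phi p true - phi p false) / 2 * (if b then (1 : ℝ) else -1) := by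
    intro b; cases b <;> simp <;> ring
  rw [sum_congr rfl fun i _ => h2 (σ i), sum_add_distrib, ← mul_sum, h1]
  simp only [sum_const, card_univ, Fintype.card_fin, nsmul_eq_mul]
  rw [hk]
  linear_combination (n : ℝ) * phi_mean hp hp'

lemma expOver_sum {ι : Type*} (s : Finset ι) (A : Finset (Fin n → Bool))
    (g : ι → (Fin n → Bool) → ℝ) :
    expOver A (fun σ => ∑ i ∈ s, g i σ) = ∑ i ∈ s, expOver A (g i) := by
  simp only [expOver]
  rw [sum_comm, sum_div]

lemma expOver_const_mul (A : Finset (Fin n → Bool)) (a : ℝ) (g : (Fin n → Bool) → ℝ) :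
    expOver A (fun σ => a * g σ) = a * expOver A g := by
  simp only [expOver]
  rw [← mul_sum, mul_div_assoc]

lemma expOver_add (A : Finset (Fin n → Bool)) (g h : (Fin n → Bool) → ℝ) :
    expOver A (fun σ => g σ + h σ) = expOver A g + expOver A h := by
  simp only [expOver]
  rw [sum_add_distrib, add_div]

lemma expOver_insert_eq (k : ℕ) {S : Finset (Fin n)} {i j : Fin n} (hi : i ∉ S) (hj : j ∉ S) :
    expOver (cardSet n k) (phiProd p (insert i S)) =
      expOver (cardSet n k) (phiProd p (insert j S)) := by
  unfold expOver
  congr 1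
  refine sum_equiv (Equiv.arrowCongr (Equiv.swap i j) (Equiv.refl Bool)) (fun σ => ?_)
    (fun σ _ => ?_)
  · have : intSum (Equiv.arrowCongr (Equiv.swap i j) (Equiv.refl Bool) σ) = intSum σ :=
      (Equiv.swap i j).symm.sum_comp fun x => if σ x = true then (1 : ℤ) else -1
    simp [cardSet, this]
  · simp only [phiProd, prod_insert hi, prod_insert hj, Equiv.arrowCongr_apply,
      Equiv.coe_refl, Function.comp_apply, id_eq, Equiv.symm_swap, Equiv.swap_apply_right]
    congr 1
    refine prod_congr rfl fun x hx => ?_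
    rw [Equiv.swap_apply_of_ne_of_ne (by rintro rfl; exact hi hx) (by rintro rfl; exact hj hx)]

lemma expOver_insert_recursion (hp : 0 < p) (hp' : p < 1) {k : ℕ} (hk : (k : ℝ) = p * n)
    {S : Finset (Fin n)} {j : Fin n} (hj : j ∉ S) :
    ((n : ℝ) - S.card) * expOver (cardSet n k) (phiProd p (insert j S)) =
      -(∑ i ∈ S, expOver (cardSet n k) (phiProd p (S.erase i)) +
        S.card * (phiSkew p * expOver (cardSet n k) (phiProd p S))) := by
  have h0 : expOver (cardSet n k) (fun σ => ∑ i, phiProd p S σ * phi p (σ i)) = 0 := by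
    unfold expOver
    rw [sum_eq_zero, zero_div]
    intro σ hσ
    rw [← mul_sum, sum_phi_eq_zero_of_mem_cardSet hp hp' hk hσ, mul_zero]
  rw [expOver_sum, ← sum_add_sum_compl S] at h0
  have h1 : ∑ i ∈ S, expOver (cardSet n k) (fun σ => phiProd p S σ * phi p (σ i)) =
      ∑ i ∈ S, expOver (cardSet n k) (phiProd p (S.erase i)) +
        S.card * (phiSkew p * expOver (cardSet n k) (phiProd p S)) := by
    rw [← nsmul_eq_mul, ← sum_const, ← sum_add_distrib]
    refine sum_congr rfl fun i hi => ?_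
    rw [← expOver_const_mul, ← expOver_add]
    congr 1
    ext σ
    exact phiProd_mul_phi hp hp' hi σ
  have h2 : ∑ i ∈ Sᶜ, expOver (cardSet n k) (fun σ => phiProd p S σ * phi p (σ i)) =
      ((n : ℝ) - S.card) * expOver (cardSet n k) (phiProd p (insert j S)) := by
    have hc : ((n : ℝ) - S.card) = (Sᶜ.card : ℝ) := by
      rw [card_compl, Fintype.card_fin, Nat.cast_sub (by simpa using card_le_univ S)]
    rw [hc, ← nsmul_eq_mul, ← sum_const]
    refine sum_congr rfl fun i hi => ?_
    have hi' : i ∉ S := mem_compl.mp hi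
    rw [← expOver_insert_eq k hi' hj]
    congr 1
    ext σ
    rw [phiProd, phiProd, prod_insert hi', mul_comm]
  rw [h1, h2] at h0
  linarith

lemma mul_sqrt_choose_le {m : ℕ} (h : 2 * (m + 1) ≤ n) :
    ((m : ℝ) + 1) * √(n.choose (m + 2)) ≤ (n - (m + 1)) * √(n.choose m) := by
  have hn : 2 * ((m : ℝ) + 1) ≤ n := by exact_mod_cast h
  have hm : (0 : ℝ) ≤ m := m.cast_nonneg
  have e1 : (n.choose (m + 1) : ℝ) * (m + 1) = n.choose m * (n - m) := by
    have := Nat.choose_succ_right_eq n m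
    have := congrArg (Nat.cast : ℕ → ℝ) this
    rw [Nat.cast_mul, Nat.cast_mul, Nat.cast_sub (by omega)] at this
    exact_mod_cast this
  have e2 : (n.choose (m + 2) : ℝ) * (m + 2) = n.choose (m + 1) * (n - (m + 1)) := by
    have := Nat.choose_succ_right_eq n (m + 1)
    have := congrArg (Nat.cast : ℕ → ℝ) this
    rw [Nat.cast_mul, Nat.cast_mul, Nat.cast_sub (by omega)] at this
    push_cast at this
    rw [← this]; ring
  have hy : (0 : ℝ) ≤ n - (m + 1) := by linarith
  have hc : (0 : ℝ) ≤ n.choose m := by positivity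
  refine abs_le_of_sq_le_sq' ?_ (by positivity) |>.2
  rw [mul_pow, mul_pow, Real.sq_sqrt (by positivity), Real.sq_sqrt (by positivity)]
  have e3 : ((m : ℝ) + 2) * (((m : ℝ) + 1) ^ 2 * n.choose (m + 2)) =
      (m + 1) * (n - m) * (n - (m + 1)) * n.choose m := by
    linear_combination ((m : ℝ) + 1) ^ 2 * e2 + (m + 1) * (n - (m + 1)) * e1
  have h5 : ((m : ℝ) + 1) * (n - m) ≤ (m + 2) * (n - (m + 1)) := by nlinarith
  have h6 := mul_le_mul_of_nonneg_right h5 (mul_nonneg hy hc)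
  have h7 : (0 : ℝ) < m + 2 := by linarith
  refine le_of_mul_le_mul_left ?_ h7
  rw [e3]
  linarith

lemma mul_sqrt_choose_succ_le {m : ℕ} {β ε : ℝ} (h : m ≤ n) (hε : 0 ≤ ε)
    (hβ : β ^ 2 * m ≤ ε ^ 2 * (n - m)) :
    (m : ℝ) * |β| * √(n.choose (m + 1)) ≤ ε * (n - m) * √(n.choose m) := by
  have hn : (0 : ℝ) ≤ n - m := by
    have : (m : ℝ) ≤ n := by exact_mod_cast h
    linarith
  have hm : (0 : ℝ) ≤ m := m.cast_nonneg
  have e1 : (n.choose (m + 1) : ℝ) * (m + 1) = n.choose m * (n - m) := by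
    have := Nat.choose_succ_right_eq n m
    have := congrArg (Nat.cast : ℕ → ℝ) this
    rw [Nat.cast_mul, Nat.cast_mul, Nat.cast_sub (by omega)] at this
    exact_mod_cast this
  refine abs_le_of_sq_le_sq' ?_ (by positivity) |>.2
  simp only [mul_pow]
  rw [sq_abs, Real.sq_sqrt (by positivity), Real.sq_sqrt (by positivity)]
  have hc : (0 : ℝ) ≤ n.choose (m + 1) := by positivity
  have hc' : (0 : ℝ) ≤ n.choose m := by positivity
  have h1 := mul_le_mul_of_nonneg_right hβ (mul_nonneg hm hc)
  have h2 : ε ^ 2 * (n - m) * (m * n.choose (m + 1)) ≤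
      ε ^ 2 * (n - m) * (n.choose m * (n - m)) := by
    rw [← e1]
    refine mul_le_mul_of_nonneg_left ?_ (by positivity)
    linarith
  nlinarith

/-- Decay of the character expectations on the slice. -/
lemma abs_expOver_phiProd_mul_sqrt_choose_le (hp : 0 < p) (hp' : p < 1) {k : ℕ}
    (hk : (k : ℝ) = p * n) {D : ℕ} (hD : 2 * D ≤ n) {ε : ℝ} (hε : 0 ≤ ε)
    (hβ : phiSkew p ^ 2 * D ≤ ε ^ 2 * (n - D)) (m : ℕ) (hm : m ≤ D) :
    ∀ S : Finset (Fin n), S.card = m →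
      |expOver (cardSet n k) (phiProd p S)| * √(n.choose m) ≤ (1 + ε) ^ m := by
  induction m using Nat.strong_induction_on with
  | _ m ih =>
  intro S hS
  match m with
  | 0 =>
    rw [card_eq_zero] at hS
    subst hS
    have : expOver (cardSet n k) (phiProd p (∅ : Finset (Fin n))) =
        ((cardSet n k).card : ℝ) / (cardSet n k).card := by
      simp [expOver, phiProd]
    rw [this, abs_of_nonneg (by positivity)]
    simpa using div_self_le_one _
  | 1 =>
    obtain ⟨j, rfl⟩ := card_eq_one.mp hS
    have h := expOver_insert_recursion hp hp' hk (notMem_empty j)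
    simp only [card_empty, sum_empty, insert_empty_eq, Nat.cast_zero, sub_zero, zero_mul,
      add_zero, neg_zero] at h
    have hn : (n : ℝ) ≠ 0 := by
      have : 0 < n := by omega
      positivity
    rw [(mul_eq_zero.mp h).resolve_left hn]
    simp; positivity
  | m + 2 =>
    obtain ⟨j, T, hj, rfl, hT⟩ := card_eq_succ.mp hS
    have h := expOver_insert_recursion hp hp' hk hj
    have hDr : (m : ℝ) + 2 ≤ D := by exact_mod_cast hm
    have hnr : 2 * (D : ℝ) ≤ n := by exact_mod_cast hD
    have hm0 : (0 : ℝ) ≤ m := m.cast_nonneg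
    have hN : (0 : ℝ) < n - (m + 1) := by linarith
    have i1 := ih (m + 1) (by omega) (by omega) T hT
    have c0 : 0 < √(n.choose m : ℝ) := Real.sqrt_pos.mpr (by
      exact_mod_cast Nat.choose_pos (by omega))
    have c1 : 0 < √(n.choose (m + 1) : ℝ) := Real.sqrt_pos.mpr (by
      exact_mod_cast Nat.choose_pos (by omega))
    have s0 := mul_sqrt_choose_le (n := n) (m := m) (by omega)
    have s1 := mul_sqrt_choose_succ_le (n := n) (m := m + 1) (β := phiSkew p) (ε := ε)
      (by omega) hε (by
        push_cast
        calc phiSkew p ^ 2 * ((m : ℝ) + 1) ≤ phiSkew p ^ 2 * D := by gcongr; linarith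
          _ ≤ ε ^ 2 * (n - D) := hβ
          _ ≤ _ := by gcongr; linarith)
    push_cast at s1
    rw [hT] at h
    push_cast at h
    have hsum : |∑ i ∈ T, expOver (cardSet n k) (phiProd p (T.erase i))| ≤
        (m + 1) * ((1 + ε) ^ m / √(n.choose m)) := by
      refine (abs_sum_le_sum_abs _ _).trans ?_
      have : ∀ i ∈ T, |expOver (cardSet n k) (phiProd p (T.erase i))| ≤
          (1 + ε) ^ m / √(n.choose m) := fun i hi => by
        rw [le_div_iff₀ c0]
        exact ih m (by omega) (by omega) _ (by rw [card_erase_of_mem hi, hT]; rfl)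
      refine (sum_le_card_nsmul _ _ _ this).trans (le_of_eq ?_)
      rw [hT, nsmul_eq_mul]
      push_cast
      rfl
    have i1' : |expOver (cardSet n k) (phiProd p T)| ≤
        (1 + ε) ^ (m + 1) / √(n.choose (m + 1)) := by rwa [le_div_iff₀ c1]
    have habs : ((n : ℝ) - (m + 1)) * |expOver (cardSet n k) (phiProd p (insert j T))| ≤
        (m + 1) * ((1 + ε) ^ m / √(n.choose m)) +
          (m + 1) * (|phiSkew p| * ((1 + ε) ^ (m + 1) / √(n.choose (m + 1)))) := by
      have : |((n : ℝ) - (m + 1)) * expOver (cardSet n k) (phiProd p (insert j T))| =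
          (n - (m + 1)) * |expOver (cardSet n k) (phiProd p (insert j T))| := by
        rw [abs_mul, abs_of_pos hN]
      rw [← this, h, abs_neg]
      refine (abs_add_le _ _).trans (add_le_add hsum ?_)
      rw [abs_mul, abs_mul, abs_of_nonneg (by positivity : (0 : ℝ) ≤ m + 1)]
      gcongr
    have t0 : ((m : ℝ) + 1) * ((1 + ε) ^ m / √(n.choose m)) * √(n.choose (m + 2)) ≤
        (n - (m + 1)) * (1 + ε) ^ m := by
      calc _ = (1 + ε) ^ m / √(n.choose m) * (((m : ℝ) + 1) * √(n.choose (m + 2))) := by ring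
        _ ≤ (1 + ε) ^ m / √(n.choose m) * ((n - (m + 1)) * √(n.choose m)) := by gcongr
        _ = _ := by field_simp
    have t1 : ((m : ℝ) + 1) * (|phiSkew p| * ((1 + ε) ^ (m + 1) / √(n.choose (m + 1)))) *
        √(n.choose (m + 2)) ≤ (n - (m + 1)) * (ε * (1 + ε) ^ (m + 1)) := by
      calc _ = (1 + ε) ^ (m + 1) / √(n.choose (m + 1)) *
            (((m : ℝ) + 1) * |phiSkew p| * √(n.choose (m + 2))) := by ring
        _ ≤ (1 + ε) ^ (m + 1) / √(n.choose (m + 1)) *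
            (ε * (n - (m + 1)) * √(n.choose (m + 1))) :=
          mul_le_mul_of_nonneg_left s1 (by positivity)
        _ = _ := by field_simp
    refine le_of_mul_le_mul_left ?_ hN
    have hmul := mul_le_mul_of_nonneg_right habs (Real.sqrt_nonneg (n.choose (m + 2) : ℝ))
    rw [add_mul] at hmul
    have hpow : (1 + ε) ^ m + ε * (1 + ε) ^ (m + 1) ≤ (1 + ε) ^ (m + 2) := by
      have : 0 ≤ (1 + ε) ^ m * ε := by positivity
      rw [pow_add (1 + ε) m 2, pow_succ]
      nlinarith
    have := mul_le_mul_of_nonneg_left hpow hN.le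
    linarith

lemma one_add_inv_pow_le {d : ℕ} (hd : 1 ≤ d) {m : ℕ} (hm : m ≤ 4 * d) :
    ((1 + 1 / (16 * (d : ℝ))) ^ m) ^ 2 ≤ 9 / 5 := by
  have hd' : (0 : ℝ) < d := by exact_mod_cast hd
  have h1 : (1 + 1 / (16 * (d : ℝ))) ≤ Real.exp (1 / (16 * d)) := by
    have := Real.add_one_le_exp (1 / (16 * (d : ℝ))); linarith
  have h2 : (1 + 1 / (16 * (d : ℝ))) ^ m ≤ Real.exp (1 / 4) := by
    calc (1 + 1 / (16 * (d : ℝ))) ^ m ≤ (1 + 1 / (16 * (d : ℝ))) ^ (4 * d) :=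
          pow_le_pow_right₀ (by simp) hm
      _ ≤ Real.exp (1 / (16 * d)) ^ (4 * d) := by gcongr
      _ = Real.exp (1 / 4) := by
        rw [← Real.exp_nat_mul]
        congr 1
        push_cast
        field_simp
        norm_num
  have h3 : Real.exp (1 / 4) ^ 4 < 2.7182818286 := by
    rw [← Real.exp_nat_mul]
    norm_num
    exact lt_of_lt_of_eq Real.exp_one_lt_d9 (by norm_num)
  have h4 : Real.exp (1 / 4) ^ 2 ≤ 9 / 5 := by
    nlinarith [sq_nonneg (Real.exp (1 / 4))]
  exact (pow_le_pow_left₀ (by positivity) h2 2).trans h4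

lemma sum_expOver_phiProd_sq_le (hp : 0 < p) (hp' : p < 1) {k : ℕ} (hk : (k : ℝ) = p * n)
    {d : ℕ} (hd : 1 ≤ d) (hn : 8 * d ≤ n)
    (hβ : phiSkew p ^ 2 * (4 * d) ≤ (1 / (16 * (d : ℝ))) ^ 2 * (n - 4 * d)) :
    ∑ S : Finset (Fin n) with S.card ≤ 4 * d, expOver (cardSet n k) (phiProd p S) ^ 2 ≤
      9 * d := by
  have hterm : ∀ S : Finset (Fin n), S.card ≤ 4 * d →
      expOver (cardSet n k) (phiProd p S) ^ 2 ≤ 9 / 5 / (n.choose S.card : ℝ) := by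
    intro S hS
    have hc : (0 : ℝ) < n.choose S.card := by exact_mod_cast Nat.choose_pos (by omega)
    have h := abs_expOver_phiProd_mul_sqrt_choose_le hp hp' hk (D := 4 * d) (by omega)
      (ε := 1 / (16 * d)) (by positivity) (by push_cast; exact hβ) S.card hS S rfl
    rw [le_div_iff₀ hc]
    calc _ = (|expOver (cardSet n k) (phiProd p S)| * √(n.choose S.card)) ^ 2 := by
          rw [mul_pow, sq_abs, Real.sq_sqrt hc.le]
      _ ≤ ((1 + 1 / (16 * (d : ℝ))) ^ S.card) ^ 2 := by gcongr
      _ ≤ 9 / 5 := one_add_inv_pow_le hd hS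
  calc ∑ S : Finset (Fin n) with S.card ≤ 4 * d, expOver (cardSet n k) (phiProd p S) ^ 2
      ≤ ∑ S : Finset (Fin n) with S.card ≤ 4 * d, 9 / 5 / (n.choose S.card : ℝ) :=
        sum_le_sum fun S hS => hterm S (mem_filter.mp hS).2
    _ = ∑ m ∈ range (n + 1), if m ≤ 4 * d then (9 / 5 : ℝ) else 0 := by
        rw [sum_filter, ← powerset_univ,
          sum_powerset_apply_card fun m => if m ≤ 4 * d then 9 / 5 / (n.choose m : ℝ) else 0]
        simp only [card_univ, Fintype.card_fin]
        refine sum_congr rfl fun m hm => ?_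
        split_ifs
        · have hc : (n.choose m : ℝ) ≠ 0 := by
            exact_mod_cast (Nat.choose_pos (by simp at hm; omega)).ne'
          rw [nsmul_eq_mul]
          field_simp
        · simp
    _ = (4 * d + 1) * (9 / 5) := by
        rw [← sum_filter]
        have : (range (n + 1)).filter (fun m => m ≤ 4 * d) = range (4 * d + 1) := by
          ext m; simp; omega
        rw [this]
        simp
    _ ≤ 9 * d := by
        have : (1 : ℝ) ≤ d := by exact_mod_cast hd
        linarith

/-- Low-degree functions have slice mean controlled by their `L²`-norm on the biased cube. -/
lemma expOver_sq_le {k e : ℕ} (hp : 0 < p) (hp' : p < 1) {g : (Fin n → Bool) → ℝ}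
    (hg : g ∈ lowDegree p n e) :
    expOver (cardSet n k) g ^ 2 ≤ biasedExp p (fun σ => g σ ^ 2) *
      ∑ S : Finset (Fin n) with S.card ≤ e, expOver (cardSet n k) (phiProd p S) ^ 2 := by
  obtain ⟨c, hc, rfl⟩ := exists_evalPhi_of_mem_lowDegree hg
  have h1 : expOver (cardSet n k) (evalPhi p c) =
      ∑ S : Finset (Fin n) with S.card ≤ e, c S * expOver (cardSet n k) (phiProd p S) := by
    have : evalPhi p c = fun σ => ∑ S, c S * phiProd p S σ := rfl
    rw [this, expOver_sum, sum_filter]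
    refine sum_congr rfl fun S _ => ?_
    rw [expOver_const_mul]
    split_ifs with h
    · rfl
    · rw [hc S (not_le.mp h), zero_mul]
  rw [h1, biasedExp_evalPhi_sq hp hp']
  refine (sum_mul_sq_le_sq_mul_sq _ _ _).trans ?_
  refine mul_le_mul_of_nonneg_right ?_ (sum_nonneg fun _ _ => sq_nonneg _)
  exact sum_le_univ_sum_of_nonneg fun S => sq_nonneg (c S)

end BiasedCharacters

theorem stmt4 (d : ℕ) (hd : 1 ≤ d) (p₀ : ℝ) (hp₀ : 0 < p₀) (hp₀' : p₀ ≤ 1 / 2) :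
    ∃ n₀ : ℕ, ∀ n : ℕ, n₀ ≤ n →
      ∀ p : ℝ, p₀ ≤ p → p ≤ 1 - p₀ → ∀ k : ℕ, (k : ℝ) = p * n →
      ∀ c : Finset (Fin n) → ℝ, (∀ S, d < S.card → c S = 0) →
        expOver (cardSet n k) (fun σ => (evalPhi p c σ) ^ 4) ≤
          3 * (d : ℝ) ^ ((3 : ℝ) / 2) *
            (256 * (((1 - p) / p) ^ 2 + (p / (1 - p)) ^ 2) ^ 2) ^ d *
            (∑ S : Finset (Fin n), c S ^ 2) ^ 2 := by
  refine ⟨⌈2048 * (d : ℝ) ^ 3 / p₀⌉₊ + 8 * d, fun n hn p hp₁ hp₂ k hk c hc => ?_⟩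
  have hp : 0 < p := by linarith
  have hp' : p < 1 := by linarith
  have hd' : (1 : ℝ) ≤ d := by exact_mod_cast hd
  have hβ : phiSkew p ^ 2 ≤ 2 / p₀ := by
    have h1 : p / (1 - p) ≤ 1 / p₀ := div_le_div₀ zero_le_one hp'.le hp₀ (by linarith)
    have h2 : (1 - p) / p ≤ 1 / p₀ := div_le_div₀ zero_le_one (by linarith) hp₀ hp₁
    have h3 : 2 / p₀ = 1 / p₀ + 1 / p₀ := by ring
    rw [phiSkew_sq hp hp', h3]
    linarith
  have hn' : 2048 * (d : ℝ) ^ 3 / p₀ + 8 * d ≤ n := by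
    calc _ ≤ (⌈2048 * (d : ℝ) ^ 3 / p₀⌉₊ : ℝ) + 8 * d := by gcongr; exact Nat.le_ceil _
      _ ≤ n := by exact_mod_cast hn
  have hβ' : phiSkew p ^ 2 * (4 * d) ≤ (1 / (16 * (d : ℝ))) ^ 2 * (n - 4 * d) := by
    calc phiSkew p ^ 2 * (4 * d) ≤ 2 / p₀ * (4 * d) := by gcongr
      _ = (1 / (16 * (d : ℝ))) ^ 2 * (2048 * (d : ℝ) ^ 3 / p₀) := by
        field_simp
        norm_num
      _ ≤ _ := by gcongr; linarith
  have hf := evalPhi_mem_lowDegree (p := p) hc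
  have hf4 : (fun σ => evalPhi p c σ ^ 4) ∈ lowDegree p n (4 * d) := by
    have := sq_mem_lowDegree hp hp' (sq_mem_lowDegree hp hp' hf)
    simp only [← pow_mul, ← mul_assoc] at this
    exact this
  have h8 := biasedExp_pow_eight_le hp hp' (phiSkew_sq_le hp hp') hf
  rw [biasedExp_evalPhi_sq hp hp'] at h8
  have hmain := expOver_sq_le (k := k) hp hp' hf4
  simp only [← pow_mul] at hmain
  have hsum := sum_expOver_phiProd_sq_le hp hp' hk hd (by omega) hβ'
  set B := (256 * (((1 - p) / p) ^ 2 + (p / (1 - p)) ^ 2) ^ 2) ^ d *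
    (∑ S : Finset (Fin n), c S ^ 2) ^ 2 with hB
  have hB0 : 0 ≤ B := by positivity
  have hpow : ((d : ℝ) ^ ((3 : ℝ) / 2)) ^ 2 = (d : ℝ) ^ 3 := by
    rw [← Real.rpow_natCast, ← Real.rpow_mul (by positivity), ← Real.rpow_natCast]
    norm_num
  rw [mul_assoc (3 * (d : ℝ) ^ ((3 : ℝ) / 2)), ← hB]
  refine abs_le_of_sq_le_sq' ?_ (by positivity) |>.2
  calc _ ≤ B ^ 2 * (9 * d) :=
        hmain.trans (mul_le_mul h8 hsum (sum_nonneg fun _ _ => sq_nonneg _) (sq_nonneg _))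
    _ ≤ B ^ 2 * (9 * d ^ 3) := by
        gcongr
        exact le_self_pow₀ hd' (by norm_num)
    _ = _ := by linear_combination -9 * B ^ 2 * hpow
end

section
/- For every integer d ≥ 1 and every p₀ ∈ (0, 1/2] there exists n₀ depending only on d and p₀ such that for all n ≥ n₀, all p ∈ [p₀, 1−p₀] with pn an integer, and every multilinear polynomial g of degree at most d on the variables x₁,…,x_n, E_{D_p}[g⁴] ≤ 12 · d^{3/2} · (256 · (((1−p)/p)² + (p/(1−p))²)²)^d · (E_{D_p}[g²])². -/
open Finset

/-- Evaluation of a multilinear polynomial given its coefficients. -/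
noncomputable def evalML {n : ℕ} (c : Finset (Fin n) → ℝ) (x : Fin n → ℝ) : ℝ :=
  ∑ S : Finset (Fin n), c S * ∏ i ∈ S, x i

/-- The ±1 assignment corresponding to a Boolean assignment. -/
def signs {n : ℕ} (σ : Fin n → Bool) : Fin n → ℝ := fun i => if σ i then 1 else -1

theorem pow_four_sum_le {ι : Type*} (s : Finset ι) (f : ι → ℝ) :
    (∑ i ∈ s, f i) ^ 4 ≤ (#s : ℝ) ^ 3 * ∑ i ∈ s, f i ^ 4 := by
  have h1 : (∑ i ∈ s, f i) ^ 2 ≤ #s * ∑ i ∈ s, f i ^ 2 := sq_sum_le_card_mul_sum_sq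
  have h2 : (∑ i ∈ s, f i ^ 2) ^ 2 ≤ #s * ∑ i ∈ s, (f i ^ 2) ^ 2 := sq_sum_le_card_mul_sum_sq
  calc (∑ i ∈ s, f i) ^ 4 = ((∑ i ∈ s, f i) ^ 2) ^ 2 := by ring
    _ ≤ (#s * ∑ i ∈ s, f i ^ 2) ^ 2 := by gcongr
    _ = (#s : ℝ) ^ 2 * (∑ i ∈ s, f i ^ 2) ^ 2 := by ring
    _ ≤ (#s : ℝ) ^ 2 * (#s * ∑ i ∈ s, (f i ^ 2) ^ 2) := by gcongr
    _ = _ := by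
      simp_rw [← pow_mul]
      ring

theorem sum_choose_inter {α : Type*} (X : Finset α) (b M : ℕ) :
    ∑ A ∈ X.powerset, (if #A ≤ M then ((b.choose (M - #A) : ℕ) : ℝ) else 0) =
      ((#X + b).choose M : ℕ) := by
  rw [sum_powerset_apply_card (fun i => if i ≤ M then ((b.choose (M - i) : ℕ) : ℝ) else 0),
    Nat.add_choose_eq, Nat.sum_antidiagonal_eq_sum_range_succ_mk]
  push_cast
  simp only [nsmul_eq_mul, mul_ite, mul_zero]
  rw [← sum_filter]
  refine sum_subset_zero_on_sdiff ?_ ?_ fun _ _ => rfl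
  · intro i
    simp
  · intro i hi
    simp only [mem_sdiff, mem_range, mem_filter, not_and, not_le] at hi
    rw [Nat.choose_eq_zero_of_lt (by by_contra h; have := hi.2 (by omega); omega)]
    simp

theorem choose_mul_pow_le (m q j : ℕ) :
    (m + q + j).choose (m + j) * m ^ j ≤ (m + q + j) ^ j * (m + q).choose m := by
  induction j with
  | zero => simp
  | succ j ih =>
    have h := Nat.add_one_mul_choose_eq (m + q + j) (m + j)
    simp only [← add_assoc]
    calc (m + q + j + 1).choose (m + j + 1) * m ^ (j + 1)
        = (m + q + j + 1).choose (m + j + 1) * m * m ^ j := by ring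
      _ ≤ (m + q + j + 1).choose (m + j + 1) * (m + j + 1) * m ^ j :=
        Nat.mul_le_mul_right _ (Nat.mul_le_mul_left _ (by omega))
      _ = (m + q + j + 1) * ((m + q + j).choose (m + j) * m ^ j) := by rw [← h]; ring
      _ ≤ (m + q + j + 1) * ((m + q + j) ^ j * (m + q).choose m) := by gcongr
      _ ≤ (m + q + j + 1) * ((m + q + j + 1) ^ j * (m + q).choose m) :=
        Nat.mul_le_mul_left _ (Nat.mul_le_mul_right _ (Nat.pow_le_pow_left (by omega) _))
      _ = _ := by ring

theorem choose_mul_pow_mul_pow_le (r s j : ℕ) :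
    (r + s + 2 * j).choose (r + j) * (r ^ j * s ^ j) ≤
      (r + s + 2 * j) ^ (2 * j) * (r + s).choose r := by
  induction j with
  | zero => simp
  | succ j ih =>
    have h1 := Nat.add_one_mul_choose_eq (r + s + 2 * j + 1) (r + j)
    have h2 := Nat.choose_mul_succ_eq (r + s + 2 * j) (r + j)
    rw [show r + s + 2 * j + 1 - (r + j) = s + j + 1 by omega] at h2
    rw [show r + s + 2 * (j + 1) = r + s + 2 * j + 1 + 1 by ring, ← add_assoc r j 1]
    set N := r + s + 2 * j with hN
    set X := (N + 1 + 1).choose (r + j + 1)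
    calc X * (r ^ (j + 1) * s ^ (j + 1)) = X * r * s * (r ^ j * s ^ j) := by ring
      _ ≤ X * (r + j + 1) * (s + j + 1) * (r ^ j * s ^ j) := by gcongr <;> omega
      _ = (N + 1 + 1) * (N + 1) * (N.choose (r + j) * (r ^ j * s ^ j)) := by
        rw [← h1, mul_assoc (N + 1 + 1), ← h2]; ring
      _ ≤ (N + 1 + 1) * (N + 1) * (N ^ (2 * j) * (r + s).choose r) := by gcongr
      _ ≤ (N + 1 + 1) * (N + 1 + 1) * ((N + 1 + 1) ^ (2 * j) * (r + s).choose r) := by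
        gcongr <;> omega
      _ = _ := by ring

theorem sum_sq_two_mul_card_sub {α : Type*} [DecidableEq α] (s : Finset α) :
    ∑ y ∈ s.powerset, (2 * (#y : ℝ) - #s) ^ 2 = (#s : ℝ) * 2 ^ #s := by
  induction s using Finset.induction_on with
  | empty => simp
  | insert i s hi ih =>
    rw [sum_powerset_insert hi, ← sum_add_distrib, card_insert_of_notMem hi]
    have : ∀ y ∈ s.powerset, (2 * (#y : ℝ) - ((#s + 1 : ℕ) : ℝ)) ^ 2 +
        (2 * (#(insert i y) : ℝ) - ((#s + 1 : ℕ) : ℝ)) ^ 2 =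
        2 * (2 * (#y : ℝ) - #s) ^ 2 + 2 := by
      intro y hy
      rw [card_insert_of_notMem fun h => hi (mem_powerset.1 hy h)]
      push_cast
      ring
    rw [sum_congr rfl this, sum_add_distrib, ← mul_sum, ih]
    simp
    ring

theorem two_pow_le_four_mul_card_filter {α : Type*} [DecidableEq α] [Fintype α]
    (hn : 64 ≤ Fintype.card α) :
    (2 : ℝ) ^ Fintype.card α ≤
      4 * #{y : Finset α | Fintype.card α ≤ 2 * #y ∧ 8 * #y ≤ 5 * Fintype.card α} := by
  set n := Fintype.card α with hnn
  set A : Finset (Finset α) := {y : Finset α | n ≤ 2 * #y} with hA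
  set B : Finset (Finset α) := {y : Finset α | 5 * n < 8 * #y} with hB
  set G : Finset (Finset α) := {y : Finset α | n ≤ 2 * #y ∧ 8 * #y ≤ 5 * n} with hG
  have hcard : #(univ : Finset (Finset α)) = 2 ^ n := by simp [hnn]
  have h1 : 2 ^ n ≤ 2 * #A := by
    have himg : #Aᶜ ≤ #A := by
      refine card_le_card_of_injOn compl ?_ compl_injective.injOn
      intro y hy
      have := card_le_univ y
      simp only [hA, coe_compl, coe_filter, mem_univ, true_and, Set.mem_compl_iff,
        Set.mem_ofPred_eq, card_compl] at hy ⊢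
      omega
    have := card_compl_add_card A
    rw [← card_univ, hcard] at this
    omega
  have h2 : #A ≤ #G + #B := by
    refine (card_le_card ?_).trans (card_union_le G B)
    intro y
    simp only [hA, hG, hB, mem_filter, mem_univ, true_and, mem_union]
    omega
  have h3 : (#B : ℝ) * ((n : ℝ) / 4) ^ 2 ≤ n * 2 ^ n := by
    have := sum_sq_two_mul_card_sub (univ : Finset α)
    rw [card_univ, ← hnn] at this
    rw [← this, ← nsmul_eq_mul, ← sum_const]
    calc ∑ y ∈ B, ((n : ℝ) / 4) ^ 2 ≤ ∑ y ∈ B, (2 * (#y : ℝ) - n) ^ 2 := by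
          refine sum_le_sum fun y hy => ?_
          have : (5 * n : ℝ) < 8 * #y := by exact_mod_cast (mem_filter.1 hy).2
          have : (n : ℝ) / 4 ≤ 2 * #y - n := by linarith
          gcongr
      _ ≤ _ := sum_le_sum_of_subset_of_nonneg (by simp) fun _ _ _ => by positivity
  have hn' : (64 : ℝ) ≤ n := by exact_mod_cast hn
  have h4 : 4 * (#B : ℝ) ≤ 2 ^ n := by
    have hp : (0 : ℝ) < 2 ^ n := by positivity
    have : (#B : ℝ) * n ≤ 16 * 2 ^ n := by
      refine le_of_mul_le_mul_right ?_ (by linarith : (0 : ℝ) < n)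
      nlinarith
    nlinarith [(Nat.cast_nonneg #B : (0 : ℝ) ≤ #B)]
  have h1' : (2 : ℝ) ^ n ≤ 2 * #A := by exact_mod_cast h1
  have h2' : (#A : ℝ) ≤ #G + #B := by exact_mod_cast h2
  linarith

section

variable {α : Type*} [DecidableEq α]

/-- The value at the indicator of `y` of the multilinear polynomial with coefficients `c`. -/
def mlEval (c : Finset α → ℝ) (y : Finset α) : ℝ := ∑ S ∈ y.powerset, c S

/-- Bonami's lemma for the uniform measure on the subsets of `s`. -/
theorem bonami (s : Finset α) : ∀ (d : ℕ) (c : Finset α → ℝ), (∀ S, d < #S → c S = 0) →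
    2 ^ #s * ∑ y ∈ s.powerset, mlEval c y ^ 4 ≤
      9 ^ d * (∑ y ∈ s.powerset, mlEval c y ^ 2) ^ 2 := by
  induction s using Finset.induction_on with
  | empty =>
    intro d c _
    simp only [powerset_empty, sum_singleton, card_empty, pow_zero, one_mul, ← pow_mul]
    exact le_mul_of_one_le_left (by positivity) (one_le_pow₀ (by norm_num))
  | insert i s hi ih =>
    intro d c hc
    set b : Finset α → ℝ := fun S => if i ∈ S then 0 else c (insert i S) / 2 with hb
    set a : Finset α → ℝ := fun S => c S + b S with ha
    have hbz : ∀ S, d ≤ #S → b S = 0 := by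
      intro S hS
      by_cases h : i ∈ S
      · simp [hb, h]
      · simp [hb, h, hc (insert i S) (by rw [card_insert_of_notMem h]; omega)]
    have hac : ∀ S, d < #S → a S = 0 := fun S hS => by simp [ha, hc S hS, hbz S hS.le]
    have e1 : ∀ y ∈ s.powerset, mlEval c y = mlEval a y - mlEval b y := by
      intro y _
      simp [mlEval, ha, sum_add_distrib]
    have e2 : ∀ y ∈ s.powerset, mlEval c (insert i y) = mlEval a y + mlEval b y := by
      intro y hy
      have hiy : i ∉ y := fun h => hi (mem_powerset.1 hy h)
      have : ∑ S ∈ y.powerset, c (insert i S) = 2 * ∑ S ∈ y.powerset, b S := by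
        rw [mul_sum]
        refine sum_congr rfl fun S hS => ?_
        have : i ∉ S := fun h => hiy (mem_powerset.1 hS h)
        simp only [hb, this, if_false]
        ring
      rw [mlEval, sum_powerset_insert hiy, this]
      simp only [mlEval, ha, sum_add_distrib]
      ring
    have hA := ih d a hac
    have hB : 2 ^ #s * ∑ y ∈ s.powerset, mlEval b y ^ 4 ≤
        9 ^ d / 9 * (∑ y ∈ s.powerset, mlEval b y ^ 2) ^ 2 := by
      rcases d with _ | d
      · have : ∀ y, mlEval b y = 0 := fun y => sum_eq_zero fun S _ => hbz S (Nat.zero_le _)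
        simp [this]
      · refine (ih d b fun S hS => hbz S hS).trans (le_of_eq ?_)
        ring
    have hAB : (∑ y ∈ s.powerset, mlEval a y ^ 2 * mlEval b y ^ 2) ^ 2 ≤
        (∑ y ∈ s.powerset, mlEval a y ^ 4) * ∑ y ∈ s.powerset, mlEval b y ^ 4 := by
      have := sum_mul_sq_le_sq_mul_sq s.powerset (fun y => mlEval a y ^ 2)
        (fun y => mlEval b y ^ 2)
      simpa only [← pow_mul] using this
    have s4 : ∑ y ∈ (insert i s).powerset, mlEval c y ^ 4 =
        2 * ∑ y ∈ s.powerset, mlEval a y ^ 4 +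
          12 * ∑ y ∈ s.powerset, mlEval a y ^ 2 * mlEval b y ^ 2 +
          2 * ∑ y ∈ s.powerset, mlEval b y ^ 4 := by
      rw [sum_powerset_insert hi, ← sum_add_distrib, mul_sum, mul_sum, mul_sum,
        ← sum_add_distrib, ← sum_add_distrib]
      refine sum_congr rfl fun y hy => ?_
      rw [e1 y hy, e2 y hy]
      ring
    have s2 : ∑ y ∈ (insert i s).powerset, mlEval c y ^ 2 =
        2 * ∑ y ∈ s.powerset, mlEval a y ^ 2 + 2 * ∑ y ∈ s.powerset, mlEval b y ^ 2 := by
      rw [sum_powerset_insert hi, ← sum_add_distrib, mul_sum, mul_sum, ← sum_add_distrib]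
      refine sum_congr rfl fun y hy => ?_
      rw [e1 y hy, e2 y hy]
      ring
    rw [s4, s2, card_insert_of_notMem hi, pow_succ]
    have pA2 : 0 ≤ ∑ y ∈ s.powerset, mlEval a y ^ 2 := sum_nonneg fun _ _ => by positivity
    have pB2 : 0 ≤ ∑ y ∈ s.powerset, mlEval b y ^ 2 := sum_nonneg fun _ _ => by positivity
    have pA4 : 0 ≤ ∑ y ∈ s.powerset, mlEval a y ^ 4 := sum_nonneg fun _ _ => by positivity
    have pB4 : 0 ≤ ∑ y ∈ s.powerset, mlEval b y ^ 4 := sum_nonneg fun _ _ => by positivity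
    generalize (∑ y ∈ s.powerset, mlEval a y ^ 2) = A2 at *
    generalize (∑ y ∈ s.powerset, mlEval b y ^ 2) = B2 at *
    generalize (∑ y ∈ s.powerset, mlEval a y ^ 4) = A4 at *
    generalize (∑ y ∈ s.powerset, mlEval b y ^ 4) = B4 at *
    generalize (∑ y ∈ s.powerset, mlEval a y ^ 2 * mlEval b y ^ 2) = AB at *
    have hN : (0 : ℝ) < 2 ^ #s := by positivity
    have h9 : (0 : ℝ) < 9 ^ d := by positivity
    generalize (2 : ℝ) ^ #s = N at *
    generalize (9 : ℝ) ^ d = K at *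
    have hmix : N * AB ≤ K / 3 * (A2 * B2) := by
      refine le_of_sq_le_sq ?_ (by positivity)
      calc (N * AB) ^ 2 = N ^ 2 * AB ^ 2 := by ring
        _ ≤ N ^ 2 * (A4 * B4) := by gcongr
        _ = (N * A4) * (N * B4) := by ring
        _ ≤ (K * A2 ^ 2) * (K / 9 * B2 ^ 2) := by gcongr
        _ = (K / 3 * (A2 * B2)) ^ 2 := by ring
    nlinarith [mul_nonneg h9.le (sq_nonneg B2)]

/-- Coefficients of a homogeneous multilinear polynomial of degree `j` killed by `∑ i, ∂ᵢ`,
equivalently orthogonal to everything of lower degree. -/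
structure IsHarmonic [Fintype α] (j : ℕ) (c : Finset α → ℝ) : Prop where
  eq_zero : ∀ S, #S ≠ j → c S = 0
  sum_superset_eq_zero : ∀ A, #A < j → ∑ S with A ⊆ S, c S = 0

variable [Fintype α]

namespace IsHarmonic

variable {j : ℕ} {c : Finset α → ℝ}

theorem sum_superset (h : IsHarmonic j c) (A : Finset α) : ∑ S with A ⊆ S, c S = c A := by
  rcases lt_or_ge #A j with hA | hA
  · rw [h.sum_superset_eq_zero A hA, h.eq_zero A hA.ne]
  · refine sum_eq_single_of_mem A (by simp) fun S hS hne => h.eq_zero S fun hcard => hne ?_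
    exact (eq_of_subset_of_card_le (mem_filter.1 hS).2 (by omega)).symm

theorem sum_mul_sum_inter (h : IsHarmonic j c) (T : Finset α) (f : ℕ → ℝ) :
    ∑ S, c S * ∑ A ∈ (S ∩ T).powerset, f #A = f j * mlEval c T := by
  have : ∀ S : Finset α, c S * ∑ A ∈ (S ∩ T).powerset, f #A =
      ∑ A ∈ T.powerset, if A ⊆ S then c S * f #A else 0 := by
    intro S
    rw [← sum_filter, mul_sum]
    refine sum_congr ?_ fun _ _ => rfl
    ext A
    simp only [mem_filter, mem_powerset, subset_inter_iff, and_comm]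
  simp_rw [this]
  rw [sum_comm, mlEval, mul_sum]
  refine sum_congr rfl fun A _ => ?_
  rw [← sum_filter, ← sum_mul, h.sum_superset]
  by_cases hA : #A = j
  · rw [hA, mul_comm]
  · simp [h.eq_zero A hA]

theorem mlEval_eq_zero (h : IsHarmonic j c) {T : Finset α} (hT : #T < j) :
    mlEval c T = 0 :=
  Finset.sum_eq_zero fun S hS => h.eq_zero S (by have := card_le_card (mem_powerset.1 hS); omega)

theorem mlEval_eq (h : IsHarmonic j c) {T : Finset α} (hT : #T = j) :
    mlEval c T = c T := by
  refine sum_eq_single_of_mem T (by simp) fun S hS hne => h.eq_zero S fun hcard => hne ?_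
  exact eq_of_subset_of_card_le (mem_powerset.1 hS) (by omega)

end IsHarmonic

theorem card_superset_powersetCard (T : Finset α) (m : ℕ) (hm : m ≤ Fintype.card α) :
    #{y ∈ powersetCard m univ | T ⊆ y} = (Fintype.card α - #T).choose (Fintype.card α - m) := by
  rw [← card_compl, ← card_powersetCard]
  refine card_bij' (fun y _ => yᶜ) (fun y _ => yᶜ) ?_ ?_ ?_ ?_
  · intro y hy
    simp only [mem_filter, mem_powersetCard, subset_univ, true_and] at hy
    simp only [mem_powersetCard, card_compl, hy.1, compl_subset_compl]
    exact ⟨hy.2, trivial⟩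
  · intro y hy
    simp only [mem_powersetCard] at hy
    simp only [mem_filter, mem_powersetCard, subset_univ, true_and, card_compl]
    exact ⟨by omega, by simpa using compl_subset_compl.2 hy.1⟩
  · simp
  · simp

theorem sum_mul_mlEval (P : Finset (Finset α)) (c : Finset α → ℝ) (F : Finset α → ℝ) :
    ∑ y ∈ P, F y * mlEval c y = ∑ S, c S * ∑ y ∈ P with S ⊆ y, F y := by
  have : ∀ y, F y * mlEval c y = ∑ S, if S ⊆ y then c S * F y else 0 := by
    intro y
    rw [← sum_filter, mlEval, mul_sum]
    refine sum_congr ?_ fun _ _ => mul_comm _ _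
    ext S
    simp
  simp_rw [this]
  rw [sum_comm]
  simp_rw [mul_sum, ← sum_filter]

theorem sum_mlEval (P : Finset (Finset α)) (c : Finset α → ℝ) :
    ∑ y ∈ P, mlEval c y = ∑ S, c S * #{y ∈ P | S ⊆ y} := by
  simpa using sum_mul_mlEval P c 1

namespace IsHarmonic

variable {j : ℕ} {c : Finset α → ℝ}

theorem sum_superset_powersetCard (h : IsHarmonic j c) (T : Finset α) {m : ℕ}
    (hm : m + j ≤ Fintype.card α) (hT : #T + j ≤ Fintype.card α) :
    ∑ y ∈ powersetCard m univ with T ⊆ y, mlEval c y =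
      ((Fintype.card α - #T - j).choose (Fintype.card α - m - j) : ℕ) * mlEval c T := by
  set M := Fintype.card α - m with hM
  set b := Fintype.card α - #T - j with hb
  have key := h.sum_mul_sum_inter T
    (fun i => if i ≤ M then ((b.choose (M - i) : ℕ) : ℝ) else 0)
  simp only [show j ≤ M by omega, if_true] at key
  rw [← key, sum_mlEval]
  refine sum_congr rfl fun S _ => ?_
  by_cases hS : #S = j
  · rw [sum_choose_inter, filter_filter]
    simp_rw [← union_subset_iff]
    rw [card_superset_powersetCard _ _ (by omega)]
    have := card_union_add_card_inter T S
    rw [inter_comm] at this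
    congr 3
    have := card_le_univ (T ∪ S)
    omega
  · simp [h.eq_zero S hS]

theorem sum_mul_mlEval_eq_zero (h : IsHarmonic j c) {l m : ℕ} {c' : Finset α → ℝ}
    (h' : IsHarmonic l c') (hlj : l < j) (hm : m + j ≤ Fintype.card α)
    (hl : l + j ≤ Fintype.card α) :
    ∑ y ∈ powersetCard m univ, mlEval c y * mlEval c' y = 0 := by
  rw [sum_mul_mlEval]
  refine Finset.sum_eq_zero fun S _ => ?_
  by_cases hS : #S = l
  · rw [h.sum_superset_powersetCard S hm (by omega), h.mlEval_eq_zero (by omega)]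
    simp
  · simp [h'.eq_zero S hS]

theorem sum_sq_powersetCard (h : IsHarmonic j c) {m : ℕ} (hm : m + j ≤ Fintype.card α)
    (hj : 2 * j ≤ Fintype.card α) :
    ∑ y ∈ powersetCard m univ, mlEval c y ^ 2 =
      ((Fintype.card α - 2 * j).choose (Fintype.card α - m - j) : ℕ) * ∑ S, c S ^ 2 := by
  simp_rw [pow_two]
  rw [sum_mul_mlEval, mul_sum]
  refine sum_congr rfl fun S _ => ?_
  by_cases hS : #S = j
  · rw [h.sum_superset_powersetCard S hm (by omega), h.mlEval_eq hS, hS,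
      show Fintype.card α - j - j = Fintype.card α - 2 * j by omega]
    ring
  · simp [h.eq_zero S hS]

theorem sum_sq (h : IsHarmonic j c) :
    4 ^ j * ∑ y, mlEval c y ^ 2 = 2 ^ Fintype.card α * ∑ S, c S ^ 2 := by
  simp_rw [pow_two (mlEval c _)]
  rw [sum_mul_mlEval, mul_sum, mul_sum]
  refine sum_congr rfl fun T _ => ?_
  by_cases hT : #T = j
  · have key := h.sum_mul_sum_inter T (fun _ => 1)
    rw [one_mul, h.mlEval_eq hT] at key
    have : 4 ^ j * ∑ y with T ⊆ y, mlEval c y = 2 ^ Fintype.card α * c T := by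
      rw [← key, sum_mlEval, mul_sum, mul_sum]
      refine sum_congr rfl fun S _ => ?_
      by_cases hS : #S = j
      · rw [filter_filter]
        simp_rw [← union_subset_iff]
        have e : #{y : Finset α | T ∪ S ⊆ y} = 2 ^ (Fintype.card α - #(T ∪ S)) := by
          rw [← card_univ, ← card_Icc_finset (subset_univ (T ∪ S))]
          congr 1
          ext
          simp
        have h1 := card_union_add_card_inter T S
        have h2 := card_le_univ (T ∪ S)
        rw [e]
        simp only [sum_const, card_powerset, nsmul_eq_mul, mul_one]
        push_cast
        have : (4 : ℝ) ^ j * 2 ^ (Fintype.card α - #(T ∪ S)) =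
            2 ^ Fintype.card α * 2 ^ #(S ∩ T) := by
          rw [show (4 : ℝ) = 2 ^ 2 by norm_num, ← pow_mul, ← pow_add, ← pow_add]
          congr 1
          rw [inter_comm]
          omega
        linear_combination c S * this
      · simp [h.eq_zero S hS]
    linear_combination c T * this
  · simp [h.eq_zero T hT]

end IsHarmonic

end

section

variable {α : Type*} [DecidableEq α]

theorem card_filter_superset_powersetCard {A y : Finset α} (hA : A ⊆ y) {d : ℕ} (hd : #A ≤ d) :
    #{S ∈ powersetCard d y | A ⊆ S} = (#y - #A).choose (d - #A) := by
  rw [← card_sdiff_of_subset hA, ← card_powersetCard]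
  refine card_bij' (fun S _ => S \ A) (fun S _ => S ∪ A) ?_ ?_ ?_ ?_
  · intro S hS
    simp only [mem_filter, mem_powersetCard] at hS ⊢
    exact ⟨sdiff_subset_sdiff hS.1.1 Subset.rfl, by rw [card_sdiff_of_subset hS.2, hS.1.2]⟩
  · intro S hS
    simp only [mem_filter, mem_powersetCard, subset_sdiff] at hS ⊢
    refine ⟨⟨union_subset hS.1.1 hA, ?_⟩, subset_union_right⟩
    rw [card_union_of_disjoint hS.1.2, hS.2]
    omega
  · intro S hS
    exact sdiff_union_of_subset (mem_filter.1 hS).2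
  · intro S hS
    rw [mem_powersetCard, subset_sdiff] at hS
    exact union_sdiff_cancel_right hS.1.2

variable [Fintype α]

theorem exists_harmonic_top (k d : ℕ) (c : Finset α → ℝ) (hc : ∀ S, d < #S → c S = 0) :
    ∃ h c' : Finset α → ℝ, IsHarmonic d h ∧ (∀ S, d ≤ #S → c' S = 0) ∧
      ∀ y, #y = k → mlEval c y = mlEval c' y + mlEval h y := by
  let e : Finset α → EuclideanSpace ℝ (Finset α) := fun A =>
    WithLp.toLp 2 fun S => if #A < d ∧ #S = d ∧ A ⊆ S then 1 else 0
  obtain ⟨u, hu, z, hz, huz⟩ := (Submodule.span ℝ (Set.range e)).exists_add_mem_mem_orthogonal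
    (WithLp.toLp 2 fun S => if #S = d then c S else 0)
  obtain ⟨v, rfl⟩ := (Submodule.mem_span_range_iff_exists_fun ℝ).1 hu
  have hS : ∀ S, (if #S = d then c S else 0) =
      (∑ A, v A * if #A < d ∧ #S = d ∧ A ⊆ S then 1 else 0) + z S := by
    intro S
    have := congrArg (fun w : EuclideanSpace ℝ (Finset α) => w S) huz
    simpa [e] using this
  refine ⟨fun S => z S,
    fun S => if #S < d then c S + v S * ((k - #S).choose (d - #S) : ℕ) else 0, ⟨?_, ?_⟩, ?_, ?_⟩
  · intro S hne
    have := hS S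
    simpa [hne] using this.symm
  · intro A hA
    have := (Submodule.mem_orthogonal _ z).1 hz (e A) (Submodule.subset_span ⟨A, rfl⟩)
    simp only [PiLp.inner_apply, e, hA, true_and, RCLike.inner_apply, conj_trivial, mul_ite,
      mul_one, mul_zero] at this
    rw [← this, sum_filter]
    refine sum_congr rfl fun S _ => ?_
    by_cases hSd : #S = d
    · simp [hSd]
    · have := hS S
      simp only [hSd, if_false, false_and, and_false, mul_zero, sum_const_zero, zero_add] at this
      simp [← this]
  · intro S h
    simp [h.not_gt]
  · intro y hy
    have hsplit : ∀ S, c S = (if #S < d then c S else 0) + if #S = d then c S else 0 := by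
      intro S
      rcases lt_trichotomy #S d with h | h | h
      · simp [h, h.ne]
      · simp [h]
      · simp [hc S h]
    have hcount : ∑ S ∈ y.powerset, ∑ A, v A * (if #A < d ∧ #S = d ∧ A ⊆ S then 1 else 0) =
        ∑ A ∈ y.powerset, if #A < d then v A * ((k - #A).choose (d - #A) : ℕ) else 0 := by
      rw [sum_comm, ← sum_subset (subset_univ y.powerset)]
      · refine sum_congr rfl fun A hA => ?_
        split_ifs with h
        · rw [← hy, ← card_filter_superset_powersetCard (mem_powerset.1 hA) h.le, ← mul_sum,
            ← sum_filter, sum_const, nsmul_one]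
          congr 3
          ext S
          simp only [mem_filter, mem_powerset, mem_powersetCard, h, true_and]
          tauto
        · simp [h]
      · intro A _ hA
        refine sum_eq_zero fun S hS => ?_
        rw [if_neg, mul_zero]
        exact fun h => hA (mem_powerset.2 (h.2.2.trans (mem_powerset.1 hS)))
    simp only [mlEval]
    rw [sum_congr rfl fun S _ => hsplit S, sum_add_distrib, sum_congr rfl fun S _ => hS S,
      sum_add_distrib, hcount, ← add_assoc, ← sum_add_distrib]
    congr 1
    refine sum_congr rfl fun S _ => ?_
    split_ifs <;> simp

theorem exists_harmonic_decomposition (k : ℕ) : ∀ (d : ℕ) (c : Finset α → ℝ),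
    (∀ S, d ≤ #S → c S = 0) → ∃ h : ℕ → Finset α → ℝ, (∀ j, IsHarmonic j (h j)) ∧
      ∀ y, #y = k → mlEval c y = ∑ j ∈ range d, mlEval (h j) y := by
  intro d
  induction d with
  | zero =>
    intro c hc
    refine ⟨fun _ _ => 0, fun j => ⟨by simp, by simp⟩, fun y _ => ?_⟩
    simp [mlEval, hc]
  | succ d ih =>
    intro c hc
    obtain ⟨h, c', hh, hc', he⟩ := exists_harmonic_top k d c hc
    obtain ⟨g, hg, hge⟩ := ih c' hc'
    refine ⟨Function.update g d h, fun j => ?_, fun y hy => ?_⟩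
    · rcases eq_or_ne j d with rfl | hj
      · simpa
      · simpa [hj] using hg j
    · rw [sum_range_succ, he y hy, hge y hy, Function.update_self]
      congr 1
      refine sum_congr rfl fun j hj => ?_
      rw [Function.update_of_ne (mem_range.1 hj).ne]

/-- Contraction of the fourth moment when passing to a higher slice. -/
theorem IsHarmonic.sum_pow_four_le {j : ℕ} {c : Finset α → ℝ} (h : IsHarmonic j c) {k m : ℕ}
    (hkm : k ≤ m) (hm : m + j ≤ Fintype.card α) {r : ℝ} (hr : 0 ≤ r)
    (hrc : r * ((Fintype.card α - k).choose (Fintype.card α - m) : ℕ) ≤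
      ((Fintype.card α - k - j).choose (Fintype.card α - m - j) : ℕ)) :
    r ^ 4 * ((Fintype.card α).choose m : ℕ) * ∑ x ∈ powersetCard k univ, mlEval c x ^ 4 ≤
      ((Fintype.card α).choose k : ℕ) * ∑ y ∈ powersetCard m univ, mlEval c y ^ 4 := by
  set n := Fintype.card α
  set N : ℝ := (((n - k).choose (n - m) : ℕ) : ℝ) with hN
  have hNpos : 0 < N := by
    rw [hN, Nat.cast_pos]
    exact Nat.choose_pos (by omega)
  have h1 : ∀ x ∈ powersetCard k (univ : Finset α), (r * N) ^ 4 * mlEval c x ^ 4 ≤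
      N ^ 3 * ∑ y ∈ powersetCard m univ with x ⊆ y, mlEval c y ^ 4 := by
    intro x hx
    have hxk : #x = k := (mem_powersetCard.1 hx).2
    have := pow_four_sum_le {y ∈ powersetCard m univ | x ⊆ y} (mlEval c)
    rw [h.sum_superset_powersetCard x hm (by omega), card_superset_powersetCard x m (by omega),
      hxk, mul_pow] at this
    exact le_trans (by gcongr) this
  have h2 : (r * N) ^ 4 * ∑ x ∈ powersetCard k univ, mlEval c x ^ 4 ≤
      N ^ 3 * ((m.choose k : ℕ) * ∑ y ∈ powersetCard m univ, mlEval c y ^ 4) := by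
    rw [mul_sum]
    refine (sum_le_sum h1).trans (le_of_eq ?_)
    simp_rw [sum_filter]
    rw [← mul_sum, sum_comm]
    congr 1
    rw [mul_sum]
    refine sum_congr rfl fun y hy => ?_
    rw [← sum_filter, sum_const, nsmul_eq_mul]
    congr 2
    rw [← (mem_powersetCard.1 hy).2, ← card_powersetCard]
    congr 1
    ext x
    simp only [mem_filter, mem_powersetCard, subset_univ, true_and]
    tauto
  have h3 : ((n.choose m : ℕ) : ℝ) * (m.choose k : ℕ) = (n.choose k : ℕ) * N := by
    have := Nat.choose_mul (n := n) hkm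
    rw [← Nat.choose_symm_of_eq_add (show n - k = (n - m) + (m - k) by omega)] at this
    rw [hN]
    exact_mod_cast this
  refine le_of_mul_le_mul_left ?_ (pow_pos hNpos 4)
  calc N ^ 4 * (r ^ 4 * (n.choose m : ℕ) * ∑ x ∈ powersetCard k univ, mlEval c x ^ 4)
      = (n.choose m : ℕ) * ((r * N) ^ 4 * ∑ x ∈ powersetCard k univ, mlEval c x ^ 4) := by ring
    _ ≤ (n.choose m : ℕ) *
        (N ^ 3 * ((m.choose k : ℕ) * ∑ y ∈ powersetCard m univ, mlEval c y ^ 4)) := by gcongr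
    _ = N ^ 3 * ((n.choose m : ℕ) * (m.choose k : ℕ)) *
        ∑ y ∈ powersetCard m univ, mlEval c y ^ 4 := by ring
    _ = _ := by rw [h3]; ring

end

section

variable {α : Type*} [DecidableEq α] [Fintype α]

theorem IsHarmonic.hypercontractive {j : ℕ} {c : Finset α → ℝ} (h : IsHarmonic j c) {k : ℕ}
    {p : ℝ} (hk : (k : ℝ) = p * Fintype.card α) (hp : 0 < p) (hp' : p ≤ 1 / 2)
    (hj : 16 * (j : ℝ) ≤ p * Fintype.card α) (hn : 64 ≤ Fintype.card α) :
    ((Fintype.card α).choose k : ℕ) * ∑ x ∈ powersetCard k univ, mlEval c x ^ 4 ≤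
      4 * (64 * ((1 - p) / p) ^ 2) ^ j * (∑ x ∈ powersetCard k univ, mlEval c x ^ 2) ^ 2 := by
  set n := Fintype.card α with hnn
  have hnR : (64 : ℝ) ≤ n := by exact_mod_cast hn
  have hpn : p * n ≤ n / 2 := by nlinarith
  have h2k : 2 * k ≤ n := by
    have : (2 * k : ℝ) ≤ n := by linarith
    exact_mod_cast this
  have hjk : 16 * j ≤ k := by
    rw [← hk] at hj
    exact_mod_cast hj
  have hq : 0 < 1 - p := by linarith
  set t : ℝ := 1 / (3 * (1 - p)) with ht
  set θ : ℝ := (15 / 16) ^ 2 * (p * (1 - p)) with hθ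
  have htpos : 0 < t := by positivity
  have hθpos : 0 < θ := by positivity
  set X4 := ∑ x ∈ powersetCard k univ, mlEval c x ^ 4
  set X2 := ∑ x ∈ powersetCard k univ, mlEval c x ^ 2
  set K := ∑ S, c S ^ 2
  set C : ℝ := ((n.choose k : ℕ) : ℝ) with hC
  have hX4 : 0 ≤ X4 := sum_nonneg fun _ _ => by positivity
  have hK : 0 ≤ K := sum_nonneg fun _ _ => by positivity
  have hCpos : 0 < C := by
    rw [hC, Nat.cast_pos]
    exact Nat.choose_pos (by omega)
  have hnk : ((n - k : ℕ) : ℝ) = (1 - p) * n := by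
    rw [Nat.cast_sub (by omega), hk]
    ring
  have slice : ∀ m, n ≤ 2 * m → 8 * m ≤ 5 * n → (t ^ j) ^ 4 * (n.choose m : ℕ) * X4 ≤
      C * ∑ y ∈ powersetCard m univ, mlEval c y ^ 4 := by
    intro m h1 h2
    refine h.sum_pow_four_le (by omega) (by omega) (by positivity) ?_
    have := choose_mul_pow_le (n - m - j) (m - k) j
    rw [show n - m - j + (m - k) + j = n - k by omega, show n - m - j + j = n - m by omega,
      show n - m - j + (m - k) = n - k - j by omega] at this
    have h3 : (((n - k).choose (n - m) : ℕ) : ℝ) * ((n - m - j : ℕ) : ℝ) ^ j ≤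
        ((1 - p) * n) ^ j * ((n - k - j).choose (n - m - j) : ℕ) := by
      rw [← hnk]
      exact_mod_cast this
    have h4 : t * ((1 - p) * n) ≤ ((n - m - j : ℕ) : ℝ) := by
      have h5 : n ≤ 3 * (n - m - j) := by omega
      have h6 : (n : ℝ) ≤ 3 * ((n - m - j : ℕ) : ℝ) := by exact_mod_cast h5
      have : t * ((1 - p) * n) = n / 3 := by
        rw [ht]
        field_simp
      linarith
    have hpos : 0 < ((1 - p) * n) ^ j := by
      have : (0 : ℝ) < n := by linarith
      positivity
    refine le_of_mul_le_mul_right ?_ hpos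
    calc t ^ j * (((n - k).choose (n - m) : ℕ) : ℝ) * ((1 - p) * n) ^ j
        = (((n - k).choose (n - m) : ℕ) : ℝ) * (t * ((1 - p) * n)) ^ j := by
          rw [mul_pow t]
          ring
      _ ≤ (((n - k).choose (n - m) : ℕ) : ℝ) * ((n - m - j : ℕ) : ℝ) ^ j := by
          have : 0 ≤ t * ((1 - p) * n) := by positivity
          gcongr
      _ ≤ _ := by linarith
  have hcube : 16 ^ j * ∑ y, mlEval c y ^ 4 ≤ 9 ^ j * 2 ^ n * K ^ 2 := by
    have h1 := bonami univ j c fun S hS => h.eq_zero S hS.ne'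
    have h2 := h.sum_sq
    rw [powerset_univ, card_univ, ← hnn] at h1
    rw [← hnn] at h2
    refine le_of_mul_le_mul_left ?_ (by positivity : (0 : ℝ) < 2 ^ n)
    have h16 : (16 : ℝ) ^ j = (4 ^ j) ^ 2 := by
      rw [← pow_mul, mul_comm, pow_mul]
      norm_num
    calc (2 : ℝ) ^ n * (16 ^ j * ∑ y, mlEval c y ^ 4)
        = (4 ^ j) ^ 2 * (2 ^ n * ∑ y, mlEval c y ^ 4) := by rw [h16]; ring
      _ ≤ (4 ^ j) ^ 2 * (9 ^ j * (∑ y, mlEval c y ^ 2) ^ 2) := by gcongr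
      _ = 9 ^ j * (4 ^ j * ∑ y, mlEval c y ^ 2) ^ 2 := by ring
      _ = _ := by rw [h2]; ring
  have hsum : (t ^ j) ^ 4 * #{y : Finset α | n ≤ 2 * #y ∧ 8 * #y ≤ 5 * n} * X4 ≤
      C * ∑ y, mlEval c y ^ 4 := by
    have h1 : (#{y : Finset α | n ≤ 2 * #y ∧ 8 * #y ≤ 5 * n} : ℝ) =
        ∑ m ∈ range (n + 1), if n ≤ 2 * m ∧ 8 * m ≤ 5 * n then ((n.choose m : ℕ) : ℝ) else 0 := by
      have := sum_powerset_apply_card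
        (fun m => if n ≤ 2 * m ∧ 8 * m ≤ 5 * n then (1 : ℝ) else 0) (x := (univ : Finset α))
      rw [powerset_univ, card_univ, ← hnn, sum_boole] at this
      rw [this]
      simp
    rw [h1, ← powerset_univ, sum_powerset, card_univ, ← hnn,
      mul_sum (range (n + 1)), mul_sum (range (n + 1)), sum_mul (range (n + 1))]
    refine sum_le_sum fun m _ => ?_
    split_ifs with hm
    · exact slice m hm.1 hm.2
    · rw [mul_zero, zero_mul]
      exact mul_nonneg hCpos.le (sum_nonneg fun _ _ => by positivity)
  have hfour : 16 ^ j * (t ^ j) ^ 4 * X4 ≤ 4 * 9 ^ j * C * K ^ 2 := by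
    have hG := two_pow_le_four_mul_card_filter hn
    rw [← hnn] at hG
    refine le_of_mul_le_mul_left ?_ (by positivity : (0 : ℝ) < 2 ^ n)
    calc (2 : ℝ) ^ n * (16 ^ j * (t ^ j) ^ 4 * X4)
        ≤ (4 * #{y : Finset α | n ≤ 2 * #y ∧ 8 * #y ≤ 5 * n}) * (16 ^ j * (t ^ j) ^ 4 * X4) := by
          gcongr
      _ = 4 * 16 ^ j * ((t ^ j) ^ 4 * #{y : Finset α | n ≤ 2 * #y ∧ 8 * #y ≤ 5 * n} * X4) := by
          ring
      _ ≤ 4 * 16 ^ j * (C * ∑ y, mlEval c y ^ 4) := by gcongr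
      _ = 4 * C * (16 ^ j * ∑ y, mlEval c y ^ 4) := by ring
      _ ≤ 4 * C * (9 ^ j * 2 ^ n * K ^ 2) := by gcongr
      _ = _ := by ring
  have htwo : C * θ ^ j * K ≤ X2 := by
    have h1 : X2 = _ := h.sum_sq_powersetCard (m := k) (by omega) (by omega)
    rw [h1]
    refine mul_le_mul_of_nonneg_right ?_ hK
    rw [← hnn]
    have := choose_mul_pow_mul_pow_le (k - j) (n - k - j) j
    rw [show k - j + (n - k - j) + 2 * j = n by omega, show k - j + j = k by omega,
      show k - j + (n - k - j) = n - 2 * j by omega,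
      ← Nat.choose_symm_of_eq_add (show n - 2 * j = (n - k - j) + (k - j) by omega)] at this
    have h3 : C * (((k - j : ℕ) : ℝ) ^ j * ((n - k - j : ℕ) : ℝ) ^ j) ≤
        (n : ℝ) ^ (2 * j) * ((n - 2 * j).choose (n - k - j) : ℕ) := by
      rw [hC]
      exact_mod_cast this
    have h4 : 15 / 16 * p * n ≤ ((k - j : ℕ) : ℝ) := by
      rw [Nat.cast_sub (by omega), hk]
      linarith
    have h5 : 15 / 16 * (1 - p) * n ≤ ((n - k - j : ℕ) : ℝ) := by
      rw [Nat.cast_sub (by omega), hnk]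
      linarith
    have hnpos : (0 : ℝ) < n := by linarith
    refine le_of_mul_le_mul_left ?_ (pow_pos hnpos (2 * j))
    refine le_trans (le_of_eq ?_) ((mul_le_mul_of_nonneg_left (mul_le_mul
      (pow_le_pow_left₀ (by positivity) h4 j) (pow_le_pow_left₀ (by positivity) h5 j)
      (by positivity) (by positivity)) hCpos.le).trans h3)
    rw [← mul_pow, pow_mul, hθ, mul_left_comm, ← mul_pow]
    congr 2
    ring
  have hnum : 9 ≤ 16 * t ^ 4 * θ ^ 2 * (64 * ((1 - p) / p) ^ 2) := by
    have : 16 * t ^ 4 * θ ^ 2 * (64 * ((1 - p) / p) ^ 2) = 16 * 64 / 81 * (15 / 16) ^ 4 := by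
      rw [ht, hθ]
      field_simp
      norm_num
    rw [this]
    norm_num
  refine le_of_mul_le_mul_left ?_ (by positivity : 0 < (16 * t ^ 4 * θ ^ 2) ^ j)
  calc (16 * t ^ 4 * θ ^ 2) ^ j * (C * X4)
      = C * (θ ^ j) ^ 2 * (16 ^ j * (t ^ j) ^ 4 * X4) := by
        rw [mul_pow, mul_pow, ← pow_mul t, ← pow_mul θ, ← pow_mul t, ← pow_mul θ, mul_comm 4 j,
          mul_comm 2 j]
        ring
    _ ≤ C * (θ ^ j) ^ 2 * (4 * 9 ^ j * C * K ^ 2) := by gcongr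
    _ = 4 * 9 ^ j * (C * θ ^ j * K) ^ 2 := by ring
    _ ≤ 4 * (16 * t ^ 4 * θ ^ 2 * (64 * ((1 - p) / p) ^ 2)) ^ j * X2 ^ 2 := by gcongr
    _ = _ := by
      rw [mul_pow _ (64 * ((1 - p) / p) ^ 2)]
      ring

theorem slice_hypercontractive {d : ℕ} {c : Finset α → ℝ} (hc : ∀ S, d < #S → c S = 0) {k : ℕ}
    {p : ℝ} (hk : (k : ℝ) = p * Fintype.card α) (hp : 0 < p) (hp' : p ≤ 1 / 2)
    (hd : 16 * (d : ℝ) ≤ p * Fintype.card α) (hn : 64 ≤ Fintype.card α) :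
    ((Fintype.card α).choose k : ℕ) * ∑ x ∈ powersetCard k univ, mlEval c x ^ 4 ≤
      4 * (d + 1) ^ 3 * (64 * ((1 - p) / p) ^ 2) ^ d *
        (∑ x ∈ powersetCard k univ, mlEval c x ^ 2) ^ 2 := by
  obtain ⟨h, hh, he⟩ := exists_harmonic_decomposition k (d + 1) c fun S hS => hc S (by omega)
  have hx : ∀ x ∈ powersetCard k (univ : Finset α),
      mlEval c x = ∑ j ∈ range (d + 1), mlEval (h j) x :=
    fun x hx => he x (mem_powersetCard.1 hx).2
  set P := powersetCard k (univ : Finset α) with hP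
  set ρ := 64 * ((1 - p) / p) ^ 2 with hρ
  have hρ1 : 1 ≤ ρ := by
    have : 1 ≤ (1 - p) / p := by
      rw [le_div_iff₀ hp]
      linarith
    nlinarith
  have hkd : 16 * d ≤ k ∧ 2 * k ≤ Fintype.card α := by
    constructor
    · rw [← hk] at hd
      exact_mod_cast hd
    · have : (2 * k : ℝ) ≤ Fintype.card α := by
        rw [hk]
        have : (0 : ℝ) ≤ Fintype.card α := by positivity
        nlinarith
      exact_mod_cast this
  have h2 : ∑ x ∈ P, mlEval c x ^ 2 = ∑ j ∈ range (d + 1), ∑ x ∈ P, mlEval (h j) x ^ 2 := by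
    rw [sum_congr rfl fun x hx' => by rw [hx x hx', pow_two, sum_mul_sum], sum_comm]
    refine sum_congr rfl fun i hi => ?_
    rw [mem_range] at hi
    rw [sum_comm, sum_eq_single_of_mem i (mem_range.2 hi)]
    · simp_rw [pow_two]
    · intro l hl hli
      rw [mem_range] at hl
      rcases hli.lt_or_gt with hlt | hgt
      · exact (hh i).sum_mul_mlEval_eq_zero (hh l) hlt (by omega) (by omega)
      · simp_rw [mul_comm (mlEval (h i) _)]
        exact (hh l).sum_mul_mlEval_eq_zero (hh i) hgt (by omega) (by omega)
  have h4 : ∑ x ∈ P, mlEval c x ^ 4 ≤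
      (d + 1) ^ 3 * ∑ j ∈ range (d + 1), ∑ x ∈ P, mlEval (h j) x ^ 4 := by
    rw [sum_comm, mul_sum]
    refine sum_le_sum fun x hx' => ?_
    have := pow_four_sum_le (range (d + 1)) fun j => mlEval (h j) x
    rw [hx x hx']
    simpa using this
  have hj : ∀ j ∈ range (d + 1), ((Fintype.card α).choose k : ℕ) * ∑ x ∈ P, mlEval (h j) x ^ 4 ≤
      4 * ρ ^ d * (∑ x ∈ P, mlEval (h j) x ^ 2) ^ 2 := by
    intro j hj
    have hjd : j ≤ d := by
      rw [mem_range] at hj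
      omega
    have hjd' : (j : ℝ) ≤ d := by exact_mod_cast hjd
    refine ((hh j).hypercontractive hk hp hp' (by linarith) hn).trans ?_
    gcongr
  have hsq : ∑ j ∈ range (d + 1), (∑ x ∈ P, mlEval (h j) x ^ 2) ^ 2 ≤
      (∑ j ∈ range (d + 1), ∑ x ∈ P, mlEval (h j) x ^ 2) ^ 2 := by
    have hnn : ∀ j, 0 ≤ ∑ x ∈ P, mlEval (h j) x ^ 2 := fun j => sum_nonneg fun _ _ => by positivity
    rw [pow_two (∑ j ∈ range (d + 1), _), sum_mul]
    refine sum_le_sum fun j hj => ?_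
    rw [pow_two]
    exact mul_le_mul_of_nonneg_left
      (single_le_sum (f := fun j => ∑ x ∈ P, mlEval (h j) x ^ 2) (fun i _ => hnn i) hj) (hnn j)
  calc _ ≤ (((Fintype.card α).choose k : ℕ) : ℝ) *
        ((d + 1) ^ 3 * ∑ j ∈ range (d + 1), ∑ x ∈ P, mlEval (h j) x ^ 4) := by gcongr
    _ = (d + 1) ^ 3 * ∑ j ∈ range (d + 1),
        ((Fintype.card α).choose k : ℕ) * ∑ x ∈ P, mlEval (h j) x ^ 4 := by
      rw [← mul_sum]
      ring
    _ ≤ (d + 1) ^ 3 * ∑ j ∈ range (d + 1), 4 * ρ ^ d * (∑ x ∈ P, mlEval (h j) x ^ 2) ^ 2 := by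
      exact mul_le_mul_of_nonneg_left (sum_le_sum hj) (by positivity)
    _ = 4 * (d + 1) ^ 3 * ρ ^ d *
        ∑ j ∈ range (d + 1), (∑ x ∈ P, mlEval (h j) x ^ 2) ^ 2 := by
      rw [← mul_sum]
      ring
    _ ≤ _ := by
      rw [h2]
      gcongr

end

theorem intSum_eq {n : ℕ} (σ : Fin n → Bool) : intSum σ = n - 2 * #{i | σ i = false} := by
  have h : ∀ i, (if σ i then (1 : ℤ) else -1) = 1 - 2 * if σ i = false then 1 else 0 := by
    intro i
    cases σ i <;> simp
  simp only [intSum, h, sum_sub_distrib, ← mul_sum, sum_boole]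
  simp

theorem card_filter_true_add_false {n : ℕ} (σ : Fin n → Bool) :
    #{i | σ i = true} + #{i | σ i = false} = n := by
  simpa using card_filter_add_card_filter_not (s := (univ : Finset (Fin n))) (fun i => σ i = true)

/-- The level set at `e` identifies `cardSet n k` with the subsets of a fixed size. -/
theorem sum_cardSet {n k l : ℕ} (e : Bool) (hl : l = if e then n - k else k) (hk : k ≤ n)
    (F : Finset (Fin n) → ℝ) :
    ∑ σ ∈ cardSet n k, F {i | σ i = e} = ∑ y ∈ powersetCard l univ, F y := by
  refine sum_bij' (fun σ _ => ({i | σ i = e} : Finset (Fin n)))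
    (fun y _ i => if i ∈ y then e else !e) ?_ ?_ ?_ ?_ fun _ _ => rfl
  · intro σ hσ
    have h1 := card_filter_true_add_false σ
    rw [cardSet, mem_filter, intSum_eq] at hσ
    rw [mem_powersetCard, hl]
    refine ⟨subset_univ _, ?_⟩
    cases e <;> simp <;> simp at hσ h1 <;> omega
  · intro y hy
    rw [mem_powersetCard] at hy
    rw [cardSet, mem_filter, intSum_eq]
    refine ⟨mem_univ _, ?_⟩
    have h1 := card_filter_true_add_false fun i => if i ∈ y then e else !e
    cases e <;> simp at hl h1 ⊢ <;> omega
  · intro σ _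
    funext i
    cases e <;> cases h : σ i <;> simp [h]
  · intro y _
    ext i
    cases e <;> simp

theorem exists_evalML_eq_mlEval {n d : ℕ} (e : Bool) (c : Finset (Fin n) → ℝ)
    (hc : ∀ S, d < #S → c S = 0) : ∃ c' : Finset (Fin n) → ℝ, (∀ S, d < #S → c' S = 0) ∧
      ∀ σ : Fin n → Bool, evalML c (signs σ) = mlEval c' {i | σ i = e} := by
  set a : ℝ := if e then -1 else 1 with ha
  refine ⟨fun A => ∑ S with A ⊆ S, c S * (a ^ #S * (-2) ^ #A), fun A hA => ?_, fun σ => ?_⟩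
  · refine sum_eq_zero fun S hS => ?_
    rw [hc S (hA.trans_le (card_le_card (mem_filter.1 hS).2)), zero_mul]
  · have hs : ∀ i, signs σ i = a * (1 + if σ i = e then -2 else 0) := by
      intro i
      cases e <;> cases h : σ i <;> simp [signs, ha, h] <;> norm_num
    have hp : ∀ S : Finset (Fin n), ∏ i ∈ S, signs σ i =
        ∑ A ∈ S.powerset, if A ⊆ ({i | σ i = e} : Finset (Fin n)) then
          a ^ #S * (-2) ^ #A else 0 := by
      intro S
      simp_rw [hs]
      rw [prod_mul_distrib, prod_const, prod_one_add, mul_sum]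
      refine sum_congr rfl fun A _ => ?_
      split_ifs with h
      · rw [prod_congr rfl fun i hi => if_pos (mem_filter.1 (h hi)).2, prod_const]
      · obtain ⟨i, hi, hi'⟩ := not_subset.1 h
        rw [prod_eq_zero hi (if_neg (by simpa using hi')), mul_zero]
    simp only [evalML, mlEval, hp, mul_sum]
    have : ∀ S : Finset (Fin n), ∑ A ∈ S.powerset,
        c S * (if A ⊆ ({i | σ i = e} : Finset (Fin n)) then a ^ #S * (-2) ^ #A else 0) =
        ∑ A ∈ ({i | σ i = e} : Finset (Fin n)).powerset,
          if A ⊆ S then c S * (a ^ #S * (-2) ^ #A) else 0 := by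
      intro S
      simp_rw [mul_ite, mul_zero]
      rw [← sum_filter, ← sum_filter]
      refine sum_congr ?_ fun _ _ => rfl
      ext A
      simp only [mem_filter, mem_powerset, and_comm]
    rw [sum_congr rfl fun S _ => this S, sum_comm]
    refine sum_congr rfl fun A _ => ?_
    rw [sum_filter]

/-- The slice inequality on `cardSet n k`, where `q` is the density of the level set at `e`. -/
theorem expOver_pow_four_le {n d k : ℕ} (e : Bool) {q : ℝ} (hq0 : 0 < q) (hq : q ≤ 1 / 2)
    (hk : k ≤ n) (hkq : ((if e then n - k else k : ℕ) : ℝ) = q * n)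
    (hd : 16 * (d : ℝ) ≤ q * n) (hn : 64 ≤ n) (c : Finset (Fin n) → ℝ)
    (hc : ∀ S, d < #S → c S = 0) :
    expOver (cardSet n k) (fun σ => evalML c (signs σ) ^ 4) ≤
      4 * (d + 1) ^ 3 * (64 * ((1 - q) / q) ^ 2) ^ d *
        expOver (cardSet n k) (fun σ => evalML c (signs σ) ^ 2) ^ 2 := by
  obtain ⟨c', hc', he⟩ := exists_evalML_eq_mlEval e c hc
  set l : ℕ := if e then n - k else k with hl
  have hcard : (#(cardSet n k) : ℝ) = (n.choose l : ℕ) := by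
    have := sum_cardSet (n := n) e hl hk (fun _ => 1)
    simpa using this
  have hpos : (0 : ℝ) < (n.choose l : ℕ) := by
    rw [Nat.cast_pos]
    refine Nat.choose_pos ?_
    rw [hl]
    split_ifs <;> omega
  have key := slice_hypercontractive hc' (k := l) (p := q) (by simpa using hkq) hq0 hq
    (by simpa using hd) (by simpa using hn)
  rw [Fintype.card_fin] at key
  simp only [expOver, he, hcard]
  rw [sum_cardSet e hl hk (fun y => mlEval c' y ^ 4), sum_cardSet e hl hk (fun y => mlEval c' y ^ 2)]
  generalize (64 * ((1 - q) / q) ^ 2) ^ d = R at key ⊢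
  rw [div_pow, mul_div_assoc', div_le_div_iff₀ hpos (by positivity)]
  nlinarith [mul_le_mul_of_nonneg_left key hpos.le]

theorem four_mul_le_twelve_mul {d : ℕ} (hd : 1 ≤ d) {q : ℝ} (hq0 : 0 < q) (hq : q < 1) :
    4 * ((d : ℝ) + 1) ^ 3 * (64 * ((1 - q) / q) ^ 2) ^ d ≤
      12 * (d : ℝ) ^ ((3 : ℝ) / 2) *
        (256 * (((1 - q) / q) ^ 2 + (q / (1 - q)) ^ 2) ^ 2) ^ d := by
  have hd1 : (1 : ℝ) ≤ d := by exact_mod_cast hd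
  have h1 : (1 : ℝ) ≤ (d : ℝ) ^ ((3 : ℝ) / 2) := Real.one_le_rpow hd1 (by norm_num)
  have h2 : ((d : ℝ) + 1) ^ 3 ≤ 8 ^ d := by
    have : (d : ℝ) + 1 ≤ 2 ^ d := by exact_mod_cast Nat.lt_two_pow_self (n := d)
    calc ((d : ℝ) + 1) ^ 3 ≤ (2 ^ d) ^ 3 := by gcongr
      _ = 8 ^ d := by
        rw [← pow_mul, mul_comm, pow_mul]
        norm_num
  have hq1 : 0 < 1 - q := by linarith
  have hA : 0 < ((1 - q) / q) ^ 2 := by positivity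
  have hAB : ((1 - q) / q) ^ 2 * (q / (1 - q)) ^ 2 = 1 := by
    field_simp
  have h3 : 8 * (64 * ((1 - q) / q) ^ 2) ≤
      256 * (((1 - q) / q) ^ 2 + (q / (1 - q)) ^ 2) ^ 2 := by
    generalize ((1 - q) / q) ^ 2 = A at *
    generalize (q / (1 - q)) ^ 2 = B at *
    nlinarith [sq_nonneg (A - 1), sq_nonneg B]
  calc 4 * ((d : ℝ) + 1) ^ 3 * (64 * ((1 - q) / q) ^ 2) ^ d
      ≤ 4 * 8 ^ d * (64 * ((1 - q) / q) ^ 2) ^ d := by gcongr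
    _ = 4 * (8 * (64 * ((1 - q) / q) ^ 2)) ^ d := by
      rw [mul_pow 8]
      ring
    _ ≤ (12 * (d : ℝ) ^ ((3 : ℝ) / 2)) *
        (256 * (((1 - q) / q) ^ 2 + (q / (1 - q)) ^ 2) ^ 2) ^ d := by
      gcongr
      linarith

theorem stmt5 (d : ℕ) (hd : 1 ≤ d) (p₀ : ℝ) (hp₀ : 0 < p₀) (hp₀' : p₀ ≤ 1 / 2) :
    ∃ n₀ : ℕ, ∀ n : ℕ, n₀ ≤ n →
      ∀ p : ℝ, p₀ ≤ p → p ≤ 1 - p₀ → ∀ k : ℕ, (k : ℝ) = p * n →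
      ∀ c : Finset (Fin n) → ℝ, (∀ S, d < S.card → c S = 0) →
        expOver (cardSet n k) (fun σ => (evalML c (signs σ)) ^ 4) ≤
          12 * (d : ℝ) ^ ((3 : ℝ) / 2) *
            (256 * (((1 - p) / p) ^ 2 + (p / (1 - p)) ^ 2) ^ 2) ^ d *
            (expOver (cardSet n k) (fun σ => (evalML c (signs σ)) ^ 2)) ^ 2 := by
  refine ⟨max 64 ⌈16 * d / p₀⌉₊, fun n hn p hp hp' k hk c hc => ?_⟩
  have hn64 : 64 ≤ n := (le_max_left _ _).trans hn
  have hdn : 16 * (d : ℝ) ≤ p₀ * n := by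
    have h1 : 16 * d / p₀ ≤ n := Nat.ceil_le.1 ((le_max_right _ _).trans hn)
    rw [div_le_iff₀ hp₀] at h1
    linarith
  have hn0 : (0 : ℝ) ≤ n := Nat.cast_nonneg n
  have hkn : k ≤ n := by
    have : (k : ℝ) ≤ n := by nlinarith
    exact_mod_cast this
  rcases le_total p (1 / 2) with h | h
  · refine (expOver_pow_four_le false (by linarith) h hkn (by simpa using hk) (by nlinarith) hn64
      c hc).trans ?_
    exact mul_le_mul_of_nonneg_right
      (four_mul_le_twelve_mul hd (by linarith) (by linarith)) (sq_nonneg _)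
  · refine (expOver_pow_four_le true (q := 1 - p) (by linarith) (by linarith) hkn ?_
      (by nlinarith) hn64 c hc).trans ?_
    · simp only [if_true]
      rw [Nat.cast_sub hkn, hk]
      ring
    · have := four_mul_le_twelve_mul hd (q := 1 - p) (by linarith) (by linarith)
      rw [sub_sub_cancel, add_comm ((p / (1 - p)) ^ 2)] at this
      rw [sub_sub_cancel]
      exact mul_le_mul_of_nonneg_right this (sq_nonneg _)
end

section
/- For every integer d ≥ 1 and every p₀ ∈ (0, 1/2] there exists n₀ depending only on d and p₀ such that the following holds for all n ≥ n₀ and p ∈ [p₀, 1−p₀] with pn an integer (so that both pn ≥ 1 and (1−p)n ≥ 1). Let g be a degree-at-most-d multilinear polynomial in the φ-basis on n variables that does not depend on x₁ (i.e., ĝ(S) = 0 whenever 1 ∈ S). Then |E_{D_p}[g² | x₁ = 1] − E_{D_p}[g² | x₁ = −1]| ≤ (3d^{3/2}/(p(1−p))) · ‖g‖₂²/√n. -/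
open Finset

section SliceCharacters

variable {α : Type*}

/-- Coordinate values and slices for which the coordinates are standardised with bounded error. -/
structure IsNearlyCentered (M u v : ℝ) (A : Finset α) (k : ℕ) : Prop where
  u_pos : 0 < u
  v_pos : 0 < v
  mul_eq : u * v = 1
  u_le : u ≤ M
  v_le : v ≤ M
  card_le : k ≤ #A
  abs_le : |((#A : ℝ) - k) * u - k * v| ≤ M

namespace IsNearlyCentered

variable {M u v : ℝ} {A : Finset α} {k : ℕ}

theorem one_le (h : IsNearlyCentered M u v A k) : 1 ≤ M := by
  have h1 := h.mul_eq
  by_contra! hM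
  have := mul_le_mul h.u_le h.v_le h.v_pos.le (h.u_pos.le.trans h.u_le)
  nlinarith [h.u_pos, h.u_le]

theorem abs_sub_le (h : IsNearlyCentered M u v A k) : |u - v| ≤ M := by
  rw [_root_.abs_le]
  constructor <;> linarith [h.u_pos, h.v_pos, h.u_le, h.v_le]

theorem abs_coeff_le (h : IsNearlyCentered M u v A k) (b : ℕ) :
    |((#A : ℝ) - k) * u - k * v - (u - v) * b| ≤ M + M * b := by
  refine (abs_sub _ _).trans (add_le_add h.abs_le ?_)
  rw [abs_mul, Nat.abs_cast]
  exact mul_le_mul_of_nonneg_right h.abs_sub_le (Nat.cast_nonneg b)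

theorem choose_pos (h : IsNearlyCentered M u v A k) : (0 : ℝ) < (#A).choose k :=
  Nat.cast_pos.2 (Nat.choose_pos h.card_le)

end IsNearlyCentered

variable [DecidableEq α]

/-- The product over `S` of the coordinate values, which are `-v` on `B` and `u` off `B`. -/
noncomputable def sliceChar (u v : ℝ) (B S : Finset α) : ℝ :=
  ∏ i ∈ S, if i ∈ B then -v else u

/-- The polynomial with coefficients `c` in the variables of `A`, evaluated at `B`. -/
noncomputable def slicePoly (u v : ℝ) (A : Finset α) (c : Finset α → ℝ) (B : Finset α) : ℝ :=
  ∑ S ∈ A.powerset, c S * sliceChar u v B S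

/-- `downSum A c R` adds up the coefficients of the sets covering `R` inside `A`. -/
noncomputable def downSum (A : Finset α) (c : Finset α → ℝ) (R : Finset α) : ℝ :=
  ∑ i ∈ A \ R, c (insert i R)

/-- `upSum c S` adds up the coefficients of the sets covered by `S`. -/
noncomputable def upSum (c : Finset α → ℝ) (S : Finset α) : ℝ :=
  ∑ i ∈ S, c (S.erase i)

/-- The sum of a character of degree `m` over the subsets of size `k` of a set of size `N`. -/
noncomputable def sliceMoment (u v : ℝ) : ℕ → ℕ → ℕ → ℝ
  | 0, N, k => N.choose k
  | m + 1, N, 0 => u * sliceMoment u v m (N - 1) 0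
  | m + 1, N, k + 1 => u * sliceMoment u v m (N - 1) (k + 1) - v * sliceMoment u v m (N - 1) k

/-- The correlation of characters of degrees `a` and `s` whose index sets share `m` elements. -/
noncomputable def sliceCorr (u v : ℝ) (N k a s m : ℕ) : ℝ :=
  ∑ r ∈ range (m + 1), m.choose r * ((u - v) ^ r * sliceMoment u v (r + (a + s - 2 * m)) N k)

theorem sum_powerset_sum_erase (A : Finset α) (F : Finset α → α → ℝ) :
    ∑ S ∈ A.powerset, ∑ i ∈ S, F (S.erase i) i = ∑ R ∈ A.powerset, ∑ i ∈ A \ R, F R i := by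
  rw [sum_sigma', sum_sigma']
  refine sum_bij' (fun x _ => ⟨x.1.erase x.2, x.2⟩) (fun x _ => ⟨insert x.2 x.1, x.2⟩) ?_ ?_ ?_ ?_ ?_
  · rintro ⟨S, i⟩ h
    simp only [mem_sigma, mem_powerset, mem_sdiff] at h ⊢
    exact ⟨(erase_subset _ _).trans h.1, h.1 h.2, by simp⟩
  · rintro ⟨S, i⟩ h
    simp only [mem_sigma, mem_powerset, mem_sdiff] at h ⊢
    exact ⟨insert_subset h.2.1 h.1, by simp⟩
  · rintro ⟨S, i⟩ h
    simp only [mem_sigma, mem_powerset] at h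
    simp [insert_erase h.2]
  · rintro ⟨S, i⟩ h
    simp only [mem_sigma, mem_powerset, mem_sdiff] at h
    simp [erase_insert h.2.2]
  · simp

theorem sum_powersetCard_succ_of_mem {A : Finset α} {i : α} (hi : i ∈ A) (k : ℕ)
    (f : Finset α → ℝ) :
    ∑ B ∈ powersetCard (k + 1) A, f B =
      ∑ B ∈ powersetCard (k + 1) (A.erase i), f B +
        ∑ B ∈ powersetCard k (A.erase i), f (insert i B) := by
  have hn : i ∉ A.erase i := by simp
  have hnot : ∀ k, ∀ B ∈ powersetCard k (A.erase i), i ∉ B := fun k B hB h =>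
    hn ((mem_powersetCard.1 hB).1 h)
  conv_lhs => rw [← insert_erase hi, powersetCard_succ_insert hn]
  rw [sum_union, sum_image]
  · intro B hB C hC h
    rw [← erase_insert (hnot k B hB), h, erase_insert (hnot k C hC)]
  · rw [Finset.disjoint_left]
    intro B hB hB'
    obtain ⟨C, -, rfl⟩ := mem_image.1 hB'
    exact hnot _ _ hB (mem_insert_self _ _)

theorem sliceChar_insert {u v : ℝ} {B S : Finset α} {i : α} (h : i ∉ S) :
    sliceChar u v B (insert i S) = (if i ∈ B then -v else u) * sliceChar u v B S :=
  prod_insert h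

theorem sliceChar_eq_mul_erase {u v : ℝ} {B S : Finset α} {i : α} (h : i ∈ S) :
    sliceChar u v B S = (if i ∈ B then -v else u) * sliceChar u v B (S.erase i) :=
  (mul_prod_erase S _ h).symm

theorem sliceChar_congr {u v : ℝ} {B B' S : Finset α} (h : ∀ i ∈ S, i ∈ B ↔ i ∈ B') :
    sliceChar u v B S = sliceChar u v B' S :=
  prod_congr rfl fun i hi => by simp only [h i hi]

theorem sum_sliceChar (u v : ℝ) (S : Finset α) :
    ∀ (A : Finset α) (k : ℕ), S ⊆ A →
      ∑ B ∈ powersetCard k A, sliceChar u v B S = sliceMoment u v #S #A k := by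
  induction S using Finset.induction_on with
  | empty => intro A k _; simp [sliceChar, sliceMoment]
  | insert i S hi ih =>
    intro A k hA
    have hiA : i ∈ A := hA (mem_insert_self _ _)
    have hS : S ⊆ A.erase i := fun j hj =>
      mem_erase.2 ⟨fun h => hi (h ▸ hj), hA (mem_insert_of_mem hj)⟩
    rw [card_insert_of_notMem hi]
    have key : ∀ k, ∑ B ∈ powersetCard k (A.erase i), sliceChar u v B (insert i S) =
        u * sliceMoment u v #S (#A - 1) k := fun k => by
      rw [← card_erase_of_mem hiA, ← ih _ _ hS, mul_sum]
      refine sum_congr rfl fun B hB => ?_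
      have : i ∉ B := fun h => by simpa using (mem_powersetCard.1 hB).1 h
      rw [sliceChar_insert hi, if_neg this]
    cases k with
    | zero =>
      have := key 0
      simpa [sliceMoment] using this
    | succ k =>
      rw [sum_powersetCard_succ_of_mem hiA, key, sliceMoment, sub_eq_add_neg, ← neg_mul,
        ← card_erase_of_mem hiA, ← ih _ _ hS, ← ih _ _ hS, mul_sum _ _ (-v)]
      congr 1
      refine sum_congr rfl fun B hB => ?_
      rw [sliceChar_insert hi, if_pos (mem_insert_self _ _)]
      congr 1
      refine sliceChar_congr fun j hj => ?_
      have : j ≠ i := fun h => hi (h ▸ hj)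
      simp [this]

theorem sum_sliceChar_insert {u v : ℝ} (huv : u * v = 1) {A B R : Finset α} (hB : B ⊆ A)
    (hR : R ⊆ A) :
    ∑ i ∈ A \ R, sliceChar u v B (insert i R) =
      ((#A - #B) * u - #B * v - (u - v) * #R) * sliceChar u v B R -
        ∑ i ∈ R, sliceChar u v B (R.erase i) := by
  have h1 : ∑ i ∈ A, (if i ∈ B then -v else u) = (#A - #B) * u - #B * v := by
    rw [sum_ite, sum_const, sum_const, filter_mem_eq_inter, inter_eq_right.2 hB,
      filter_notMem_eq_sdiff, card_sdiff_of_subset hB, nsmul_eq_mul, nsmul_eq_mul,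
      Nat.cast_sub (card_le_card hB)]
    ring
  have h2 : ∑ i ∈ R, (if i ∈ B then -v else u) * sliceChar u v B R =
      ∑ i ∈ R, sliceChar u v B (R.erase i) + (u - v) * #R * sliceChar u v B R := by
    have : (u - v) * #R * sliceChar u v B R = ∑ i ∈ R, (u - v) * sliceChar u v B R := by
      rw [sum_const, nsmul_eq_mul]; ring
    rw [this, ← sum_add_distrib]
    refine sum_congr rfl fun i hi => ?_
    rw [sliceChar_eq_mul_erase hi]
    split_ifs
    · linear_combination (sliceChar u v B (R.erase i)) * huv
    · linear_combination (sliceChar u v B (R.erase i)) * huv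
  have h3 : ∑ i ∈ A \ R, sliceChar u v B (insert i R) =
      ∑ i ∈ A \ R, (if i ∈ B then -v else u) * sliceChar u v B R :=
    sum_congr rfl fun i hi => sliceChar_insert (mem_sdiff.1 hi).2
  have h4 := sum_sdiff hR (f := fun i => (if i ∈ B then -v else u) * sliceChar u v B R)
  rw [← sum_mul, ← sum_mul, ← sum_mul, h1] at h4
  rw [← sum_mul] at h2 h3
  rw [h3]
  linarith

theorem slicePoly_upSum {u v : ℝ} (huv : u * v = 1) {A B : Finset α} (hB : B ⊆ A) {b : ℕ}
    {c : Finset α → ℝ} (hc : ∀ S, #S ≠ b → c S = 0) :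
    slicePoly u v A (upSum c) B =
      ((#A - #B) * u - #B * v - (u - v) * b) * slicePoly u v A c B -
        slicePoly u v A (downSum A c) B := by
  have h1 : slicePoly u v A (upSum c) B =
      ∑ R ∈ A.powerset, ∑ i ∈ A \ R, c R * sliceChar u v B (insert i R) := by
    rw [← sum_powerset_sum_erase A fun R i => c R * sliceChar u v B (insert i R)]
    refine sum_congr rfl fun S _ => ?_
    rw [upSum, sum_mul]
    exact sum_congr rfl fun i hi => by rw [insert_erase hi]
  have h2 : slicePoly u v A (downSum A c) B =
      ∑ S ∈ A.powerset, ∑ i ∈ S, c S * sliceChar u v B (S.erase i) := by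
    have := sum_powerset_sum_erase A fun R i => c (insert i R) * sliceChar u v B R
    simp only [slicePoly, downSum, sum_mul]
    rw [← this]
    exact sum_congr rfl fun S _ => sum_congr rfl fun i hi => by rw [insert_erase hi]
  rw [h1, h2, slicePoly, mul_sum, ← sum_sub_distrib]
  refine sum_congr rfl fun R hR => ?_
  rw [← mul_sum, ← mul_sum, sum_sliceChar_insert huv hB (mem_powerset.1 hR)]
  by_cases h : #R = b
  · rw [h]; ring
  · rw [hc R h]; ring

theorem sum_upSum_sq {A : Finset α} {b : ℕ} {c : Finset α → ℝ} (hc : ∀ S, #S ≠ b → c S = 0) :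
    ∑ S ∈ A.powerset, upSum c S ^ 2 =
      (#A - 2 * b) * ∑ S ∈ A.powerset, c S ^ 2 + ∑ S ∈ A.powerset, downSum A c S ^ 2 := by
  have h1 : ∑ S ∈ A.powerset, upSum c S ^ 2 =
      ∑ R ∈ A.powerset, ∑ i ∈ A \ R, c R * upSum c (insert i R) := by
    rw [← sum_powerset_sum_erase A fun R i => c R * upSum c (insert i R)]
    refine sum_congr rfl fun S _ => ?_
    rw [sq, upSum, sum_mul]
    exact sum_congr rfl fun i hi => by rw [insert_erase hi, upSum]
  have h2 : ∑ S ∈ A.powerset, downSum A c S ^ 2 =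
      ∑ S ∈ A.powerset, ∑ i ∈ S, c S * downSum A c (S.erase i) := by
    have := sum_powerset_sum_erase A fun R i => c (insert i R) * downSum A c R
    rw [sum_congr rfl fun S _ => sq (downSum A c S)]
    conv_lhs => simp only [downSum, sum_mul]
    simp only [downSum] at this ⊢
    rw [← this]
    exact sum_congr rfl fun S _ => sum_congr rfl fun i hi => by rw [insert_erase hi]
  rw [h1, h2, mul_sum, ← sum_add_distrib]
  refine sum_congr rfl fun R hR => ?_
  have hRA := mem_powerset.1 hR
  have h3 : ∑ i ∈ A \ R, upSum c (insert i R) =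
      ∑ i ∈ A \ R, c R + ∑ i ∈ A \ R, ∑ j ∈ R, c (insert i (R.erase j)) := by
    rw [← sum_add_distrib]
    refine sum_congr rfl fun i hi => ?_
    have hi := (mem_sdiff.1 hi).2
    rw [upSum, sum_insert hi, erase_insert hi]
    congr 1
    refine sum_congr rfl fun j hj => ?_
    rw [erase_insert_of_ne fun h : i = j => hi (h ▸ hj)]
  have h4 : ∑ j ∈ R, downSum A c (R.erase j) =
      ∑ j ∈ R, c R + ∑ j ∈ R, ∑ i ∈ A \ R, c (insert i (R.erase j)) := by
    rw [← sum_add_distrib]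
    refine sum_congr rfl fun j hj => ?_
    rw [downSum, sdiff_erase (hRA hj), sum_insert (by simp [hj]), insert_erase hj]
  rw [← mul_sum, ← mul_sum, h3, h4, sum_comm (s := R), sum_const, sum_const,
    card_sdiff_of_subset hRA, nsmul_eq_mul, nsmul_eq_mul, Nat.cast_sub (card_le_card hRA)]
  by_cases h : #R = b
  · rw [h]; ring
  · rw [hc R h]; ring

theorem sliceChar_mul {u v : ℝ} (huv : u * v = 1) (B S T : Finset α) :
    sliceChar u v B S * sliceChar u v B T =
      ∑ V ∈ (S ∩ T).powerset, (u - v) ^ #V * sliceChar u v B (V ∪ (S \ T ∪ T \ S)) := by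
  have hsq : ∏ i ∈ S ∩ T, (if i ∈ B then -v else u) * (if i ∈ B then -v else u) =
      ∑ V ∈ (S ∩ T).powerset, (u - v) ^ #V * sliceChar u v B V := by
    have : ∀ i ∈ S ∩ T, (if i ∈ B then -v else u) * (if i ∈ B then -v else u) =
        1 + (u - v) * if i ∈ B then -v else u := fun i _ => by
      split_ifs
      · linear_combination huv
      · linear_combination huv
    rw [prod_congr rfl this, prod_one_add]
    exact sum_congr rfl fun V _ => by rw [prod_mul_distrib, prod_const, sliceChar]
  have hS : sliceChar u v B S = sliceChar u v B (S ∩ T) * sliceChar u v B (S \ T) :=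
    (prod_inter_mul_prod_sdiff S T _).symm
  have hT : sliceChar u v B T = sliceChar u v B (S ∩ T) * sliceChar u v B (T \ S) := by
    rw [inter_comm]; exact (prod_inter_mul_prod_sdiff T S _).symm
  have hd : sliceChar u v B (S \ T ∪ T \ S) = sliceChar u v B (S \ T) * sliceChar u v B (T \ S) :=
    prod_union (disjoint_sdiff_sdiff)
  rw [prod_mul_distrib] at hsq
  rw [hS, hT, mul_mul_mul_comm, ← hd]
  unfold sliceChar at hsq ⊢
  rw [hsq, sum_mul]
  refine sum_congr rfl fun V hV => ?_
  rw [mul_assoc, ← prod_union]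
  rw [Finset.disjoint_left]
  intro i hi
  have := mem_powerset.1 hV hi
  simp only [mem_inter] at this
  simp [this]

theorem sum_sliceChar_mul {u v : ℝ} (huv : u * v = 1) {A S T : Finset α} (hS : S ⊆ A) (hT : T ⊆ A)
    (k : ℕ) :
    ∑ B ∈ powersetCard k A, sliceChar u v B S * sliceChar u v B T =
      sliceCorr u v #A k #S #T #(S ∩ T) := by
  have hcard : #(S \ T ∪ T \ S) = #S + #T - 2 * #(S ∩ T) := by
    rw [card_union_of_disjoint disjoint_sdiff_sdiff]
    have h1 := card_sdiff_add_card_inter S T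
    have h2 := card_sdiff_add_card_inter T S
    rw [inter_comm T S] at h2
    omega
  have h := sum_powerset_apply_card (fun r => (u - v) ^ r *
    sliceMoment u v (r + (#S + #T - 2 * #(S ∩ T))) #A k) (x := S ∩ T)
  simp only [nsmul_eq_mul] at h
  rw [sum_congr rfl fun B _ => sliceChar_mul huv B S T, sum_comm, sliceCorr, ← h]
  refine sum_congr rfl fun V hV => ?_
  have hV' := mem_powerset.1 hV
  rw [← mul_sum, sum_sliceChar, card_union_of_disjoint, hcard]
  · rw [Finset.disjoint_left]
    intro i hi
    have := hV' hi
    simp only [mem_inter] at this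
    simp [this]
  · exact union_subset ((hV'.trans inter_subset_left).trans hS)
      (union_subset (sdiff_subset.trans hS) (sdiff_subset.trans hT))

theorem sum_superset_eq_zero {A : Finset α} {a : ℕ} {c : Finset α → ℝ}
    (hc : ∀ S, #S ≠ a → c S = 0) (hd : ∀ R ∈ A.powerset, downSum A c R = 0) {V : Finset α}
    (hV : #V < a) : ∑ S ∈ A.powerset, (if V ⊆ S then c S else 0) = 0 := by
  have h := sum_powerset_sum_erase A fun R i => if V ⊆ R then c (insert i R) else 0
  have h0 : ∑ R ∈ A.powerset, ∑ i ∈ A \ R, (if V ⊆ R then c (insert i R) else 0) = 0 := by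
    refine sum_eq_zero fun R hR => ?_
    by_cases hVR : V ⊆ R
    · simpa [hVR, downSum] using hd R hR
    · simp [hVR]
  have h1 : ∀ S ∈ A.powerset,
      ∑ i ∈ S, (if V ⊆ S.erase i then c (insert i (S.erase i)) else 0) =
        (a - #V : ℝ) * if V ⊆ S then c S else 0 := by
    intro S _
    have : ∀ i ∈ S, (if V ⊆ S.erase i then c (insert i (S.erase i)) else 0) =
        if i ∈ V then 0 else if V ⊆ S then c S else 0 := by
      intro i hi
      rw [insert_erase hi]
      simp only [subset_erase]
      by_cases i ∈ V <;> simp_all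
    rw [sum_congr rfl this, sum_ite, sum_const_zero, zero_add, sum_const, filter_notMem_eq_sdiff,
      nsmul_eq_mul]
    by_cases hVS : V ⊆ S
    · by_cases hS : #S = a
      · rw [card_sdiff_of_subset hVS, Nat.cast_sub (card_le_card hVS), hS]
      · simp [hc S hS]
    · simp [hVS]
  rw [h0, sum_congr rfl h1, ← mul_sum] at h
  refine (mul_eq_zero.1 h).resolve_left ?_
  have : (#V : ℝ) < a := by exact_mod_cast hV
  linarith

theorem sum_mul_apply_card_inter {A : Finset α} {a : ℕ} {c : Finset α → ℝ}
    (hc : ∀ S, #S ≠ a → c S = 0) (hd : ∀ R ∈ A.powerset, downSum A c R = 0) (e : ℕ → ℝ)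
    {T : Finset α} (hT : T ⊆ A) (hTa : #T ≤ a) :
    ∑ S ∈ A.powerset, c S * e #(S ∩ T) = (fwdDiff 1)^[a] e 0 * c T := by
  have newton : ∀ S : Finset α, e #(S ∩ T) =
      ∑ V ∈ T.powerset, if V ⊆ S then (fwdDiff 1)^[#V] e 0 else 0 := by
    intro S
    have h := shift_eq_sum_fwdDiff_iter 1 e #(S ∩ T) 0
    rw [← sum_powerset_apply_card (fun r => (fwdDiff 1)^[r] e 0)] at h
    simp only [smul_eq_mul, mul_one, zero_add] at h
    rw [h, ← sum_filter]
    refine sum_congr ?_ fun _ _ => rfl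
    ext V
    simp only [mem_powerset, mem_filter, subset_inter_iff]
    exact and_comm
  have h : ∀ V ∈ T.powerset,
      ∑ S ∈ A.powerset, c S * (if V ⊆ S then (fwdDiff 1)^[#V] e 0 else 0) =
        if V = T then (fwdDiff 1)^[a] e 0 * c T else 0 := by
    intro V hV
    have hVT := mem_powerset.1 hV
    have : ∀ S ∈ A.powerset, c S * (if V ⊆ S then (fwdDiff 1)^[#V] e 0 else 0) =
        (fwdDiff 1)^[#V] e 0 * (if V ⊆ S then c S else 0) := fun S _ => by
      split_ifs <;> ring
    rw [sum_congr rfl this, ← mul_sum]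
    rcases lt_or_eq_of_le ((card_le_card hVT).trans hTa) with hlt | heq
    · rw [sum_superset_eq_zero hc hd hlt, mul_zero]
      split_ifs with hVT'
      · rw [hc T (by subst hVT'; exact hlt.ne), mul_zero]
      · rfl
    · have hVT' : V = T := eq_of_subset_of_card_le hVT (heq ▸ hTa)
      subst hVT'
      rw [if_pos rfl, heq]
      congr 1
      rw [sum_eq_single_of_mem V (mem_powerset.2 hT), if_pos Subset.rfl]
      intro S _ hS
      split_ifs with hVS
      · exact hc S fun h => hS (eq_of_subset_of_card_le hVS (by omega)).symm
      · rfl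
  simp only [newton, mul_sum]
  rw [sum_comm, sum_congr rfl h, sum_ite_eq_of_mem' _ _ _ (mem_powerset_self T)]

theorem sum_slicePoly_mul_sliceChar {u v : ℝ} (huv : u * v = 1) {A : Finset α} {a : ℕ}
    {c : Finset α → ℝ} (hc : ∀ S, #S ≠ a → c S = 0) (hd : ∀ R ∈ A.powerset, downSum A c R = 0)
    {T : Finset α} (hT : T ⊆ A) (hTa : #T ≤ a) (k : ℕ) :
    ∑ B ∈ powersetCard k A, slicePoly u v A c B * sliceChar u v B T =
      (fwdDiff 1)^[a] (sliceCorr u v #A k a #T) 0 * c T := by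
  rw [← sum_mul_apply_card_inter hc hd _ hT hTa]
  simp only [slicePoly, sum_mul]
  rw [sum_comm]
  refine sum_congr rfl fun S hS => ?_
  simp only [mul_assoc]
  rw [← mul_sum, sum_sliceChar_mul huv (mem_powerset.1 hS) hT]
  by_cases h : #S = a
  · rw [h]
  · rw [hc S h, zero_mul, zero_mul]

theorem exists_sum_sub_mul_eq_zero {ι V : Type*} [Fintype ι] [AddCommGroup V] [Module ℝ V]
    (T : V →ₗ[ℝ] ι → ℝ) (c : ι → ℝ) : ∃ p, ∀ q, ∑ i, (c i - T p i) * T q i = 0 := by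
  let L : V →ₗ[ℝ] EuclideanSpace ℝ ι := (WithLp.linearEquiv 2 ℝ (ι → ℝ)).symm.toLinearMap ∘ₗ T
  obtain ⟨y, ⟨p, rfl⟩, z, hz, hyz⟩ :=
    (LinearMap.range L).exists_add_mem_mem_orthogonal (WithLp.toLp 2 c)
  refine ⟨p, fun q => ?_⟩
  have h := (Submodule.mem_orthogonal _ _).1 hz (L q) ⟨q, rfl⟩
  have hz' : ∀ i, z i = c i - T p i := fun i => by
    have := congrArg (fun w : EuclideanSpace ℝ ι => w i) hyz
    simp only [PiLp.add_apply] at this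
    have hL : (L p) i = T p i := rfl
    linarith
  rw [PiLp.inner_apply] at h
  rw [← h]
  refine sum_congr rfl fun i _ => ?_
  rw [← hz' i]
  rfl

theorem sum_mul_upSum (A : Finset α) (h p : Finset α → ℝ) :
    ∑ S ∈ A.powerset, h S * upSum p S = ∑ R ∈ A.powerset, downSum A h R * p R := by
  simp only [upSum, downSum, mul_sum, sum_mul]
  rw [← sum_powerset_sum_erase A fun R i => h (insert i R) * p R]
  exact sum_congr rfl fun S _ => sum_congr rfl fun i hi => by rw [insert_erase hi]

theorem upSum_eq_zero {b : ℕ} {p : Finset α → ℝ} (hp : ∀ S, #S ≠ b → p S = 0) {S : Finset α}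
    (hS : #S ≠ b + 1) : upSum p S = 0 := by
  refine sum_eq_zero fun i hi => hp _ ?_
  have := card_pos.2 ⟨i, hi⟩
  rw [card_erase_of_mem hi]
  omega

theorem downSum_eq_zero {b : ℕ} (A : Finset α) {h : Finset α → ℝ} (hh : ∀ S, #S ≠ b + 1 → h S = 0)
    {R : Finset α} (hR : #R ≠ b) : downSum A h R = 0 := by
  refine sum_eq_zero fun i hi => hh _ ?_
  rw [card_insert_of_notMem (mem_sdiff.1 hi).2]
  omega

/-- A homogeneous coefficient function splits into one killed by `downSum` and an `upSum`. -/
theorem exists_harmonic_add_upSum (A : Finset α) {b : ℕ} {c : Finset α → ℝ}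
    (hc : ∀ S, #S ≠ b + 1 → c S = 0) :
    ∃ h p : Finset α → ℝ, (∀ S, #S ≠ b + 1 → h S = 0) ∧ (∀ S, #S ≠ b → p S = 0) ∧
      (∀ R ∈ A.powerset, downSum A h R = 0) ∧ (∀ S, c S = h S + upSum p S) ∧
      ∑ S ∈ A.powerset, c S ^ 2 =
        ∑ S ∈ A.powerset, h S ^ 2 + ∑ S ∈ A.powerset, upSum p S ^ 2 := by
  let trunc : (Finset α → ℝ) → Finset α → ℝ := fun p R => if #R = b then p R else 0
  have htrunc : ∀ p S, #S ≠ b → trunc p S = 0 := fun p S hS => if_neg hS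
  let T : (Finset α → ℝ) →ₗ[ℝ] (A.powerset → ℝ) :=
    { toFun := fun p S => upSum (trunc p) S
      map_add' := fun p q => by
        ext S
        simp only [upSum, trunc, Pi.add_apply, ← sum_add_distrib]
        refine sum_congr rfl fun i _ => ?_
        split_ifs <;> simp
      map_smul' := fun r p => by
        ext S
        simp [upSum, trunc, mul_sum] }
  obtain ⟨p, hp⟩ := exists_sum_sub_mul_eq_zero T fun S => c S
  have horth : ∀ q, ∑ S ∈ A.powerset, (c S - upSum (trunc p) S) * upSum (trunc q) S = 0 :=
    fun q => by
      rw [← hp q, ← sum_coe_sort]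
      rfl
  have hsupp : ∀ S, #S ≠ b + 1 → c S - upSum (trunc p) S = 0 := fun S hS => by
    rw [hc S hS, upSum_eq_zero (htrunc p) hS, sub_zero]
  refine ⟨fun S => c S - upSum (trunc p) S, trunc p, hsupp, htrunc p, ?_, fun S => by ring, ?_⟩
  · intro R hR
    by_cases hRb : #R = b
    · have h := horth fun Q => if Q = R then 1 else 0
      rw [sum_mul_upSum A fun S => c S - upSum (trunc p) S,
        sum_eq_single_of_mem R hR fun Q _ hQ => by simp [trunc, hQ]] at h
      simpa [trunc, hRb] using h
    · exact downSum_eq_zero A hsupp hRb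
  · rw [← add_zero (_ + _), ← mul_zero 2, ← horth p, mul_sum, ← sum_add_distrib,
      ← sum_add_distrib]
    exact sum_congr rfl fun S _ => by ring

theorem sliceMoment_recurrence {u v : ℝ} (huv : u * v = 1) {A V : Finset α} (hV : V ⊆ A) (k : ℕ) :
    ((#A : ℝ) - #V) * sliceMoment u v (#V + 1) #A k =
      ((#A - k) * u - k * v - (u - v) * #V) * sliceMoment u v #V #A k -
        #V * sliceMoment u v (#V - 1) #A k := by
  have h : ∑ B ∈ powersetCard k A, ∑ i ∈ A \ V, sliceChar u v B (insert i V) =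
      ∑ B ∈ powersetCard k A, (((#A - k) * u - k * v - (u - v) * #V) * sliceChar u v B V -
        ∑ i ∈ V, sliceChar u v B (V.erase i)) := by
    refine sum_congr rfl fun B hB => ?_
    obtain ⟨hBA, rfl⟩ := mem_powersetCard.1 hB
    exact sum_sliceChar_insert huv hBA hV
  have h1 : ∀ i ∈ A \ V, ∑ B ∈ powersetCard k A, sliceChar u v B (insert i V) =
      sliceMoment u v (#V + 1) #A k := fun i hi => by
    obtain ⟨hiA, hiV⟩ := mem_sdiff.1 hi
    rw [sum_sliceChar u v _ _ _ (insert_subset hiA hV), card_insert_of_notMem hiV]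
  have h2 : ∀ i ∈ V, ∑ B ∈ powersetCard k A, sliceChar u v B (V.erase i) =
      sliceMoment u v (#V - 1) #A k := fun i hi => by
    rw [sum_sliceChar u v _ _ _ ((erase_subset _ _).trans hV), card_erase_of_mem hi]
  rw [sum_sub_distrib, ← mul_sum, sum_comm, sum_comm (t := V), sum_congr rfl h1, sum_congr rfl h2,
    sum_sliceChar u v V A k hV, sum_const, sum_const, nsmul_eq_mul, nsmul_eq_mul,
    card_sdiff_of_subset hV, Nat.cast_sub (card_le_card hV)] at h
  exact h

namespace IsNearlyCentered

variable {M u v : ℝ} {A : Finset α} {k : ℕ}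

theorem abs_sliceMoment_le (h : IsNearlyCentered M u v A k) {m : ℕ} (hm : m ≤ #A) :
    |sliceMoment u v m #A k| ≤ M ^ m * (#A).choose k := by
  obtain ⟨V, hV, rfl⟩ := exists_subset_card_eq hm
  rw [← sum_sliceChar u v V A k hV, mul_comm, ← nsmul_eq_mul, ← card_powersetCard]
  refine (abs_sum_le_sum_abs _ _).trans (sum_le_card_nsmul _ _ _ fun B _ => ?_)
  rw [sliceChar, abs_prod, ← prod_const]
  refine prod_le_prod (fun _ _ => abs_nonneg _) fun i _ => ?_
  split_ifs
  · rw [abs_neg, abs_of_pos h.v_pos]; exact h.v_le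
  · rw [abs_of_pos h.u_pos]; exact h.u_le

end IsNearlyCentered

theorem exists_abs_sliceMoment_succ_le (m : ℕ) (M : ℝ) {ε : ℝ} (hε : 0 < ε) :
    ∃ n₀ : ℕ, ∀ (α : Type) [DecidableEq α] (u v : ℝ) (A : Finset α) (k : ℕ),
      IsNearlyCentered M u v A k → n₀ ≤ #A →
        |sliceMoment u v (m + 1) #A k| ≤ ε * (#A).choose k := by
  obtain ⟨n₁, hn₁⟩ := exists_nat_ge (((M + M * m) * M ^ m + m * M ^ (m - 1)) / ε)
  refine ⟨m + n₁ + 1, fun α _ u v A k h hA => ?_⟩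
  obtain ⟨V, hV, hVm⟩ := exists_subset_card_eq (show m ≤ #A by omega)
  have hrec := sliceMoment_recurrence h.mul_eq hV k
  rw [hVm] at hrec
  have hM := h.one_le
  have hC := h.choose_pos
  have hA' : (m : ℝ) + n₁ + 1 ≤ #A := by exact_mod_cast hA
  have hpos : (0 : ℝ) < #A - m := by linarith [Nat.cast_nonneg (α := ℝ) n₁]
  have h1 : |((#A : ℝ) - m) * sliceMoment u v (m + 1) #A k| ≤
      ((M + M * m) * M ^ m + m * M ^ (m - 1)) * (#A).choose k := by
    rw [hrec, add_mul]
    refine (abs_sub _ _).trans (add_le_add ?_ ?_)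
    · rw [abs_mul, mul_assoc]
      exact mul_le_mul (h.abs_coeff_le m) (h.abs_sliceMoment_le (by omega)) (abs_nonneg _)
        (by positivity)
    · rw [abs_mul, mul_assoc, Nat.abs_cast]
      exact mul_le_mul_of_nonneg_left (h.abs_sliceMoment_le (by omega)) (Nat.cast_nonneg _)
  rw [abs_mul, abs_of_pos hpos] at h1
  rw [div_le_iff₀ hε] at hn₁
  refine le_of_mul_le_mul_left (h1.trans ?_) hpos
  rw [← mul_assoc]
  refine mul_le_mul_of_nonneg_right (hn₁.trans ?_) hC.le
  exact mul_le_mul_of_nonneg_right (by linarith) hε.le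

theorem exists_abs_sliceMoment_sub_le (J : ℕ) (M : ℝ) {ε : ℝ} (hε : 0 < ε) :
    ∃ n₀ : ℕ, ∀ (α : Type) [DecidableEq α] (u v : ℝ) (A : Finset α) (k : ℕ),
      IsNearlyCentered M u v A k → n₀ ≤ #A → ∀ j ≤ J,
        |sliceMoment u v j #A k - if j = 0 then ((#A).choose k : ℝ) else 0| ≤
          ε * (#A).choose k := by
  choose n₀ hn₀ using fun m => exists_abs_sliceMoment_succ_le m M hε
  refine ⟨∑ j ∈ range (J + 1), n₀ j, fun α _ u v A k h hA j hj => ?_⟩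
  cases j with
  | zero => simpa [sliceMoment] using mul_nonneg hε.le h.choose_pos.le
  | succ j =>
    have : n₀ j ≤ ∑ j ∈ range (J + 1), n₀ j :=
      single_le_sum (fun _ _ => Nat.zero_le _) (mem_range.2 (by omega))
    simpa using hn₀ j α u v A k h (this.trans hA)

theorem exists_abs_fwdDiff_sliceCorr_sub_le (a : ℕ) (M : ℝ) {ε : ℝ} (hε : 0 < ε) :
    ∃ n₀ : ℕ, ∀ (α : Type) [DecidableEq α] (u v : ℝ) (A : Finset α) (k : ℕ),
      IsNearlyCentered M u v A k → n₀ ≤ #A →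
        |(fwdDiff 1)^[a] (sliceCorr u v #A k a a) 0 - (#A).choose k| ≤ ε * (#A).choose k := by
  have hK : 0 < (2 + |M|) ^ a := by positivity
  obtain ⟨n₀, hn₀⟩ := exists_abs_sliceMoment_sub_le (2 * a) M (div_pos hε hK)
  refine ⟨n₀, fun α _ u v A k h hA => ?_⟩
  specialize hn₀ α u v A k h hA
  set η := ε / (2 + |M|) ^ a with hη
  have hM := h.one_le
  have hC := h.choose_pos
  set C : ℝ := ((#A).choose k : ℝ)
  have hcorr : ∀ m ≤ a, |sliceCorr u v #A k a a m - if m = a then C else 0| ≤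
      (1 + M) ^ m * (η * C) := by
    intro m hm
    have h1 : (if m = a then C else 0) = ∑ r ∈ range (m + 1), m.choose r *
        ((u - v) ^ r * if r + (a + a - 2 * m) = 0 then C else 0) := by
      rw [sum_eq_single_of_mem 0 (by simp) fun r _ hr => by simp [hr]]
      have : 0 + (a + a - 2 * m) = 0 ↔ m = a := by omega
      rw [if_congr this rfl rfl]
      simp
    rw [h1, sliceCorr, ← sum_sub_distrib, add_comm 1 M, add_pow, sum_mul]
    refine (abs_sum_le_sum_abs _ _).trans (sum_le_sum fun r hr => ?_)
    have hr := mem_range.1 hr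
    rw [← mul_sub, ← mul_sub, abs_mul, abs_mul, Nat.abs_cast, abs_pow, one_pow, mul_one,
      mul_comm (M ^ r), mul_assoc]
    refine mul_le_mul_of_nonneg_left ?_ (Nat.cast_nonneg _)
    exact mul_le_mul (pow_le_pow_left₀ (abs_nonneg _) h.abs_sub_le r) (hn₀ _ (by omega))
      (abs_nonneg _) (by positivity)
  have h2 : C = ∑ m ∈ range (a + 1),
      (((-1 : ℤ) ^ (a - m) * a.choose m : ℤ) : ℝ) * if m = a then C else 0 := by
    rw [sum_eq_single_of_mem a (by simp) fun r _ hr => by simp [hr]]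
    simp
  have h3 : ε * C = (2 + M) ^ a * (η * C) := by
    rw [hη, abs_of_nonneg (by linarith)]
    field_simp
  rw [fwdDiff_iter_eq_sum_shift, h3]
  nth_rw 1 [h2]
  rw [← sum_sub_distrib, show 2 + M = (1 + M) + 1 by ring, add_pow, sum_mul]
  refine (abs_sum_le_sum_abs _ _).trans (sum_le_sum fun m hm => ?_)
  have hm := mem_range.1 hm
  have habs : |(((-1 : ℤ) ^ (a - m) * a.choose m : ℤ) : ℝ)| = a.choose m := by
    push_cast
    rw [abs_mul, abs_pow, abs_neg, abs_one, one_pow, one_mul, Nat.abs_cast]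
  rw [zsmul_eq_mul, ← mul_sub, abs_mul, habs, one_pow, mul_one, mul_comm (_ ^ m), mul_assoc,
    zero_add, smul_eq_mul, mul_one]
  exact mul_le_mul_of_nonneg_left (hcorr m (by omega)) (Nat.cast_nonneg _)

theorem slicePoly_congr {u v : ℝ} {A B : Finset α} {c c' : Finset α → ℝ}
    (h : ∀ S ∈ A.powerset, c S = c' S) : slicePoly u v A c B = slicePoly u v A c' B :=
  sum_congr rfl fun S hS => by rw [h S hS]

theorem slicePoly_add (u v : ℝ) (A B : Finset α) (c c' : Finset α → ℝ) :
    slicePoly u v A (fun S => c S + c' S) B = slicePoly u v A c B + slicePoly u v A c' B := by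
  simp only [slicePoly, add_mul, sum_add_distrib]

theorem sum_harmonic_sq {u v : ℝ} (huv : u * v = 1) {A : Finset α} {a : ℕ}
    {c : Finset α → ℝ} (hc : ∀ S, #S ≠ a → c S = 0) (hd : ∀ R ∈ A.powerset, downSum A c R = 0)
    (k : ℕ) :
    ∑ B ∈ powersetCard k A, slicePoly u v A c B ^ 2 =
      (fwdDiff 1)^[a] (sliceCorr u v #A k a a) 0 * ∑ S ∈ A.powerset, c S ^ 2 := by
  have h : ∀ B, slicePoly u v A c B ^ 2 =
      ∑ T ∈ A.powerset, c T * (slicePoly u v A c B * sliceChar u v B T) := fun B => by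
    rw [sq]
    nth_rw 2 [slicePoly]
    rw [mul_sum]
    exact sum_congr rfl fun T _ => by ring
  rw [sum_congr rfl fun B _ => h B, sum_comm, mul_sum]
  refine sum_congr rfl fun T hT => ?_
  rw [← mul_sum]
  by_cases hTa : #T = a
  · rw [sum_slicePoly_mul_sliceChar huv hc hd (mem_powerset.1 hT) hTa.le, hTa]
    ring
  · rw [hc T hTa]; ring

theorem sum_harmonic_mul_eq_zero {u v : ℝ} (huv : u * v = 1) {A : Finset α} {a : ℕ}
    {c q : Finset α → ℝ} (hc : ∀ S, #S ≠ a → c S = 0) (hd : ∀ R ∈ A.powerset, downSum A c R = 0)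
    (hq : ∀ S, a ≤ #S → q S = 0) (k : ℕ) :
    ∑ B ∈ powersetCard k A, slicePoly u v A c B * slicePoly u v A q B = 0 := by
  have h : ∀ B, slicePoly u v A c B * slicePoly u v A q B =
      ∑ T ∈ A.powerset, q T * (slicePoly u v A c B * sliceChar u v B T) := fun B => by
    nth_rw 2 [slicePoly]
    rw [mul_sum]
    exact sum_congr rfl fun T _ => by ring
  rw [sum_congr rfl fun B _ => h B, sum_comm]
  refine sum_eq_zero fun T hT => ?_
  rw [← mul_sum]
  by_cases hTa : a ≤ #T
  · rw [hq T hTa, zero_mul]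
  · rw [sum_slicePoly_mul_sliceChar huv hc hd (mem_powerset.1 hT) (not_le.1 hTa).le,
      hc T (not_le.1 hTa).ne, mul_zero, mul_zero]

/-- Homogeneous polynomials of degree `a` have mean square on a nearly centered slice at most
`1 + ε` times the sum of their squared coefficients, once the dimension is large. -/
theorem exists_sum_homogeneous_sq_le (M : ℝ) (a : ℕ) : ∀ {ε : ℝ}, 0 < ε →
    ∃ n₀ : ℕ, ∀ (α : Type) [DecidableEq α] (u v : ℝ) (A : Finset α) (k : ℕ),
      IsNearlyCentered M u v A k → n₀ ≤ #A → ∀ c : Finset α → ℝ, (∀ S, #S ≠ a → c S = 0) →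
        ∑ B ∈ powersetCard k A, slicePoly u v A c B ^ 2 ≤
          (1 + ε) * ((#A).choose k * ∑ S ∈ A.powerset, c S ^ 2) := by
  induction a using Nat.strong_induction_on with
  | _ a ih =>
  intro ε hε
  cases a with
  | zero =>
    refine ⟨0, fun α _ u v A k h _ c hc => ?_⟩
    have hc' : ∀ S ∈ A.powerset, S ≠ ∅ → c S = 0 := fun S _ hS => hc S (by simpa using hS)
    have h1 : ∀ B, slicePoly u v A c B = c ∅ := fun B => by
      rw [slicePoly, sum_eq_single_of_mem ∅ (by simp) fun S hS hS' => by rw [hc' S hS hS', zero_mul]]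
      simp [sliceChar]
    rw [sum_congr rfl fun B _ => by rw [h1 B], sum_const, card_powersetCard, nsmul_eq_mul,
      sum_eq_single_of_mem ∅ (by simp) fun S hS hS' => by rw [hc' S hS hS']; norm_num]
    have : 0 ≤ ((#A).choose k : ℝ) * c ∅ ^ 2 := by positivity
    nlinarith
  | succ b =>
    obtain ⟨η, hη, hη1, hηε⟩ : ∃ η : ℝ, 0 < η ∧ η ≤ 1 ∧ (1 + η) * (1 + η) ≤ 1 + ε := by
      refine ⟨min ε 1 / 3, by positivity, by linarith [min_le_right ε 1], ?_⟩
      have h1 := min_le_left ε 1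
      have h2 := min_le_right ε 1
      have h3 : 0 < min ε 1 := by positivity
      nlinarith
    obtain ⟨n₁, hn₁⟩ := exists_abs_fwdDiff_sliceCorr_sub_le (b + 1) M hε
    obtain ⟨n₂, hn₂⟩ := ih b (by omega) hη
    obtain ⟨n₃, hn₃⟩ : ∃ n₀ : ℕ, ∀ (α : Type) [DecidableEq α] (u v : ℝ) (A : Finset α) (k : ℕ),
        IsNearlyCentered M u v A k → n₀ ≤ #A → ∀ p : Finset α → ℝ, (∀ S, #S ≠ b → p S = 0) →
          ∑ B ∈ powersetCard k A, slicePoly u v A (downSum A p) B ^ 2 ≤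
            (1 + η) * ((#A).choose k * ∑ S ∈ A.powerset, downSum A p S ^ 2) := by
      cases b with
      | zero =>
        refine ⟨0, fun α _ u v A k _ _ p hp => ?_⟩
        have h0 : ∀ R, downSum A p R = 0 := fun R => sum_eq_zero fun i hi => hp _ (by simp)
        simp [slicePoly, h0]
      | succ b =>
        obtain ⟨n₀, hn₀⟩ := ih b (by omega) hη
        exact ⟨n₀, fun α _ u v A k h hA p hp =>
          hn₀ α u v A k h hA _ fun S hS => downSum_eq_zero A hp hS⟩
    obtain ⟨n₄, hn₄⟩ := exists_nat_ge (2 * b + (1 + 1 / η) * (M + M * b) ^ 2)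
    refine ⟨n₁ + n₂ + n₃ + n₄, fun α _ u v A k hA hN c hc => ?_⟩
    obtain ⟨h, p, hh, hp, hdh, hcd, hnorm⟩ := exists_harmonic_add_upSum A hc
    have hC := hA.choose_pos
    specialize hn₁ α u v A k hA (by omega)
    specialize hn₂ α u v A k hA (by omega) p hp
    specialize hn₃ α u v A k hA (by omega) p hp
    have hN4 : (n₄ : ℝ) ≤ #A := by exact_mod_cast (show n₄ ≤ #A by omega)
    set C : ℝ := ((#A).choose k : ℝ)
    set lam : ℝ := ((#A : ℝ) - k) * u - k * v - (u - v) * b with hlam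
    have hlam2 : lam ^ 2 ≤ (M + M * b) ^ 2 := by
      rw [← sq_abs]
      exact pow_le_pow_left₀ (abs_nonneg _) (hA.abs_coeff_le b) 2
    let q : Finset α → ℝ := fun S => lam * p S + -downSum A p S
    have hq : ∀ S, b + 1 ≤ #S → q S = 0 := fun S hS => by
      have h1 : downSum A p S = 0 := sum_eq_zero fun i hi => hp _ (by
        rw [card_insert_of_notMem (mem_sdiff.1 hi).2]; omega)
      simp [q, h1, hp S (by omega)]
    have hqB : ∀ B, slicePoly u v A q B =
        lam * slicePoly u v A p B - slicePoly u v A (downSum A p) B := fun B => by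
      simp only [slicePoly, q, mul_sum]
      rw [← sum_sub_distrib]
      exact sum_congr rfl fun S _ => by ring
    have hsplit : ∀ B ∈ powersetCard k A, slicePoly u v A c B ^ 2 = slicePoly u v A h B ^ 2 +
        2 * (slicePoly u v A h B * slicePoly u v A q B) + slicePoly u v A q B ^ 2 := by
      intro B hB
      obtain ⟨hBA, hBk⟩ := mem_powersetCard.1 hB
      have h1 := slicePoly_upSum hA.mul_eq hBA hp
      rw [hBk, ← hqB] at h1
      rw [slicePoly_congr fun S _ => hcd S, slicePoly_add, h1]
      ring
    have hqsq : ∀ B, slicePoly u v A q B ^ 2 ≤ (1 + η) * slicePoly u v A (downSum A p) B ^ 2 +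
        (1 + 1 / η) * lam ^ 2 * slicePoly u v A p B ^ 2 := fun B => by
      rw [hqB]
      set x := slicePoly u v A (downSum A p) B
      set y := lam * slicePoly u v A p B
      have h1 : (1 + η) * x ^ 2 + (1 + 1 / η) * y ^ 2 - (y - x) ^ 2 = (η * x + y) ^ 2 / η := by
        field_simp
        ring
      have h2 : 0 ≤ (η * x + y) ^ 2 / η := by positivity
      have h3 : (1 + 1 / η) * lam ^ 2 * slicePoly u v A p B ^ 2 = (1 + 1 / η) * y ^ 2 := by
        simp only [y]; ring
      linarith
    rw [sum_congr rfl hsplit, sum_add_distrib, sum_add_distrib, ← mul_sum,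
      sum_harmonic_mul_eq_zero hA.mul_eq hh hdh hq, mul_zero, add_zero, hnorm, mul_add, mul_add]
    have hsumq := sum_le_sum fun B (_ : B ∈ powersetCard k A) => hqsq B
    rw [sum_add_distrib, ← mul_sum, ← mul_sum] at hsumq
    refine add_le_add ?_ (hsumq.trans ?_)
    · rw [sum_harmonic_sq hA.mul_eq hh hdh, ← mul_assoc]
      refine mul_le_mul_of_nonneg_right ?_ (sum_nonneg fun _ _ => sq_nonneg _)
      have := (abs_le.1 hn₁).2
      linarith
    · rw [sum_upSum_sq hp]
      have hP : 0 ≤ ∑ S ∈ A.powerset, p S ^ 2 := sum_nonneg fun _ _ => sq_nonneg _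
      have hD : 0 ≤ ∑ S ∈ A.powerset, downSum A p S ^ 2 := sum_nonneg fun _ _ => sq_nonneg _
      set P := ∑ S ∈ A.powerset, p S ^ 2
      set D := ∑ S ∈ A.powerset, downSum A p S ^ 2
      have h1 : (1 + 1 / η) * lam ^ 2 ≤ #A - 2 * b := by
        have := mul_le_mul_of_nonneg_left hlam2 (show 0 ≤ 1 + 1 / η by positivity)
        linarith
      have h0 : 0 ≤ (1 + 1 / η) * lam ^ 2 := by positivity
      have h2 := mul_le_mul_of_nonneg_left hn₃ (show 0 ≤ 1 + η by linarith)
      have h3 := mul_le_mul h1 hn₂ (sum_nonneg fun _ _ => sq_nonneg _) (h0.trans h1)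
      have h4 : (1 + η) * ((1 + η) * (C * D)) ≤ (1 + ε) * (C * D) := by
        rw [← mul_assoc]
        exact mul_le_mul_of_nonneg_right hηε (by positivity)
      have h5 : (#A - 2 * b) * ((1 + η) * (C * P)) ≤ (1 + ε) * (C * ((#A - 2 * b) * P)) := by
        have h6 : (0 : ℝ) ≤ C * ((#A - 2 * b) * P) :=
          mul_nonneg hC.le (mul_nonneg (h0.trans h1) hP)
        have h7 : 1 + η ≤ 1 + ε := le_trans (by nlinarith) hηε
        calc _ = (1 + η) * (C * ((#A - 2 * b) * P)) := by ring
          _ ≤ _ := mul_le_mul_of_nonneg_right h7 h6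
      calc _ ≤ _ := add_le_add (h2.trans h4) (h3.trans h5)
        _ = _ := by ring

theorem exists_sum_slicePoly_sq_le (M : ℝ) (d : ℕ) {ε : ℝ} (hε : 0 < ε) :
    ∃ n₀ : ℕ, ∀ (α : Type) [DecidableEq α] (u v : ℝ) (A : Finset α) (k : ℕ),
      IsNearlyCentered M u v A k → n₀ ≤ #A → ∀ c : Finset α → ℝ, (∀ S, d < #S → c S = 0) →
        ∑ B ∈ powersetCard k A, slicePoly u v A c B ^ 2 ≤
          (d + 1) * (1 + ε) * ((#A).choose k * ∑ S ∈ A.powerset, c S ^ 2) := by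
  choose n₀ hn₀ using fun a => exists_sum_homogeneous_sq_le M a hε
  refine ⟨∑ a ∈ range (d + 1), n₀ a, fun α _ u v A k h hA c hc => ?_⟩
  let part : ℕ → Finset α → ℝ := fun a S => if #S = a then c S else 0
  have hpart : ∀ S, ∑ a ∈ range (d + 1), part a S = c S := fun S => by
    simp only [part, sum_ite_eq, mem_range]
    split_ifs with hS
    · rfl
    · exact (hc S (by omega)).symm
  have hpart2 : ∀ S, ∑ a ∈ range (d + 1), part a S ^ 2 = c S ^ 2 := fun S => by
    simp only [part, ite_pow, zero_pow two_ne_zero, sum_ite_eq, mem_range]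
    split_ifs with hS
    · rfl
    · rw [hc S (by omega)]; norm_num
  have hpoly : ∀ B, slicePoly u v A c B = ∑ a ∈ range (d + 1), slicePoly u v A (part a) B :=
    fun B => by
      simp only [slicePoly]
      rw [sum_comm]
      exact sum_congr rfl fun S _ => by rw [← sum_mul, hpart]
  calc ∑ B ∈ powersetCard k A, slicePoly u v A c B ^ 2
      ≤ ∑ B ∈ powersetCard k A, (d + 1) *
          ∑ a ∈ range (d + 1), slicePoly u v A (part a) B ^ 2 := by
        refine sum_le_sum fun B _ => ?_
        rw [hpoly]
        refine sq_sum_le_card_mul_sum_sq.trans (le_of_eq ?_)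
        rw [card_range]
        push_cast
        rfl
    _ = (d + 1) * ∑ a ∈ range (d + 1), ∑ B ∈ powersetCard k A,
          slicePoly u v A (part a) B ^ 2 := by
        rw [← mul_sum, sum_comm]
    _ ≤ (d + 1) * ∑ a ∈ range (d + 1),
          (1 + ε) * ((#A).choose k * ∑ S ∈ A.powerset, part a S ^ 2) := by
        refine mul_le_mul_of_nonneg_left (sum_le_sum fun a ha => ?_) (by positivity)
        have : n₀ a ≤ ∑ a ∈ range (d + 1), n₀ a :=
          single_le_sum (fun _ _ => Nat.zero_le _) ha
        exact hn₀ a α u v A k h (this.trans hA) _ fun S hS => if_neg hS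
    _ = (d + 1) * (1 + ε) * ((#A).choose k * ∑ S ∈ A.powerset, c S ^ 2) := by
        rw [← mul_sum, ← mul_sum, sum_comm, sum_congr rfl fun S _ => hpart2 S]
        ring

theorem sum_sum_powersetCard_erase_insert (A : Finset α) (k : ℕ) (f : Finset α → ℝ) :
    ∑ i ∈ A, ∑ z ∈ powersetCard k (A.erase i), f (insert i z) =
      (k + 1) * ∑ B ∈ powersetCard (k + 1) A, f B := by
  have h : ∀ i ∈ A, ∑ z ∈ powersetCard k (A.erase i), f (insert i z) =
      ∑ B ∈ powersetCard (k + 1) A, if i ∈ B then f B else 0 := fun i hi => by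
    rw [sum_powersetCard_succ_of_mem hi, sum_eq_zero (s := powersetCard (k + 1) (A.erase i)),
      zero_add]
    · exact sum_congr rfl fun z _ => by rw [if_pos (mem_insert_self i z)]
    · exact fun B hB => if_neg fun hiB => by simpa using (mem_powersetCard.1 hB).1 hiB
  rw [sum_congr rfl h, sum_comm, mul_sum]
  refine sum_congr rfl fun B hB => ?_
  obtain ⟨hBA, hBk⟩ := mem_powersetCard.1 hB
  rw [← sum_filter, filter_mem_eq_inter, inter_eq_right.2 hBA, sum_const, hBk, nsmul_eq_mul]
  push_cast
  rfl

theorem sum_sum_powersetCard_erase (A : Finset α) (k : ℕ) (f : Finset α → ℝ) :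
    ∑ i ∈ A, ∑ z ∈ powersetCard k (A.erase i), f z =
      (#A - k) * ∑ B ∈ powersetCard k A, f B := by
  rw [sum_comm' (t' := powersetCard k A) (s' := fun B => A \ B), mul_sum]
  · refine sum_congr rfl fun B hB => ?_
    obtain ⟨hBA, rfl⟩ := mem_powersetCard.1 hB
    rw [sum_const, card_sdiff_of_subset hBA, nsmul_eq_mul, Nat.cast_sub (card_le_card hBA)]
  · intro i B
    simp only [mem_powersetCard, subset_erase, mem_sdiff]
    tauto

theorem slicePoly_insert_sub {u v : ℝ} {A z : Finset α} {i : α} (hi : i ∈ A) (hz : i ∉ z)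
    (c : Finset α → ℝ) :
    slicePoly u v A c (insert i z) - slicePoly u v A c z =
      -((u + v) * slicePoly u v (A.erase i) (fun S => c (insert i S)) z) := by
  have hn : i ∉ A.erase i := by simp
  have hS : ∀ S ∈ (A.erase i).powerset, i ∉ S := fun S hS h => hn (mem_powerset.1 hS h)
  have hchar : ∀ S ∈ (A.erase i).powerset, sliceChar u v (insert i z) S = sliceChar u v z S :=
    fun S hS' => sliceChar_congr fun j hj => by
      have : j ≠ i := fun h => hS S hS' (h ▸ hj)
      simp [this]
  simp only [slicePoly]
  conv_lhs => rw [← insert_erase hi, sum_powerset_insert hn, sum_powerset_insert hn]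
  rw [mul_sum, ← sum_neg_distrib, sum_congr rfl fun S hS' => by rw [hchar S hS'],
    add_sub_add_left_eq_sub, ← sum_sub_distrib]
  refine sum_congr rfl fun S hS' => ?_
  rw [sliceChar_insert (hS S hS'), sliceChar_insert (hS S hS'), hchar S hS',
    if_pos (mem_insert_self i z), if_neg hz]
  ring

theorem sum_sum_insert_sq_le {A : Finset α} {d : ℕ} {c : Finset α → ℝ}
    (hc : ∀ S, d < #S → c S = 0) :
    ∑ i ∈ A, ∑ S ∈ (A.erase i).powerset, c (insert i S) ^ 2 ≤ d * ∑ S ∈ A.powerset, c S ^ 2 := by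
  rw [sum_comm' (t' := A.powerset) (s' := fun S => A \ S) (by
      intro i S
      simp only [mem_powerset, subset_erase, mem_sdiff]
      tauto),
    ← sum_powerset_sum_erase A fun S i => c (insert i S) ^ 2, mul_sum]
  refine sum_le_sum fun S _ => ?_
  rw [sum_congr rfl fun i hi => by rw [insert_erase hi], sum_const, nsmul_eq_mul]
  by_cases hS : d < #S
  · simp [hc S hS]
  · exact mul_le_mul_of_nonneg_right (Nat.cast_le.2 (not_lt.1 hS)) (sq_nonneg _)

/-- Moving one element into a random subset changes the mean square of a low-degree polynomial by
an amount controlled by its total influence. -/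
theorem sq_sub_mean_sq_le {u v K : ℝ} {A : Finset α} {k d : ℕ} (hk : k < #A) (hK : 0 ≤ K)
    {c : Finset α → ℝ} (hc : ∀ S, d < #S → c S = 0)
    (h₁ : ∑ B ∈ powersetCard (k + 1) A, slicePoly u v A c B ^ 2 ≤
      K * ((#A).choose (k + 1) * ∑ S ∈ A.powerset, c S ^ 2))
    (h₀ : ∑ B ∈ powersetCard k A, slicePoly u v A c B ^ 2 ≤
      K * ((#A).choose k * ∑ S ∈ A.powerset, c S ^ 2))
    (hD : ∀ i ∈ A, ∑ B ∈ powersetCard k (A.erase i),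
        slicePoly u v (A.erase i) (fun S => c (insert i S)) B ^ 2 ≤
      K * ((#(A.erase i)).choose k * ∑ S ∈ (A.erase i).powerset, c (insert i S) ^ 2)) :
    ((∑ B ∈ powersetCard (k + 1) A, slicePoly u v A c B ^ 2) / (#A).choose (k + 1) -
        (∑ B ∈ powersetCard k A, slicePoly u v A c B ^ 2) / (#A).choose k) ^ 2 ≤
      4 * K ^ 2 * (u + v) ^ 2 * d * (∑ S ∈ A.powerset, c S ^ 2) ^ 2 / #A := by
  have hE : 0 ≤ ∑ S ∈ A.powerset, c S ^ 2 := sum_nonneg fun _ _ => sq_nonneg _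
  set g := slicePoly u v A c
  set E := ∑ S ∈ A.powerset, c S ^ 2
  set Q : ℝ := ((#A - 1).choose k : ℝ) with hQdef
  have hN : (0 : ℝ) < #A := Nat.cast_pos.2 (by omega)
  have hQ : 0 < Q := Nat.cast_pos.2 (Nat.choose_pos (by omega))
  have hC₁ : (0 : ℝ) < (#A).choose (k + 1) := Nat.cast_pos.2 (Nat.choose_pos hk)
  have hC₀ : (0 : ℝ) < (#A).choose k := Nat.cast_pos.2 (Nat.choose_pos hk.le)
  have hNk : (0 : ℝ) < #A - k := sub_pos.2 (Nat.cast_lt.2 hk)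
  have hcard : ∑ i ∈ A, ∑ z ∈ powersetCard k (A.erase i), (1 : ℝ) = #A * Q := by
    rw [sum_congr rfl fun i hi => by
      rw [sum_const, card_powersetCard, card_erase_of_mem hi, nsmul_eq_mul, mul_one], sum_const,
      nsmul_eq_mul]
  have hQ₁ := sum_sum_powersetCard_erase_insert A k fun _ => 1
  have hQ₀ := sum_sum_powersetCard_erase A k fun _ => 1
  rw [hcard, sum_const, card_powersetCard, nsmul_eq_mul, mul_one] at hQ₁ hQ₀
  have e₁ := sum_sum_powersetCard_erase_insert A k fun B => g B ^ 2
  have e₀ := sum_sum_powersetCard_erase A k fun B => g B ^ 2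
  set s₁ := ∑ B ∈ powersetCard (k + 1) A, g B ^ 2
  set s₀ := ∑ B ∈ powersetCard k A, g B ^ 2
  set I := A.sigma fun i => powersetCard k (A.erase i)
  have hdiff : s₁ / (#A).choose (k + 1) - s₀ / (#A).choose k =
      (∑ x ∈ I, (g (insert x.1 x.2) - g x.2) * (g (insert x.1 x.2) + g x.2)) / (#A * Q) := by
    have : ∑ x ∈ I, (g (insert x.1 x.2) - g x.2) * (g (insert x.1 x.2) + g x.2) =
        (k + 1) * s₁ - (#A - k) * s₀ := by
      rw [← e₁, ← e₀, sum_sigma', sum_sigma', ← sum_sub_distrib]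
      exact sum_congr rfl fun x _ => by ring
    rw [this, sub_div]
    congr 1
    · rw [hQ₁]; field_simp
    · rw [hQ₀]; field_simp
  have hX : ∑ x ∈ I, (g (insert x.1 x.2) - g x.2) ^ 2 ≤ (u + v) ^ 2 * (K * Q * (d * E)) := by
    rw [sum_sigma]
    calc _ = (u + v) ^ 2 * ∑ i ∈ A, ∑ B ∈ powersetCard k (A.erase i),
          slicePoly u v (A.erase i) (fun S => c (insert i S)) B ^ 2 := by
          rw [mul_sum]
          refine sum_congr rfl fun i hi => ?_
          rw [mul_sum]
          refine sum_congr rfl fun z hz => ?_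
          have hiz : i ∉ z := fun h => by simpa using (mem_powersetCard.1 hz).1 h
          rw [slicePoly_insert_sub hi hiz]
          ring
      _ ≤ (u + v) ^ 2 * ∑ i ∈ A, K * Q * ∑ S ∈ (A.erase i).powerset, c (insert i S) ^ 2 := by
          refine mul_le_mul_of_nonneg_left (sum_le_sum fun i hi => ?_) (sq_nonneg _)
          have := hD i hi
          rwa [card_erase_of_mem hi, ← hQdef, ← mul_assoc] at this
      _ ≤ _ := by
          rw [← mul_sum]
          exact mul_le_mul_of_nonneg_left (mul_le_mul_of_nonneg_left (sum_sum_insert_sq_le hc)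
            (by positivity)) (sq_nonneg _)
  have hY : ∑ x ∈ I, (g (insert x.1 x.2) + g x.2) ^ 2 ≤ 4 * K * (#A * Q) * E := by
    calc _ ≤ ∑ x ∈ I, (2 * g (insert x.1 x.2) ^ 2 + 2 * g x.2 ^ 2) :=
          sum_le_sum fun x _ => by nlinarith [sq_nonneg (g (insert x.1 x.2) - g x.2)]
      _ = 2 * ((k + 1) * s₁) + 2 * ((#A - k) * s₀) := by
          rw [← e₁, ← e₀, sum_sigma', sum_sigma', mul_sum, mul_sum, ← sum_add_distrib]
      _ ≤ 2 * ((k + 1) * (K * ((#A).choose (k + 1) * E))) +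
            2 * ((#A - k) * (K * ((#A).choose k * E))) := by gcongr
      _ = 2 * K * E * ((k + 1) * (#A).choose (k + 1)) +
            2 * K * E * ((#A - k) * (#A).choose k) := by ring
      _ = _ := by rw [← hQ₁, ← hQ₀]; ring
  have hXY := (sum_mul_sq_le_sq_mul_sq I _ _).trans
    (mul_le_mul hX hY (sum_nonneg fun _ _ => sq_nonneg _) (by positivity))
  rw [hdiff, div_pow, div_le_div_iff₀ (by positivity) hN]
  calc _ ≤ _ := mul_le_mul_of_nonneg_right hXY hN.le
    _ = _ := by ring

end SliceCharacters

theorem mem_cardSet {n k : ℕ} {σ : Fin n → Bool} :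
    σ ∈ cardSet n k ↔ #(univ.filter fun i => σ i = false) = k := by
  have h : intSum σ = n - 2 * #(univ.filter fun i => σ i = false) := by
    have : ∀ i, (if σ i then (1 : ℤ) else -1) = 1 - 2 * if σ i = false then 1 else 0 := fun i => by
      cases σ i <;> simp
    rw [intSum, sum_congr rfl fun i _ => this i, sum_sub_distrib, ← mul_sum, sum_boole]
    simp
  rw [cardSet, mem_filter, h]
  simp only [mem_univ, true_and]
  omega

theorem sum_cardSet_true {n : ℕ} (k : ℕ) (i₀ : Fin n) (f : (Fin n → Bool) → ℝ) :
    ∑ σ ∈ (cardSet n k).filter (fun σ => σ i₀ = true), f σ =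
      ∑ B ∈ powersetCard k (univ.erase i₀), f fun i => decide (i ∉ B) := by
  refine sum_bij' (fun σ _ => univ.filter fun i => σ i = false) (fun B _ i => decide (i ∉ B))
    ?_ ?_ ?_ ?_ ?_
  · intro σ hσ
    obtain ⟨h1, h2⟩ := mem_filter.1 hσ
    rw [mem_powersetCard]
    exact ⟨fun i hi => by rw [mem_erase]; exact ⟨by rintro rfl; simp [h2] at hi, mem_univ _⟩,
      mem_cardSet.1 h1⟩
  · intro B hB
    obtain ⟨h1, h2⟩ := mem_powersetCard.1 hB
    rw [mem_filter, mem_cardSet]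
    have : i₀ ∉ B := fun h => by simpa using h1 h
    simp [this, h2]
  · intro σ _
    ext i
    simp
  · intro B _
    simp
  · intro σ _
    congr 1
    ext i
    simp

theorem sum_cardSet_false {n : ℕ} (k : ℕ) (i₀ : Fin n) (f : (Fin n → Bool) → ℝ) :
    ∑ σ ∈ (cardSet n (k + 1)).filter (fun σ => σ i₀ = false), f σ =
      ∑ B ∈ powersetCard k (univ.erase i₀), f fun i => decide (i ∉ insert i₀ B) := by
  have hins : ∀ σ : Fin n → Bool, σ i₀ = false →
      insert i₀ ((univ.filter fun i => σ i = false).erase i₀) =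
        univ.filter fun i => σ i = false := fun σ h => insert_erase (by simp [h])
  refine sum_bij' (fun σ _ => (univ.filter fun i => σ i = false).erase i₀)
    (fun B _ i => decide (i ∉ insert i₀ B)) ?_ ?_ ?_ ?_ ?_
  · intro σ hσ
    obtain ⟨h1, h2⟩ := mem_filter.1 hσ
    rw [mem_powersetCard]
    refine ⟨erase_subset_erase _ (subset_univ _), ?_⟩
    rw [card_erase_of_mem (by simp [h2]), mem_cardSet.1 h1]
    omega
  · intro B hB
    obtain ⟨h1, h2⟩ := mem_powersetCard.1 hB
    have : i₀ ∉ B := fun h => by simpa using h1 h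
    have hf : (univ.filter fun i => decide (i ∉ insert i₀ B) = false) = insert i₀ B := by
      ext i
      simp
      tauto
    rw [mem_filter, mem_cardSet, hf, card_insert_of_notMem this, h2]
    simp
  · intro σ hσ
    funext i
    rw [hins σ (mem_filter.1 hσ).2]
    simp
  · intro B hB
    have : i₀ ∉ B := fun h => by simpa using (mem_powersetCard.1 hB).1 h
    have hf : (univ.filter fun i => decide (i ∉ insert i₀ B) = false) = insert i₀ B := by
      ext i
      simp
      tauto
    rw [hf, erase_insert this]
  · intro σ hσ
    congr 1
    funext i
    rw [hins σ (mem_filter.1 hσ).2]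
    simp

theorem evalPhi_decide_notMem {n : ℕ} (p : ℝ) {i₀ : Fin n} {c : Finset (Fin n) → ℝ}
    (hc : ∀ S, i₀ ∈ S → c S = 0) (B : Finset (Fin n)) :
    evalPhi p c (fun i => decide (i ∉ B)) =
      slicePoly √(p / (1 - p)) √((1 - p) / p) (univ.erase i₀) c B := by
  have h : ∀ S ∈ univ, S ∉ (univ.erase i₀).powerset →
      c S * ∏ i ∈ S, phi p (decide (i ∉ B)) = 0 := fun S _ hS => by
    rw [hc S, zero_mul]
    by_contra hi
    exact hS (mem_powerset.2 (subset_erase.2 ⟨subset_univ _, hi⟩))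
  rw [evalPhi, slicePoly, ← sum_subset (subset_univ _) h]
  refine sum_congr rfl fun S _ => ?_
  congr 1
  refine prod_congr rfl fun i _ => ?_
  by_cases hi : i ∈ B <;> simp [phi, hi]

theorem expOver_true {n : ℕ} (p : ℝ) (k : ℕ) {i₀ : Fin n} {c : Finset (Fin n) → ℝ}
    (hc : ∀ S, i₀ ∈ S → c S = 0) :
    expOver ((cardSet n k).filter fun σ => σ i₀ = true) (fun σ => (evalPhi p c σ) ^ 2) =
      (∑ B ∈ powersetCard k (univ.erase i₀),
        slicePoly √(p / (1 - p)) √((1 - p) / p) (univ.erase i₀) c B ^ 2) /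
          (#(univ.erase i₀)).choose k := by
  have h := sum_cardSet_true k i₀ fun _ => 1
  rw [sum_const, sum_const, card_powersetCard, nsmul_eq_mul, nsmul_eq_mul, mul_one, mul_one] at h
  rw [expOver, h, sum_cardSet_true]
  simp only [evalPhi_decide_notMem p hc]

theorem expOver_false {n : ℕ} (p : ℝ) (k : ℕ) {i₀ : Fin n} {c : Finset (Fin n) → ℝ}
    (hc : ∀ S, i₀ ∈ S → c S = 0) :
    expOver ((cardSet n (k + 1)).filter fun σ => σ i₀ = false) (fun σ => (evalPhi p c σ) ^ 2) =
      (∑ B ∈ powersetCard k (univ.erase i₀),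
        slicePoly √(p / (1 - p)) √((1 - p) / p) (univ.erase i₀) c B ^ 2) /
          (#(univ.erase i₀)).choose k := by
  have h := sum_cardSet_false k i₀ fun _ => 1
  rw [sum_const, sum_const, card_powersetCard, nsmul_eq_mul, nsmul_eq_mul, mul_one, mul_one] at h
  rw [expOver, h, sum_cardSet_false]
  congr 1
  refine sum_congr rfl fun B _ => ?_
  rw [evalPhi_decide_notMem p hc]
  congr 1
  refine sum_congr rfl fun S hS => ?_
  rw [sliceChar_congr fun i hi => ?_]
  have : i ≠ i₀ := ne_of_mem_erase (mem_powerset.1 hS hi)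
  simp [this]

theorem influence_bound_le_sq {d : ℕ} (hd : 1 ≤ d) {n p E : ℝ} (hn : 4 ≤ n) (hp0 : 0 < p)
    (hq0 : 0 < 1 - p) :
    4 * ((d + 1) * (1 + 1 / 4) : ℝ) ^ 2 * (1 / (p * (1 - p))) * d * E ^ 2 / (n - 1) ≤
      (3 * (d : ℝ) ^ ((3 : ℝ) / 2) / (p * (1 - p)) * E / √n) ^ 2 := by
  have hd3 : ((d : ℝ) ^ ((3 : ℝ) / 2)) ^ 2 = (d : ℝ) ^ 3 := by
    rw [← Real.rpow_natCast, ← Real.rpow_mul (Nat.cast_nonneg d), ← Real.rpow_natCast]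
    norm_num
  have hd1 : (1 : ℝ) ≤ d := by exact_mod_cast hd
  have hK : 4 * ((d + 1) * (1 + 1 / 4) : ℝ) ^ 2 ≤ 25 * d ^ 2 := by nlinarith
  have hpq4 : p * (1 - p) ≤ 1 / 4 := by nlinarith [sq_nonneg (p - 1 / 2)]
  have hpq0 : 0 < p * (1 - p) := by positivity
  have hR : (3 * (d : ℝ) ^ ((3 : ℝ) / 2) / (p * (1 - p)) * E / √n) ^ 2 =
      9 * d ^ 3 / (p * (1 - p)) ^ 2 * E ^ 2 / n := by
    rw [div_pow, mul_pow, div_pow, mul_pow, hd3, Real.sq_sqrt (by linarith)]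
    norm_num
  rw [hR]
  set s := p * (1 - p)
  have hn1 : (0 : ℝ) < n - 1 := by linarith
  calc _ ≤ 25 * (d : ℝ) ^ 2 * (1 / s) * d * E ^ 2 / (n - 1) := by gcongr
    _ = 25 * s * n * (d ^ 3 * E ^ 2 / (s ^ 2 * n * (n - 1))) := by field_simp
    _ ≤ 9 * (n - 1) * (d ^ 3 * E ^ 2 / (s ^ 2 * n * (n - 1))) := by
        refine mul_le_mul_of_nonneg_right ?_ (by positivity)
        nlinarith
    _ = _ := by field_simp

theorem stmt6 (d : ℕ) (hd : 1 ≤ d) (p₀ : ℝ) (hp₀ : 0 < p₀) (hp₀' : p₀ ≤ 1 / 2) :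
    ∃ n₀ : ℕ, ∀ n : ℕ, n₀ ≤ n →
      ∀ p : ℝ, p₀ ≤ p → p ≤ 1 - p₀ → ∀ k : ℕ, (k : ℝ) = p * n →
      ∀ i₀ : Fin n, (i₀ : ℕ) = 0 →
      ∀ c : Finset (Fin n) → ℝ, (∀ S, d < S.card → c S = 0) →
        (∀ S, i₀ ∈ S → c S = 0) →
        |expOver ((cardSet n k).filter fun σ => σ i₀ = true)
            (fun σ => (evalPhi p c σ) ^ 2) -
          expOver ((cardSet n k).filter fun σ => σ i₀ = false)
            (fun σ => (evalPhi p c σ) ^ 2)| ≤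
          (3 * (d : ℝ) ^ ((3 : ℝ) / 2) / (p * (1 - p))) *
            (∑ S : Finset (Fin n), c S ^ 2) / Real.sqrt n := by
  obtain ⟨n₁, hn₁⟩ := exists_sum_slicePoly_sq_le (1 / p₀) d (show (0 : ℝ) < 1 / 4 by norm_num)
  refine ⟨n₁ + 4, fun n hn p hp hp' k hk i₀ _ c hc hci => ?_⟩
  have hp0 : 0 < p := hp₀.trans_le hp
  have hq0 : 0 < 1 - p := by linarith
  have hn4 : (4 : ℝ) ≤ n := by exact_mod_cast (show 4 ≤ n by omega)
  have hk0 : 0 < k := by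
    have : (0 : ℝ) < k := by rw [hk]; positivity
    exact_mod_cast this
  have hkn : k < n := by
    have : (k : ℝ) < n := by rw [hk]; nlinarith
    exact_mod_cast this
  obtain ⟨k, rfl⟩ : ∃ j, k = j + 1 := ⟨k - 1, by omega⟩
  rw [expOver_true p _ hci, expOver_false p _ hci]
  set u := √(p / (1 - p)) with hu
  set v := √((1 - p) / p) with hv
  have hu0 : 0 < u := Real.sqrt_pos.2 (by positivity)
  have hv0 : 0 < v := Real.sqrt_pos.2 (by positivity)
  have hu2 : u ^ 2 = p / (1 - p) := Real.sq_sqrt (by positivity)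
  have hv2 : v ^ 2 = (1 - p) / p := Real.sq_sqrt (by positivity)
  have huv : u * v = 1 := by
    rw [hu, hv, ← Real.sqrt_mul (by positivity), Real.sqrt_eq_one]
    field_simp
  have hpq : (1 - p) * u = p * v := by
    have h1 : (1 - p) * u ^ 2 = p := by rw [hu2]; field_simp
    linear_combination (-((1 - p) * u)) * huv + v * h1
  have hM1 : 1 ≤ 1 / p₀ := by rw [le_div_iff₀ hp₀]; linarith
  have hle : ∀ x : ℝ, 0 < x → x ^ 2 ≤ 1 / p₀ → x ≤ 1 / p₀ := fun x hx h => by nlinarith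
  have huM : u ≤ 1 / p₀ := hle u hu0 (by
    rw [hu2]; exact div_le_div₀ zero_le_one (by linarith) hp₀ (by linarith))
  have hvM : v ≤ 1 / p₀ := hle v hv0 (by
    rw [hv2]; exact div_le_div₀ zero_le_one (by linarith) hp₀ hp)
  have hbal : ((n : ℝ) - (k + 1)) * u = (k + 1) * v := by
    push_cast at hk
    rw [hk]
    linear_combination (n : ℝ) * hpq
  have hA : #(univ.erase i₀) = n - 1 := by simp
  have hAr : (#(univ.erase i₀) : ℝ) = n - 1 := by
    rw [hA, Nat.cast_sub (by omega), Nat.cast_one]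
  have c₁ : IsNearlyCentered (1 / p₀) u v (univ.erase i₀) (k + 1) := by
    refine ⟨hu0, hv0, huv, huM, hvM, by omega, ?_⟩
    rw [hAr]
    push_cast
    rw [show ((n : ℝ) - 1 - (k + 1)) * u - (k + 1) * v = -u by linear_combination hbal, abs_neg,
      abs_of_pos hu0]
    exact huM
  have c₀ : IsNearlyCentered (1 / p₀) u v (univ.erase i₀) k := by
    refine ⟨hu0, hv0, huv, huM, hvM, by omega, ?_⟩
    rw [hAr, show ((n : ℝ) - 1 - k) * u - k * v = v by linear_combination hbal, abs_of_pos hv0]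
    exact hvM
  have cD : ∀ i ∈ univ.erase i₀,
      IsNearlyCentered (1 / p₀) u v ((univ.erase i₀).erase i) k := fun i hi => by
    have hcard := card_erase_of_mem hi
    refine ⟨hu0, hv0, huv, huM, hvM, by omega, ?_⟩
    rw [hcard, hA, Nat.sub_sub, Nat.cast_sub (by omega)]
    push_cast
    rw [show ((n : ℝ) - 2 - k) * u - k * v = v - u by linear_combination hbal, abs_sub_comm]
    exact c₁.abs_sub_le
  have main := sq_sub_mean_sq_le (K := (d + 1) * (1 + 1 / 4)) (by omega) (by positivity) hc
    (hn₁ _ u v _ _ c₁ (by omega) c hc) (hn₁ _ u v _ _ c₀ (by omega) c hc) fun i hi =>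
      hn₁ _ u v _ _ (cD i hi) (by have := card_erase_of_mem hi; omega) _ fun S hS =>
        hc _ (hS.trans_le (card_le_card (subset_insert i S)))
  have hE : ∑ S ∈ (univ.erase i₀).powerset, c S ^ 2 = ∑ S, c S ^ 2 :=
    sum_subset (subset_univ _) fun S _ hS => by
      rw [hci S, zero_pow two_ne_zero]
      by_contra hi
      exact hS (mem_powerset.2 (subset_erase.2 ⟨subset_univ _, hi⟩))
  have huv2 : (u + v) ^ 2 = 1 / (p * (1 - p)) := by
    have : (u + v) ^ 2 = p / (1 - p) + (1 - p) / p + 2 := by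
      rw [← hu2, ← hv2]
      linear_combination 2 * huv
    rw [this]
    field_simp
    ring
  rw [hE, hAr, huv2] at main
  have hE0 : 0 ≤ ∑ S, c S ^ 2 := sum_nonneg fun _ _ => sq_nonneg _
  set E := ∑ S, c S ^ 2
  exact abs_le_of_sq_le_sq (main.trans (influence_bound_le_sq hd hn4 hp0 hq0)) (by positivity)
end
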